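/- Let N ≥ 4, λ < (N−1)²/4 and 1 < p < (N+2)/(N−2). Then there exist two distinct C² functions u₁ ≠ u₂ on the open unit ball B = {x ∈ ℝ^N : |x| < 1}, neither identically zero, each satisfying ((1−|x|²)²/4)Δu(x) + (N−2)((1−|x|²)/2)⟨x, ∇u(x)⟩ + λu(x) + |u(x)|^{p−1}u(x) = 0 for all x ∈ B, each with ∫_B u² (2/(1−|x|²))^N dx < ∞ and ∫_B |∇u|² (2/(1−|x|²))^{N−2} dx < ∞, and each sign-changing and non-radial, i.e., each u_i takes both positive and negative values and there exist x, y ∈ B with |x| = |y| and u_i(x) ≠ u_i(y). -/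

import Mathlib

open scoped RealInnerProductSpace

/-- The Euclidean Laplacian of `u : ℝ^N → ℝ` at `x`: the sum of second partial derivatives. -/
noncomputable def lap {N : ℕ} (u : EuclideanSpace ℝ (Fin N) → ℝ)
    (x : EuclideanSpace ℝ (Fin N)) : ℝ :=
  ∑ i : Fin N,
    fderiv ℝ (fun y => fderiv ℝ u y (EuclideanSpace.single i 1)) x (EuclideanSpace.single i 1)

section

open Set Filter Topology
open scoped RealInnerProductSpace

section AbstractMinimization

variable {X Y : Type*} [NormedAddCommGroup X] [InnerProductSpace ℝ X]
  [NormedAddCommGroup Y] [NormedSpace ℝ Y]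

theorem exists_norm_minimizer [CompleteSpace X] (ι : X →L[ℝ] Y)
    (hcomp : ∀ (x : ℕ → X) (C : ℝ), (∀ n, ‖x n‖ ≤ C) →
      ∃ k : ℕ → ℕ, StrictMono k ∧ CauchySeq fun n => ι (x (k n)))
    (hne : ∃ x, ι x ≠ 0) : ∃ h, ‖ι h‖ = 1 ∧ ∀ x, ‖h‖ * ‖ι x‖ ≤ ‖x‖ := by
  set S : Set ℝ := {r | ∃ x, ‖ι x‖ = 1 ∧ ‖x‖ = r} with hS
  have hSne : S.Nonempty := by
    obtain ⟨x, hx⟩ := hne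
    refine ⟨_, ‖ι x‖⁻¹ • x, ?_, rfl⟩
    rw [map_smul, norm_smul, norm_inv, norm_norm, inv_mul_cancel₀ (norm_ne_zero_iff.2 hx)]
  have hSb : BddBelow S := ⟨0, by rintro _ ⟨x, -, rfl⟩; exact norm_nonneg x⟩
  set m := sInf S with hm
  have hm0 : 0 ≤ m := le_csInf hSne (by rintro _ ⟨x, -, rfl⟩; exact norm_nonneg x)
  have hmin : ∀ x, m * ‖ι x‖ ≤ ‖x‖ := by
    intro x
    by_cases hx : ι x = 0
    · simp [hx]
    have hx' := norm_ne_zero_iff.2 hx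
    have : m ≤ ‖‖ι x‖⁻¹ • x‖ := csInf_le hSb
      ⟨_, by rw [map_smul, norm_smul, norm_inv, norm_norm, inv_mul_cancel₀ hx'], rfl⟩
    rw [norm_smul, norm_inv, norm_norm, ← div_eq_inv_mul, le_div_iff₀ (by positivity)] at this
    exact this
  have hseq : ∀ n : ℕ, ∃ x, ‖ι x‖ = 1 ∧ ‖x‖ < m + 1 / (n + 1 : ℝ) := by
    intro n
    obtain ⟨_, ⟨x, hx, rfl⟩, h⟩ := exists_lt_of_csInf_lt hSne
      (show sInf S < m + 1 / (n + 1 : ℝ) by rw [← hm]; exact lt_add_of_pos_right _ (by positivity))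
    exact ⟨x, hx, h⟩
  choose x hx1 hxm using hseq
  obtain ⟨k, hk, hC⟩ := hcomp x (m + 1) fun n => (hxm n).le.trans (by
    gcongr; rw [div_le_one (by positivity)]; linarith [n.cast_nonneg (α := ℝ)])
  have hkm : Tendsto (fun n => ‖x (k n)‖) atTop (𝓝 m) := by
    have h1 : Tendsto (fun n : ℕ => m + 1 / (n + 1 : ℝ)) atTop (𝓝 m) := by
      simpa using tendsto_one_div_add_atTop_nhds_zero_nat.const_add m
    refine tendsto_of_tendsto_of_tendsto_of_le_of_le tendsto_const_nhds
      (h1.comp hk.tendsto_atTop) (fun n => ?_) fun n => (hxm _).le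
    have := hmin (x (k n))
    rwa [hx1, mul_one] at this
  have hcauchy : CauchySeq fun n => x (k n) := by
    rw [Metric.cauchySeq_iff] at hC ⊢
    intro ε hε
    obtain ⟨η, hη, hη1, hηε⟩ : ∃ η : ℝ, 0 < η ∧ η < 1 ∧ 4 * (m + η) ^ 2 - m ^ 2 * (2 - η) ^ 2 < ε ^ 2 := by
      have : ContinuousAt (fun η : ℝ => 4 * (m + η) ^ 2 - m ^ 2 * (2 - η) ^ 2) 0 := by fun_prop
      have h2 := this.eventually_lt_const (u := ε ^ 2) (by ring_nf; positivity)
      obtain ⟨η, h5, h3, h4⟩ := ((h2.filter_mono (nhdsWithin_le_nhds (s := Ioi 0))).and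
        (Ioo_mem_nhdsGT (show (0:ℝ) < 1 by norm_num))).exists
      exact ⟨η, h3, h4, h5⟩
    obtain ⟨n0, h0⟩ := hC η hη
    obtain ⟨n1, h1⟩ := eventually_atTop.1 (hkm.eventually_lt_const (u := m + η) (by linarith))
    refine ⟨max n0 n1, fun a ha b hb => ?_⟩
    have e0 := h0 a (le_of_max_le_left ha) b (le_of_max_le_left hb)
    have ea := h1 a (le_of_max_le_right ha)
    have eb := h1 b (le_of_max_le_right hb)
    rw [dist_eq_norm] at e0 ⊢
    have hs : 2 - η ≤ ‖ι (x (k a) + x (k b))‖ := by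
      have h6 : ι (x (k a) + x (k b)) = (2:ℝ) • ι (x (k a)) - (ι (x (k a)) - ι (x (k b))) := by
        rw [map_add, two_smul]; abel
      have h7 := norm_sub_norm_le ((2:ℝ) • ι (x (k a))) (ι (x (k a)) - ι (x (k b)))
      rw [h6]
      rw [norm_smul, hx1] at h7
      norm_num at h7
      linarith
    have hs2 : m * (2 - η) ≤ ‖x (k a) + x (k b)‖ :=
      (mul_le_mul_of_nonneg_left hs hm0).trans (hmin _)
    have hpar := parallelogram_law_with_norm ℝ (x (k a)) (x (k b))
    have h8 : (m * (2 - η)) ^ 2 ≤ ‖x (k a) + x (k b)‖ ^ 2 := by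
      gcongr
      exact mul_nonneg hm0 (by linarith)
    have h9 : ‖x (k a)‖ ^ 2 ≤ (m + η) ^ 2 := by gcongr
    have h10 : ‖x (k b)‖ ^ 2 ≤ (m + η) ^ 2 := by gcongr
    exact lt_of_pow_lt_pow_left₀ 2 hε.le (by nlinarith)
  obtain ⟨h, hh⟩ := cauchySeq_tendsto_of_complete hcauchy
  have hn : ‖h‖ = m := tendsto_nhds_unique hh.norm hkm
  refine ⟨h, ?_, hn ▸ hmin⟩
  refine tendsto_nhds_unique ((ι.continuous.tendsto h).comp hh).norm ?_
  simp [hx1]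

theorem inner_eq_of_norm_minimizer (ι : X →L[ℝ] Y) {h : X} (hmin : ∀ x, ‖h‖ * ‖ι x‖ ≤ ‖x‖)
    (f : Y →L[ℝ] ℝ) (hf : ∀ y, |f y| ≤ ‖y‖) (hfh : f (ι h) = 1) (x : X) :
    ⟪h, x⟫ = ‖h‖ ^ 2 * f (ι x) := by
  have key : ∀ t : ℝ, 0 ≤ (‖x‖ ^ 2 - ‖h‖ ^ 2 * f (ι x) ^ 2) * (t * t) +
      (2 * (⟪h, x⟫ - ‖h‖ ^ 2 * f (ι x))) * t + 0 := by
    intro t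
    have h1 : (‖h‖ * |f (ι (h + t • x))|) ^ 2 ≤ ‖h + t • x‖ ^ 2 := by
      have := (mul_le_mul_of_nonneg_left (hf (ι (h + t • x))) (norm_nonneg h)).trans (hmin _)
      gcongr
    rw [mul_pow, sq_abs, map_add, map_smul, map_add, map_smul, hfh, norm_add_sq_real,
      real_inner_smul_right, norm_smul, mul_pow, Real.norm_eq_abs, sq_abs, smul_eq_mul] at h1
    nlinarith
  have := discrim_le_zero key
  unfold discrim at this
  have h2 : (2 * (⟪h, x⟫ - ‖h‖ ^ 2 * f (ι x))) ^ 2 = 0 := le_antisymm (by linarith) (sq_nonneg _)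
  have := pow_eq_zero_iff (two_ne_zero) |>.1 h2
  linarith

theorem exists_norm_minimizer_mem [CompleteSpace X] (ι : X →L[ℝ] Y) (G : Submodule ℝ X)
    (hG : IsClosed (G : Set X))
    (hcomp : ∀ (x : ℕ → X) (C : ℝ), (∀ n, x n ∈ G) → (∀ n, ‖x n‖ ≤ C) →
      ∃ k : ℕ → ℕ, StrictMono k ∧ CauchySeq fun n => ι (x (k n)))
    (hne : ∃ x ∈ G, ι x ≠ 0) :
    ∃ h ∈ G, ‖ι h‖ = 1 ∧ ∀ f : Y →L[ℝ] ℝ, (∀ y, |f y| ≤ ‖y‖) → f (ι h) = 1 →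
      ∀ x ∈ G, ⟪h, x⟫ = ‖h‖ ^ 2 * f (ι x) := by
  have : CompleteSpace G := hG.isComplete.completeSpace_coe
  obtain ⟨x₀, hx₀, hx₀'⟩ := hne
  obtain ⟨h, hh1, hmin⟩ := exists_norm_minimizer (ι.comp G.subtypeL)
    (fun x C hC => hcomp (fun n => G.subtypeL (x n)) C (fun n => Submodule.coe_mem _) hC) ⟨⟨x₀, hx₀⟩, hx₀'⟩
  exact ⟨h, h.2, hh1, fun f hf hfh x hx =>
    inner_eq_of_norm_minimizer (ι.comp G.subtypeL) hmin f hf hfh ⟨x, hx⟩⟩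

end AbstractMinimization

section SymmetricCriticality

variable {V Y D S : Type*} [NormedAddCommGroup V] [InnerProductSpace ℝ V]
  [NormedAddCommGroup Y] [NormedSpace ℝ Y] {H : Submodule ℝ V} {J : D → V}
  {U : S → V →ₗᵢ[ℝ] V} {sgn : S → ℝ}

variable [CompleteSpace V] in
theorem inner_eq_of_symmetric_critical (hH : IsClosed (H : Set V)) (hJ : ∀ d, J d ∈ H)
    (hdense : ∀ a, (∀ d, ⟪J d, a⟫ = 0) → ∀ h ∈ H, ⟪h, a⟫ = 0)
    (hUH : ∀ s, ∀ x ∈ H, U s x ∈ H) (hUJ : ∀ s d, ∃ d', J d = U s (J d'))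
    (hsgn : ∀ s, sgn s * sgn s = 1) (g : H →L[ℝ] ℝ)
    (hg : ∀ s (x : H), g ⟨U s x, hUH s x x.2⟩ = sgn s * g x) {h : V} {m : ℝ} (hhH : h ∈ H)
    (hh : ∀ s, U s h = sgn s • h)
    (hcrit : ∀ x : H, (∀ s, U s x = sgn s • (x : V)) → ⟪h, x⟫ = m * g x) (x : H) :
    ⟪h, x⟫ = m * g x := by
  have : CompleteSpace H := hH.isComplete.completeSpace_coe
  set z : H := (InnerProductSpace.toDual ℝ H).symm g with hz
  have hzg : ∀ x : H, ⟪(z : V), (x : V)⟫ = g x := fun x => by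
    rw [← Submodule.coe_inner, hz, InnerProductSpace.toDual_symm_apply]
  have hzs : ∀ s, U s z = sgn s • (z : V) := by
    intro s
    have hmem : U s z - sgn s • (z : V) ∈ H := H.sub_mem (hUH s z z.2) (H.smul_mem _ z.2)
    have h0 := hdense (U s z - sgn s • (z : V)) (fun d => ?_) _ hmem
    · rw [inner_self_eq_zero, sub_eq_zero] at h0
      exact h0
    · obtain ⟨d', hd'⟩ := hUJ s d
      have e1 : ⟪U s z, J d⟫ = g ⟨J d', hJ d'⟩ := by
        rw [hd', LinearIsometry.inner_map_map, ← hzg]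
      have e2 : ⟪(z : V), J d⟫ = sgn s * g ⟨J d', hJ d'⟩ := by
        rw [← hg, ← hzg]
        simp only [← hd']
      rw [real_inner_comm, inner_sub_left, real_inner_smul_left, e1, e2, ← mul_assoc, hsgn]
      ring
  have hsym : ∀ s, U s (h - m • (z : V)) = sgn s • (h - m • (z : V)) := fun s => by
    rw [map_sub, map_smul, hh, hzs, smul_sub, smul_comm]
  have hmem : h - m • (z : V) ∈ H := H.sub_mem hhH (H.smul_mem _ z.2)
  have h1 := hcrit ⟨_, hmem⟩ hsym
  rw [← hzg, ← real_inner_smul_left, ← sub_eq_zero, ← inner_sub_left, inner_self_eq_zero,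
    sub_eq_zero] at h1
  rw [h1, real_inner_smul_left, hzg]

/-- The vectors of `H` on which each `U s` acts as multiplication by `sgn s`. -/
def symmetricSubspace (H : Submodule ℝ V) (U : S → V →ₗᵢ[ℝ] V) (sgn : S → ℝ) : Submodule ℝ H where
  carrier := {x | ∀ s, U s x = sgn s • (x : V)}
  add_mem' := fun {a b} ha hb s => by simp [ha s, hb s]
  zero_mem' := fun s => by simp
  smul_mem' := fun t x hx s => by simp [hx s, smul_comm t]

theorem isClosed_symmetricSubspace : IsClosed (symmetricSubspace H U sgn : Set H) := by
  change IsClosed {x : H | ∀ s, U s x = sgn s • (x : V)}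
  simp only [ofPred_forall]
  exact isClosed_iInter fun s => isClosed_eq ((U s).continuous.comp continuous_subtype_val)
    (continuous_subtype_val.const_smul _)

variable [CompleteSpace V] in
theorem exists_symmetric_critical (hH : IsClosed (H : Set V)) (hJ : ∀ d, J d ∈ H)
    (hdense : ∀ a, (∀ d, ⟪J d, a⟫ = 0) → ∀ h ∈ H, ⟪h, a⟫ = 0)
    (hUH : ∀ s, ∀ x ∈ H, U s x ∈ H) (hUJ : ∀ s d, ∃ d', J d = U s (J d'))
    (hsgn : ∀ s, sgn s * sgn s = 1) (ι : H →L[ℝ] Y)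
    (hcomp : ∀ (x : ℕ → H) (C : ℝ), (∀ n s, U s (x n) = sgn s • (x n : V)) → (∀ n, ‖x n‖ ≤ C) →
      ∃ k : ℕ → ℕ, StrictMono k ∧ CauchySeq fun n => ι (x (k n)))
    (hne : ∃ x : H, (∀ s, U s x = sgn s • (x : V)) ∧ ι x ≠ 0)
    (F : Y → Y →L[ℝ] ℝ) (hF : ∀ y, ‖y‖ = 1 → ∀ y', |F y y'| ≤ ‖y'‖)
    (hF1 : ∀ y, ‖y‖ = 1 → F y y = 1)
    (hFU : ∀ x : H, (∀ s, U s x = sgn s • (x : V)) → ∀ s (x' : H),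
      F (ι x) (ι ⟨U s x', hUH s x' x'.2⟩) = sgn s * F (ι x) (ι x')) :
    ∃ h : H, (∀ s, U s h = sgn s • (h : V)) ∧ ‖ι h‖ = 1 ∧
      ∀ x : H, ⟪(h : V), x⟫ = ‖h‖ ^ 2 * F (ι h) (ι x) := by
  have : CompleteSpace H := hH.isComplete.completeSpace_coe
  obtain ⟨h, hG, hh1, hmin⟩ := exists_norm_minimizer_mem ι (symmetricSubspace H U sgn)
    isClosed_symmetricSubspace hcomp hne
  refine ⟨h, hG, hh1, ?_⟩
  exact inner_eq_of_symmetric_critical hH hJ hdense hUH hUJ hsgn ((F (ι h)).comp ι) (hFU h hG) h.2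
    hG fun x hx => hmin (F (ι h)) (hF _ hh1) (hF1 _ hh1) x hx

end SymmetricCriticality

end

section

open MeasureTheory Set
open scoped ENNReal RealInnerProductSpace ContDiff

/-- A smooth radial mollifier `η` together with a radial potential `ζ` such that
`∇ζ(z) = -η(z) z`. -/
theorem exists_radial_mollifier (E : Type*) [NormedAddCommGroup E] [InnerProductSpace ℝ E]
    [FiniteDimensional ℝ E] [MeasurableSpace E] [BorelSpace E] (μ : Measure E)
    [μ.IsAddHaarMeasure] :
    ∃ η ζ : E → ℝ, ContDiff ℝ ∞ η ∧ ContDiff ℝ ∞ ζ ∧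
      (∀ z, 1 ≤ ‖z‖ → η z = 0) ∧ (∀ z, 1 ≤ ‖z‖ → ζ z = 0) ∧
      (∀ z, η (-z) = η z) ∧ (∀ z, ζ (-z) = ζ z) ∧ ∫ z, η z ∂μ = 1 ∧
      ∀ z v, fderiv ℝ ζ z v = -(η z * ⟪z, v⟫) := by
  let b : ContDiffBump (0 : ℝ) := ⟨1 / 2, 1, by norm_num, by norm_num⟩
  have hbs : ContDiff ℝ ∞ b := b.contDiff
  have hb1 : ∀ s : ℝ, 1 ≤ s → b s = 0 := fun s hs =>
    b.zero_of_le_dist (by simpa [Real.dist_eq] using hs.trans (le_abs_self s))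
  let P : ℝ → ℝ := fun s => ∫ t in s..1, b t
  have hP : ∀ s, HasDerivAt P (-b s) s := fun s =>
    intervalIntegral.integral_hasDerivAt_left (b.continuous.intervalIntegrable _ _)
      (b.continuous.stronglyMeasurableAtFilter _ _) b.continuous.continuousAt
  have hPs : ContDiff ℝ ∞ P := by
    rw [contDiff_infty_iff_deriv]
    refine ⟨fun s => (hP s).differentiableAt, ?_⟩
    have : deriv P = fun s => -b s := funext fun s => (hP s).deriv
    rw [this]
    exact hbs.neg
  have hP1 : ∀ s, 1 ≤ s → P s = 0 := by
    intro s hs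
    have : P s = ∫ t in s..1, (0 : ℝ) := by
      refine intervalIntegral.integral_congr fun t ht => hb1 t ?_
      rw [uIcc_of_ge hs] at ht
      exact ht.1
    simpa using this
  have hq : ∀ z : E, HasFDerivAt (fun z : E => ‖z‖ ^ 2) (2 • innerSL ℝ z) z := fun z =>
    (hasStrictFDerivAt_norm_sq z).hasFDerivAt
  have hqs : ContDiff ℝ ∞ fun z : E => ‖z‖ ^ 2 := contDiff_norm_sq ℝ
  have hsq : ∀ z : E, 1 ≤ ‖z‖ → 1 ≤ ‖z‖ ^ 2 := fun z hz => one_le_pow₀ hz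
  have hcont : Continuous fun z : E => b (‖z‖ ^ 2) := b.continuous.comp hqs.continuous
  have hcs : HasCompactSupport fun z : E => b (‖z‖ ^ 2) := by
    refine HasCompactSupport.of_support_subset_isCompact (isCompact_closedBall (0 : E) 1) ?_
    intro z hz
    by_contra hz'
    rw [mem_closedBall_zero_iff, not_le] at hz'
    exact hz (hb1 _ (hsq z hz'.le))
  have hpos : 0 < ∫ z, b (‖z‖ ^ 2) ∂μ := by
    refine hcont.integral_pos_of_hasCompactSupport_nonneg_nonzero hcs (fun z => b.nonneg) (x := 0) ?_
    have : b (‖(0 : E)‖ ^ 2) = 1 := by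
      apply b.one_of_mem_closedBall
      simp [b]
    rw [this]; exact one_ne_zero
  set c := ∫ z, b (‖z‖ ^ 2) ∂μ
  refine ⟨fun z => c⁻¹ * b (‖z‖ ^ 2), fun z => c⁻¹ * (P (‖z‖ ^ 2) * 2⁻¹), ?_, ?_, ?_, ?_, ?_, ?_, ?_, ?_⟩
  · exact contDiff_const.mul (hbs.comp hqs)
  · exact contDiff_const.mul ((hPs.comp hqs).mul contDiff_const)
  · intro z hz; simp [hb1 _ (hsq z hz)]
  · intro z hz; simp [hP1 _ (hsq z hz)]
  · intro z; simp
  · intro z; simp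
  · rw [integral_const_mul, inv_mul_cancel₀ hpos.ne']
  · intro z v
    have h0 : HasFDerivAt (fun z : E => P (‖z‖ ^ 2)) (-b (‖z‖ ^ 2) • 2 • innerSL ℝ z) z :=
      HasDerivAt.comp_hasFDerivAt (h₂ := P) z (hP (‖z‖ ^ 2)) (hq z)
    have h1 := (h0.mul_const 2⁻¹).const_mul c⁻¹
    rw [h1.fderiv]
    simp
    ring

/-- The kernel `k(y) = ∫₀ᴿ t^{1-N} ζ(y/t) dt`, a truncated Newtonian potential. -/
noncomputable def potKernel {N : ℕ} (ζ : EuclideanSpace ℝ (Fin N) → ℝ) (R : ℝ)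
    (y : EuclideanSpace ℝ (Fin N)) : ℝ :=
  ∫ t in Ioo 0 R, t * (t⁻¹) ^ N * ζ (t⁻¹ • y)

section Kernel

variable {N : ℕ} {ζ : EuclideanSpace ℝ (Fin N) → ℝ} {R : ℝ}

theorem potKernel_neg (hζ : ∀ z, ζ (-z) = ζ z) (y : EuclideanSpace ℝ (Fin N)) :
    potKernel ζ R (-y) = potKernel ζ R y := by
  simp [potKernel, hζ]

theorem measurable_potKernel (hζ : Continuous ζ) : Measurable (potKernel ζ R) := by
  have : StronglyMeasurable fun q : EuclideanSpace ℝ (Fin N) × ℝ =>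
      q.2 * (q.2⁻¹) ^ N * ζ (q.2⁻¹ • q.1) := by
    apply Measurable.stronglyMeasurable
    exact (measurable_snd.mul (measurable_snd.inv.pow_const _)).mul
      (hζ.measurable.comp (measurable_snd.inv.smul measurable_fst))
  exact (this.integral_prod_right (ν := volume.restrict (Ioo 0 R))).measurable

theorem potKernel_eq_zero (hζ : ∀ z, 1 ≤ ‖z‖ → ζ z = 0) {y : EuclideanSpace ℝ (Fin N)}
    (hy : R ≤ ‖y‖) : potKernel ζ R y = 0 := by
  have : potKernel ζ R y = ∫ t in Ioo 0 R, (0 : ℝ) := by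
    refine setIntegral_congr_fun measurableSet_Ioo fun t ht => ?_
    have : 1 ≤ ‖t⁻¹ • y‖ := by
      rw [norm_smul, Real.norm_of_nonneg (inv_nonneg.2 ht.1.le), inv_mul_eq_div,
        le_div_iff₀ ht.1]
      linarith [ht.2]
    simp [hζ _ this]
  simpa using this

theorem norm_potKernel_le (hN : 3 ≤ N) (hζ : ∀ z, 1 ≤ ‖z‖ → ζ z = 0) {C : ℝ}
    (hC : ∀ z, |ζ z| ≤ C) {y : EuclideanSpace ℝ (Fin N)} (hy : y ≠ 0) :
    ‖potKernel ζ R y‖ ≤ C * ‖y‖ ^ (-((N : ℝ) - 2)) := by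
  have hy0 : 0 < ‖y‖ := norm_pos_iff.2 hy
  have hN' : (3 : ℝ) ≤ N := by exact_mod_cast hN
  have hC0 : 0 ≤ C := (abs_nonneg _).trans (hC 0)
  have hlt : (1 - N : ℝ) < -1 := by linarith
  have hint : IntegrableOn (fun t : ℝ => C * t ^ (1 - N : ℝ)) (Ioi ‖y‖) :=
    (integrableOn_Ioi_rpow_of_lt hlt hy0).const_mul C
  have h1 : potKernel ζ R y = ∫ t in Ioo ‖y‖ R, t * (t⁻¹) ^ N * ζ (t⁻¹ • y) := by
    refine setIntegral_eq_of_subset_of_forall_sdiff_eq_zero measurableSet_Ioo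
      (Ioo_subset_Ioo_left hy0.le) (fun t ht => ?_)
    have ht0 : 0 < t := ht.1.1
    have hty : t ≤ ‖y‖ := by
      by_contra h
      exact ht.2 ⟨not_le.1 h, ht.1.2⟩
    have : 1 ≤ ‖t⁻¹ • y‖ := by
      rw [norm_smul, Real.norm_of_nonneg (inv_nonneg.2 ht0.le), inv_mul_eq_div, le_div_iff₀ ht0]
      linarith
    simp [hζ _ this]
  have hpt : ∀ t : ℝ, 0 < t → ‖t * (t⁻¹) ^ N * ζ (t⁻¹ • y)‖ ≤ C * t ^ (1 - N : ℝ) := by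
    intro t ht
    have : t * (t⁻¹) ^ N = t ^ (1 - N : ℝ) := by
      rw [Real.rpow_sub ht, Real.rpow_one, Real.rpow_natCast, inv_pow, div_eq_mul_inv]
    rw [norm_mul, this, Real.norm_of_nonneg (Real.rpow_nonneg ht.le _), mul_comm]
    exact mul_le_mul_of_nonneg_right (hC _) (Real.rpow_nonneg ht.le _)
  rw [h1]
  calc ‖∫ t in Ioo ‖y‖ R, t * (t⁻¹) ^ N * ζ (t⁻¹ • y)‖
      ≤ ∫ t in Ioo ‖y‖ R, C * t ^ (1 - N : ℝ) := by
        refine norm_integral_le_of_norm_le (hint.mono_set Ioo_subset_Ioi_self) ?_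
        exact (ae_restrict_mem measurableSet_Ioo).mono fun t ht => hpt t (hy0.trans ht.1)
    _ ≤ ∫ t in Ioi ‖y‖, C * t ^ (1 - N : ℝ) := by
        refine setIntegral_mono_set hint ?_ Ioo_subset_Ioi_self.eventuallyLE
        exact (ae_restrict_mem measurableSet_Ioi).mono fun t ht =>
          mul_nonneg hC0 (Real.rpow_nonneg (hy0.trans ht).le _)
    _ = C * (‖y‖ ^ (-((N : ℝ) - 2)) / (N - 2)) := by
        rw [integral_const_mul, integral_Ioi_rpow_of_lt hlt hy0]
        have e : (1 - N : ℝ) + 1 = -((N : ℝ) - 2) := by ring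
        rw [e, neg_div_neg_eq]
    _ ≤ C * ‖y‖ ^ (-((N : ℝ) - 2)) := by
        refine mul_le_mul_of_nonneg_left (div_le_self (Real.rpow_nonneg hy0.le _) ?_) hC0
        linarith

theorem integrable_norm_potKernel_rpow (hN : 3 ≤ N) (hζc : Continuous ζ)
    (hζ : ∀ z, 1 ≤ ‖z‖ → ζ z = 0) {r : ℝ} (hr : 0 < r) (hrN : ((N : ℝ) - 2) * r < N) :
    Integrable fun y => ‖potKernel ζ R y‖ ^ r := by
  obtain ⟨C, hC⟩ : ∃ C, ∀ z, |ζ z| ≤ C := by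
    obtain ⟨C, hC⟩ := (isCompact_closedBall (0 : EuclideanSpace ℝ (Fin N)) 1).exists_bound_of_continuousOn
      hζc.continuousOn
    refine ⟨max C 0, fun z => ?_⟩
    by_cases hz : ‖z‖ ≤ 1
    · exact (hC z (by simpa using hz)).trans (le_max_left _ _)
    · rw [hζ z (not_le.1 hz).le]; simp
  have hC0 : 0 ≤ C := (abs_nonneg _).trans (hC 0)
  have hm : Measurable fun y => ‖potKernel ζ R y‖ ^ r := (measurable_potKernel hζc).norm.pow_const r
  have : IntegrableOn (fun y => ‖potKernel ζ R y‖ ^ r) (Metric.ball 0 R) := by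
    refine integrableOn_ball_of_norm_le_rpow (C := C ^ r) (α := (N - 2) * r) ?_ ?_ ?_ ?_
    · simp; omega
    · simpa using hrN
    · refine (ae_restrict_of_ae ?_)
      have : ∀ᵐ y : EuclideanSpace ℝ (Fin N), y ≠ 0 := by
        have : Nonempty (Fin N) := ⟨⟨0, by omega⟩⟩
        have : Nontrivial (EuclideanSpace ℝ (Fin N)) := by
          apply Module.nontrivial_of_finrank_pos (R := ℝ); simp; omega
        exact (measure_eq_zero_iff_ae_notMem.1 (measure_singleton (0 : EuclideanSpace ℝ (Fin N))))
      filter_upwards [this] with y hy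
      have := norm_potKernel_le (R := R) hN hζ hC hy
      rw [Real.norm_of_nonneg (by positivity)]
      refine (Real.rpow_le_rpow (norm_nonneg _) this hr.le).trans_eq ?_
      rw [Real.mul_rpow hC0 (by positivity), ← Real.rpow_mul (norm_nonneg _)]
      ring_nf
    · exact hm.aestronglyMeasurable
  refine (integrableOn_iff_integrable_of_support_subset ?_).1 this
  intro y hy
  by_contra h
  refine hy ?_
  simp only [Metric.mem_ball, dist_zero_right, not_lt] at h
  simp [potKernel_eq_zero hζ h, hr.ne']

theorem integrable_potKernel (hN : 3 ≤ N) (hζc : Continuous ζ)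
    (hζ : ∀ z, 1 ≤ ‖z‖ → ζ z = 0) : Integrable (potKernel ζ R) := by
  have := integrable_norm_potKernel_rpow (R := R) hN hζc hζ one_pos (by linarith)
  simp only [Real.rpow_one] at this
  exact (integrable_norm_iff (measurable_potKernel hζc).aestronglyMeasurable).1 this

end Kernel

end

section

open MeasureTheory Set
open scoped ENNReal RealInnerProductSpace ContDiff Convolution

section Kernel

variable {N : ℕ} {ζ : EuclideanSpace ℝ (Fin N) → ℝ} {R : ℝ}

/-- Integrability over `(0,R) × ℝᴺ` of a rescaled profile. -/
theorem integrable_scaled_prod {F : Type*} [NormedAddCommGroup F] [NormedSpace ℝ F]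
    {Z : EuclideanSpace ℝ (Fin N) → F}
    (hZ : Integrable Z) (hZc : Continuous Z) {a : ℝ → ℝ} (ha : Measurable a)
    (ha' : IntegrableOn a (Ioo 0 R)) :
    Integrable (fun q : EuclideanSpace ℝ (Fin N) × ℝ => (a q.2 * (q.2⁻¹) ^ N) • Z (q.2⁻¹ • q.1))
      (volume.prod (volume.restrict (Ioo 0 R))) := by
  borelize F
  have hm : StronglyMeasurable (fun q : EuclideanSpace ℝ (Fin N) × ℝ =>
      (a q.2 * (q.2⁻¹) ^ N) • Z (q.2⁻¹ • q.1)) := by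
    refine Measurable.stronglyMeasurable (f := fun q : EuclideanSpace ℝ (Fin N) × ℝ =>
      (a q.2 * (q.2⁻¹) ^ N)) ((ha.comp measurable_snd).mul (measurable_snd.inv.pow_const _)) |>.smul ?_
    exact hZc.stronglyMeasurable.comp_measurable (measurable_snd.inv.smul measurable_fst)
  rw [integrable_prod_iff' hm.aestronglyMeasurable]
  constructor
  · filter_upwards [ae_restrict_mem measurableSet_Ioo] with t ht
    exact (hZ.comp_smul (inv_ne_zero ht.1.ne')).smul _
  · have : IntegrableOn (fun t => |a t| * ∫ z, ‖Z z‖) (Ioo 0 R) := ha'.abs.mul_const _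
    refine this.congr ?_
    filter_upwards [ae_restrict_mem measurableSet_Ioo] with t ht
    simp only [norm_smul, norm_mul, integral_const_mul]
    rw [Measure.integral_comp_inv_smul_of_nonneg volume (fun z => ‖Z z‖) ht.1.le]
    simp only [finrank_euclideanSpace, Fintype.card_fin, smul_eq_mul, Real.norm_eq_abs, abs_pow,
      abs_inv, abs_of_pos ht.1]
    have h0 : (t⁻¹) ^ N * t ^ N = 1 := by rw [← mul_pow, inv_mul_cancel₀ ht.1.ne', one_pow]
    linear_combination (-|a t| * ∫ z, ‖Z z‖) * h0

theorem integrable_of_norm_ge_one_eq_zero {F : Type*} [NormedAddCommGroup F]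
    {Z : EuclideanSpace ℝ (Fin N) → F} (hZc : Continuous Z) (hZ : ∀ z, 1 ≤ ‖z‖ → Z z = 0) :
    HasCompactSupport Z ∧ Integrable Z := by
  have : HasCompactSupport Z := HasCompactSupport.of_support_subset_isCompact
    (isCompact_closedBall (0 : EuclideanSpace ℝ (Fin N)) 1) fun z hz => by
      by_contra h
      simp only [Metric.mem_closedBall, dist_zero_right, not_le] at h
      exact hz (hZ z h.le)
  exact ⟨this, hZc.integrable_of_hasCompactSupport this⟩

variable {F : Type*} [NormedAddCommGroup F] [NormedSpace ℝ F]
  {f : EuclideanSpace ℝ (Fin N) → F} {M : ℝ}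

theorem measurePreserving_sub_left' (x : EuclideanSpace ℝ (Fin N)) :
    MeasurePreserving (fun y => x - y) :=
  ⟨measurable_id.const_sub x, Measure.map_sub_left_eq_self volume x⟩

theorem aestronglyMeasurable_comp_sub (hf : AEStronglyMeasurable f) (x : EuclideanSpace ℝ (Fin N)) :
    AEStronglyMeasurable (fun y => f (x - y)) :=
  hf.comp_measurePreserving (measurePreserving_sub_left' x)

theorem ae_comp_sub (hM : ∀ᵐ x, ‖f x‖ ≤ M) (x : EuclideanSpace ℝ (Fin N)) :
    ∀ᵐ y, ‖f (x - y)‖ ≤ M :=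
  (measurePreserving_sub_left' x).quasiMeasurePreserving.ae hM

theorem potKernel_convolution_eq [CompleteSpace F] (hζc : Continuous ζ)
    (hζ : ∀ z, 1 ≤ ‖z‖ → ζ z = 0) (hf : AEStronglyMeasurable f) (hM : ∀ᵐ x, ‖f x‖ ≤ M)
    (x : EuclideanSpace ℝ (Fin N)) :
    IntegrableOn (fun t : ℝ => ∫ y, (t * (t⁻¹) ^ N * ζ (t⁻¹ • y)) • f (x - y)) (Ioo 0 R) ∧
    ∫ y, potKernel ζ R y • f (x - y) =
      ∫ t in Ioo 0 R, ∫ y, (t * (t⁻¹) ^ N * ζ (t⁻¹ • y)) • f (x - y) := by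
  have h1 := integrable_scaled_prod (R := R) (integrable_of_norm_ge_one_eq_zero hζc hζ).2 hζc
    (a := fun t => t) measurable_id (continuous_id.integrableOn_Icc.mono_set Ioo_subset_Icc_self)
  have h2 : Integrable (fun q : EuclideanSpace ℝ (Fin N) × ℝ =>
      (q.2 * (q.2⁻¹) ^ N * ζ (q.2⁻¹ • q.1)) • f (x - q.1))
      (volume.prod (volume.restrict (Ioo 0 R))) :=
    h1.smul_bdd M (aestronglyMeasurable_comp_sub hf x).comp_fst
      (Measure.quasiMeasurePreserving_fst.ae (ae_comp_sub hM x))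
  refine ⟨h2.integral_prod_right, ?_⟩
  rw [← integral_integral_swap h2]
  refine integral_congr_ae (Filter.Eventually.of_forall fun y => ?_)
  simp only [potKernel]
  rw [integral_smul_const]

theorem potKernel_convolution_contDiff_one [CompleteSpace F] (hζc : ContDiff ℝ 1 ζ)
    (hζ : ∀ z, 1 ≤ ‖z‖ → ζ z = 0) (hf : AEStronglyMeasurable f) (hM : ∀ᵐ x, ‖f x‖ ≤ M) :
    ContDiff ℝ 1 (potKernel ζ R ⋆[ContinuousLinearMap.lsmul ℝ ℝ, volume] f) := by
  let L : ℝ →L[ℝ] F →L[ℝ] F := ContinuousLinearMap.lsmul ℝ ℝ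
  let Z : ℝ → (EuclideanSpace ℝ (Fin N)) → ℝ := fun t y => t * (t⁻¹) ^ N * ζ (t⁻¹ • y)
  have hcs := (integrable_of_norm_ge_one_eq_zero hζc.continuous hζ).1
  have hfc : Continuous (fderiv ℝ ζ) := hζc.continuous_fderiv one_ne_zero
  have hZs : ∀ t ∈ Ioo 0 R, HasCompactSupport (Z t) := fun t ht =>
    (hcs.comp_smul (inv_ne_zero ht.1.ne')).mul_left
  have hZc : ∀ t, ContDiff ℝ 1 (Z t) := fun t =>
    contDiff_const.mul (hζc.comp (contDiff_const_smul _))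
  have hZd : ∀ t ∈ Ioo 0 R, ∀ y, fderiv ℝ (Z t) y = (1 * (t⁻¹) ^ N) • fderiv ℝ ζ (t⁻¹ • y) := by
    intro t ht y
    have h1 : HasFDerivAt (fun y : (EuclideanSpace ℝ (Fin N)) => t⁻¹ • y) (t⁻¹ • ContinuousLinearMap.id ℝ (EuclideanSpace ℝ (Fin N))) y :=
      (hasFDerivAt_id y).const_smul t⁻¹
    have h2 := (((hζc.differentiable one_ne_zero) (t⁻¹ • y)).hasFDerivAt.comp y h1).const_mul
      (t * (t⁻¹) ^ N)
    refine h2.fderiv.trans ?_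
    rw [ContinuousLinearMap.comp_smul, ContinuousLinearMap.comp_id, smul_smul]
    congr 1
    have := ht.1.ne'
    rw [mul_right_comm, mul_inv_cancel₀ this]
  let G : (EuclideanSpace ℝ (Fin N)) → ℝ → (EuclideanSpace ℝ (Fin N)) →L[ℝ] F := fun x t => ((fderiv ℝ (Z t)) ⋆[L.precompL (EuclideanSpace ℝ (Fin N)), volume] f) x
  have hfl : LocallyIntegrable f := (memLp_top_of_bound hf M hM).locallyIntegrable le_top
  have hder : ∀ t ∈ Ioo 0 R, ∀ x, HasFDerivAt (fun x => ∫ y, Z t y • f (x - y)) (G x t) x :=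
    fun t ht x => (hZs t ht).hasFDerivAt_convolution_left L (hZc t) hfl x
  have hcont : ∀ t ∈ Ioo 0 R, Continuous fun x => G x t := fun t ht =>
    ((hZs t ht).fderiv ℝ).continuous_convolution_left _ ((hZc t).continuous_fderiv one_ne_zero) hfl
  have hfi : Integrable (fderiv ℝ ζ) := hfc.integrable_of_hasCompactSupport (hcs.fderiv ℝ)
  have hsc := integrable_scaled_prod (R := R) hfi hfc (a := fun _ => 1) measurable_const (by simp)
  have hP : ∀ (u : EuclideanSpace ℝ (Fin N) →L[ℝ] ℝ) (v : F),
      ‖L.precompL (EuclideanSpace ℝ (Fin N)) u v‖ ≤ ‖u‖ * ‖v‖ := by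
    intro u v
    refine ContinuousLinearMap.opNorm_le_bound _ (by positivity) fun w => ?_
    rw [ContinuousLinearMap.precompL_apply]
    simp only [L, ContinuousLinearMap.lsmul_apply, norm_smul]
    calc ‖u w‖ * ‖v‖ ≤ (‖u‖ * ‖w‖) * ‖v‖ := by gcongr; exact u.le_opNorm w
      _ = _ := by ring
  have hint : ∀ x, IntegrableOn (fun t => G x t) (Ioo 0 R) := by
    intro x
    have h2 : Integrable (fun q : (EuclideanSpace ℝ (Fin N)) × ℝ =>
        L.precompL (EuclideanSpace ℝ (Fin N)) ((1 * (q.2⁻¹) ^ N) • fderiv ℝ ζ (q.2⁻¹ • q.1)) (f (x - q.1)))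
        (volume.prod (volume.restrict (Ioo 0 R))) := by
      refine Integrable.mono' (hsc.norm.mul_const M) ?_ ?_
      · exact ContinuousLinearMap.aestronglyMeasurable_comp₂ _ hsc.aestronglyMeasurable
          (aestronglyMeasurable_comp_sub hf x).comp_fst
      · filter_upwards [Measure.quasiMeasurePreserving_fst.ae (ae_comp_sub hM x)] with q hq
        exact (hP _ _).trans
          (mul_le_mul_of_nonneg_left hq (by positivity))
    refine (h2.integral_prod_right).congr ?_
    filter_upwards [ae_restrict_mem measurableSet_Ioo] with t ht
    simp only [G, convolution, hZd t ht]
  obtain ⟨B, hB⟩ : ∃ B, ∀ x, ∀ t ∈ Ioo 0 R, ‖G x t‖ ≤ B := by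
    refine ⟨(∫ z, ‖fderiv ℝ ζ z‖) * M, fun x t ht => ?_⟩
    have hi : Integrable fun y => (1 * (t⁻¹) ^ N) • fderiv ℝ ζ (t⁻¹ • y) :=
      (hfi.comp_smul (inv_ne_zero ht.1.ne')).smul (1 * (t⁻¹) ^ N)
    have : ‖G x t‖ ≤ ∫ y, ‖(1 * (t⁻¹) ^ N) • fderiv ℝ ζ (t⁻¹ • y)‖ * M := by
      refine norm_integral_le_of_norm_le (hi.norm.mul_const _) ?_
      filter_upwards [ae_comp_sub hM x] with y hy
      rw [hZd t ht]
      exact (hP _ _).trans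
          (mul_le_mul_of_nonneg_left hy (by positivity))
    refine this.trans_eq ?_
    rw [integral_mul_const]
    congr 1
    simp only [norm_smul, norm_mul, integral_const_mul]
    rw [Measure.integral_comp_inv_smul_of_nonneg volume (fun z => ‖fderiv ℝ ζ z‖) ht.1.le]
    have h0 : (t⁻¹) ^ N * t ^ N = 1 := by rw [← mul_pow, inv_mul_cancel₀ ht.1.ne', one_pow]
    simp only [finrank_euclideanSpace, Fintype.card_fin, smul_eq_mul, Real.norm_eq_abs, abs_pow,
      abs_inv, abs_of_pos ht.1, abs_one, one_mul]
    rw [← mul_assoc, h0, one_mul]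
  have hBi : IntegrableOn (fun _ => B) (Ioo 0 R) := by simp
  have hk : ∀ x, HasFDerivAt (potKernel ζ R ⋆[ContinuousLinearMap.lsmul ℝ ℝ, volume] f)
      (∫ t in Ioo 0 R, G x t) x := by
    intro x
    have := hasFDerivAt_integral_of_dominated_of_fderiv_le (μ := volume.restrict (Ioo 0 R))
      (F := fun x t => ∫ y, Z t y • f (x - y)) (F' := G) (bound := fun _ => B) (x₀ := x)
      (s := univ) Filter.univ_mem
      (Filter.Eventually.of_forall fun x =>
        (potKernel_convolution_eq hζc.continuous hζ hf hM x).1.aestronglyMeasurable)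
      (potKernel_convolution_eq hζc.continuous hζ hf hM x).1
      (hint x).aestronglyMeasurable
      ((ae_restrict_mem measurableSet_Ioo).mono fun t ht x _ => hB x t ht)
      hBi
      ((ae_restrict_mem measurableSet_Ioo).mono fun t ht x _ => hder t ht x)
    refine this.congr_of_eventuallyEq (Filter.Eventually.of_forall fun x => ?_)
    exact (potKernel_convolution_eq hζc.continuous hζ hf hM x).2
  rw [contDiff_one_iff_fderiv]
  refine ⟨fun x => (hk x).differentiableAt, ?_⟩
  have : fderiv ℝ (potKernel ζ R ⋆[ContinuousLinearMap.lsmul ℝ ℝ, volume] f) =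
      fun x => ∫ t in Ioo 0 R, G x t := funext fun x => (hk x).fderiv
  rw [this]
  exact continuous_of_dominated (fun x => (hint x).aestronglyMeasurable)
    (fun x => (ae_restrict_mem measurableSet_Ioo).mono fun t ht => hB x t ht) hBi
    ((ae_restrict_mem measurableSet_Ioo).mono fun t ht => hcont t ht)

end Kernel

section Kernel

variable {N : ℕ} {ζ : EuclideanSpace ℝ (Fin N) → ℝ} {R : ℝ}
  {F : Type*} [NormedAddCommGroup F] [NormedSpace ℝ F] [CompleteSpace F]
  {f : EuclideanSpace ℝ (Fin N) → F}

theorem hasFDerivAt_smul_convolution {k : EuclideanSpace ℝ (Fin N) → ℝ} (hk : LocallyIntegrable k)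
    (hf : ContDiff ℝ 1 f) (hfs : HasCompactSupport f) (x : EuclideanSpace ℝ (Fin N)) :
    HasFDerivAt (k ⋆[ContinuousLinearMap.lsmul ℝ ℝ, volume] f)
      ((k ⋆[ContinuousLinearMap.lsmul ℝ ℝ, volume] fderiv ℝ f) x) x :=
  hfs.hasFDerivAt_convolution_right (ContinuousLinearMap.lsmul ℝ ℝ) hk hf x

theorem fderiv_smul_convolution_apply {k : EuclideanSpace ℝ (Fin N) → ℝ} (hk : LocallyIntegrable k)
    (hf : ContDiff ℝ 1 f) (hfs : HasCompactSupport f) (x v : EuclideanSpace ℝ (Fin N)) :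
    fderiv ℝ (k ⋆[ContinuousLinearMap.lsmul ℝ ℝ, volume] f) x v =
      (k ⋆[ContinuousLinearMap.lsmul ℝ ℝ, volume] fun y => fderiv ℝ f y v) x := by
  rw [(hfs.hasFDerivAt_convolution_right (ContinuousLinearMap.lsmul ℝ ℝ) hk hf x).fderiv]
  exact convolution_precompR_apply _ hk (hfs.fderiv ℝ) (hf.continuous_fderiv one_ne_zero) x v

theorem potKernel_convolution_contDiff_two (hN : 3 ≤ N) (hζc : ContDiff ℝ 1 ζ)
    (hζ : ∀ z, 1 ≤ ‖z‖ → ζ z = 0) (hf : ContDiff ℝ 1 f) (hfs : HasCompactSupport f) :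
    ContDiff ℝ 2 (potKernel ζ R ⋆[ContinuousLinearMap.lsmul ℝ ℝ, volume] f) := by
  have hk := (integrable_potKernel (R := R) hN hζc.continuous hζ).locallyIntegrable
  have h2 : (2 : WithTop ℕ∞) = 1 + 1 := by norm_num
  rw [h2, contDiff_succ_iff_fderiv]
  refine ⟨fun x => (hasFDerivAt_smul_convolution hk hf hfs x).differentiableAt, by simp, ?_⟩
  have : fderiv ℝ (potKernel ζ R ⋆[ContinuousLinearMap.lsmul ℝ ℝ, volume] f) =
      (potKernel ζ R ⋆[ContinuousLinearMap.lsmul ℝ ℝ, volume] fderiv ℝ f) :=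
    funext fun x => (hasFDerivAt_smul_convolution hk hf hfs x).fderiv
  rw [this]
  have hc := hf.continuous_fderiv one_ne_zero
  obtain ⟨C, hC⟩ := (hfs.fderiv ℝ).exists_bound_of_continuous hc
  exact potKernel_convolution_contDiff_one hζc hζ hc.aestronglyMeasurable (ae_of_all _ hC)

theorem hasCompactSupport_fderiv_apply {f : EuclideanSpace ℝ (Fin N) → F} (hfs : HasCompactSupport f)
    (v : EuclideanSpace ℝ (Fin N)) : HasCompactSupport fun y => fderiv ℝ f y v :=
  (hfs.fderiv ℝ).comp_left (g := fun A : EuclideanSpace ℝ (Fin N) →L[ℝ] F => A v) rfl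

theorem contDiff_fderiv_apply' {f : EuclideanSpace ℝ (Fin N) → F} (hf : ContDiff ℝ 2 f)
    (v : EuclideanSpace ℝ (Fin N)) : ContDiff ℝ 1 fun y => fderiv ℝ f y v :=
  (hf.fderiv_right (m := 1) (by norm_num)).clm_apply contDiff_const

theorem continuous_lap {ψ : EuclideanSpace ℝ (Fin N) → ℝ} (hψ : ContDiff ℝ 2 ψ) :
    Continuous (lap ψ) :=
  continuous_finsetSum _ fun _ _ =>
    ((contDiff_fderiv_apply' hψ _).continuous_fderiv one_ne_zero).clm_apply continuous_const

theorem lap_eq_zero_of_notMem_tsupport {ψ : EuclideanSpace ℝ (Fin N) → ℝ}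
    {x : EuclideanSpace ℝ (Fin N)} (hx : x ∉ tsupport ψ) : lap ψ x = 0 := by
  refine Finset.sum_eq_zero fun i _ => ?_
  have h1 : (fun y => fderiv ℝ ψ y (EuclideanSpace.single i 1)) =ᶠ[nhds x] fun _ => 0 := by
    filter_upwards [(isClosed_tsupport ψ).isOpen_compl.mem_nhds hx] with y hy
    rw [image_eq_zero_of_notMem_tsupport (fun h => hy (tsupport_fderiv_subset ℝ h))]
    rfl
  rw [h1.fderiv_eq]
  simp

theorem hasCompactSupport_lap {ψ : EuclideanSpace ℝ (Fin N) → ℝ} (hψ : HasCompactSupport ψ) :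
    HasCompactSupport (lap ψ) :=
  HasCompactSupport.intro hψ fun _ hx => lap_eq_zero_of_notMem_tsupport hx

theorem lap_smul_convolution {k ψ : EuclideanSpace ℝ (Fin N) → ℝ} (hk : LocallyIntegrable k)
    (hψ : ContDiff ℝ 2 ψ) (hψs : HasCompactSupport ψ) (x : EuclideanSpace ℝ (Fin N)) :
    lap (k ⋆[ContinuousLinearMap.lsmul ℝ ℝ, volume] ψ) x =
      (k ⋆[ContinuousLinearMap.lsmul ℝ ℝ, volume] lap ψ) x := by
  have h1 : ∀ i : Fin N, (fun y => fderiv ℝ (k ⋆[ContinuousLinearMap.lsmul ℝ ℝ, volume] ψ) y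
      (EuclideanSpace.single i 1)) = (k ⋆[ContinuousLinearMap.lsmul ℝ ℝ, volume]
        fun y => fderiv ℝ ψ y (EuclideanSpace.single i 1)) := fun i =>
    funext fun y => fderiv_smul_convolution_apply hk (hψ.of_le (by norm_num)) hψs y _
  simp only [lap, h1]
  simp only [fderiv_smul_convolution_apply hk (contDiff_fderiv_apply' hψ _)
    (hasCompactSupport_fderiv_apply hψs _)]
  simp only [convolution, ContinuousLinearMap.lsmul_apply]
  simp only [lap, Finset.smul_sum]
  rw [integral_finsetSum]
  intro i _
  have := (hasCompactSupport_fderiv_apply (hasCompactSupport_fderiv_apply hψs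
    (EuclideanSpace.single i 1)) (EuclideanSpace.single i 1)).convolutionExists_right
    (ContinuousLinearMap.lsmul ℝ ℝ) hk
    (((contDiff_fderiv_apply' hψ _).continuous_fderiv one_ne_zero).clm_apply continuous_const) x
  exact this

theorem integral_fderiv_apply_smul_eq (hζc : ContDiff ℝ ∞ ζ) (hζ : ∀ z, 1 ≤ ‖z‖ → ζ z = 0)
    {η ψ : EuclideanSpace ℝ (Fin N) → ℝ}
    (hηζ : ∀ z v, fderiv ℝ ζ z v = -(η z * ⟪z, v⟫)) (hψ : ContDiff ℝ 2 ψ)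
    (x : EuclideanSpace ℝ (Fin N)) (t : ℝ) :
    ∫ z, η z * fderiv ℝ ψ (x - t • z) (-z) = ∫ z, (t * ζ z) * lap ψ (x - t • z) := by
  let e : Fin N → EuclideanSpace ℝ (Fin N) := fun i => EuclideanSpace.single i 1
  let g : Fin N → EuclideanSpace ℝ (Fin N) → ℝ := fun i z => fderiv ℝ ψ (x - t • z) (e i)
  obtain ⟨hζs, hζi⟩ := integrable_of_norm_ge_one_eq_zero hζc.continuous hζ
  have hin : ∀ z : EuclideanSpace ℝ (Fin N), z = ∑ i, ⟪z, e i⟫ • e i := by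
    intro z
    conv_lhs => rw [← (EuclideanSpace.basisFun (Fin N) ℝ).sum_repr z]
    refine Finset.sum_congr rfl fun i _ => ?_
    simp [e, EuclideanSpace.inner_single_right]
  have h1 : ∀ z, η z * fderiv ℝ ψ (x - t • z) (-z) = ∑ i, fderiv ℝ ζ z (e i) * g i z := by
    intro z
    have : fderiv ℝ ψ (x - t • z) z = ∑ i, ⟪z, e i⟫ * g i z := by
      have h := congrArg (fderiv ℝ ψ (x - t • z)) (hin z)
      rw [map_sum] at h
      simpa [g] using h
    rw [map_neg, this, mul_neg, Finset.mul_sum, ← Finset.sum_neg_distrib]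
    refine Finset.sum_congr rfl fun i _ => ?_
    rw [hηζ]; ring
  have hgc : ∀ i, ContDiff ℝ 1 (g i) := fun i =>
    (contDiff_fderiv_apply' hψ (e i)).comp (contDiff_const.sub (contDiff_const_smul t))
  have hgd : ∀ i z, fderiv ℝ (g i) z (e i) =
      -t * fderiv ℝ (fun y => fderiv ℝ ψ y (e i)) (x - t • z) (e i) := by
    intro i z
    have ha : HasFDerivAt (fun z => x - t • z) (-(t • ContinuousLinearMap.id ℝ _)) z :=
      ((hasFDerivAt_id z).const_smul t).const_sub x
    have := (((contDiff_fderiv_apply' hψ (e i)).differentiable one_ne_zero _).hasFDerivAt).comp z ha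
    rw [show fderiv ℝ (g i) z = _ from HasFDerivAt.fderiv this]
    simp
  have hζ1 : ∀ v, Continuous fun z => fderiv ℝ ζ z v := fun v =>
    (hζc.continuous_fderiv (by simp)).clm_apply continuous_const
  have hi1 : ∀ i, Integrable fun z => fderiv ℝ ζ z (e i) * g i z := fun i =>
    ((hζ1 _).mul (hgc i).continuous).integrable_of_hasCompactSupport
      (hasCompactSupport_fderiv_apply hζs (e i)).mul_right
  have hi2 : ∀ i, Integrable fun z => ζ z * fderiv ℝ (g i) z (e i) := fun i =>
    (hζc.continuous.mul (((hgc i).continuous_fderiv one_ne_zero).clm_apply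
      continuous_const)).integrable_of_hasCompactSupport hζs.mul_right
  have hi3 : ∀ i, Integrable fun z => ζ z * g i z := fun i =>
    (hζc.continuous.mul (hgc i).continuous).integrable_of_hasCompactSupport hζs.mul_right
  simp only [h1]
  rw [integral_finsetSum _ fun i _ => hi1 i]
  have h2 : ∀ i, ∫ z, fderiv ℝ ζ z (e i) * g i z = -∫ z, ζ z * fderiv ℝ (g i) z (e i) := by
    intro i
    rw [integral_mul_fderiv_eq_neg_fderiv_mul_of_integrable (hi1 i) (hi2 i) (hi3 i)
      (fun z _ => hζc.differentiable (by simp) z)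
      (fun z _ => (hgc i).differentiable one_ne_zero z), neg_neg]
  simp only [h2]
  rw [Finset.sum_neg_distrib, ← integral_finsetSum _ fun i _ => hi2 i, ← integral_neg]
  refine integral_congr_ae (ae_of_all _ fun z => ?_)
  simp only [hgd, lap, Finset.mul_sum, ← Finset.sum_neg_distrib]
  refine Finset.sum_congr rfl fun i _ => ?_
  ring

end Kernel

section Kernel

variable {N : ℕ} {ζ : EuclideanSpace ℝ (Fin N) → ℝ} {R : ℝ}

theorem potKernel_convolution_lap (hζc : ContDiff ℝ ∞ ζ) (hζ : ∀ z, 1 ≤ ‖z‖ → ζ z = 0)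
    {η ψ : EuclideanSpace ℝ (Fin N) → ℝ} (hηc : Continuous η) (hη : ∀ z, 1 ≤ ‖z‖ → η z = 0)
    (hη1 : ∫ z, η z = 1)
    (hηζ : ∀ z v, fderiv ℝ ζ z v = -(η z * ⟪z, v⟫)) (hψ : ContDiff ℝ 2 ψ)
    (hψs : HasCompactSupport ψ) (hR : 0 < R) (x : EuclideanSpace ℝ (Fin N)) :
    (potKernel ζ R ⋆[ContinuousLinearMap.lsmul ℝ ℝ, volume] lap ψ) x =
      (∫ z, η z * ψ (x - R • z)) - ψ x := by
  obtain ⟨hηs, hηi⟩ := integrable_of_norm_ge_one_eq_zero hηc hη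
  have hd1 : Continuous (fderiv ℝ ψ) := hψ.continuous_fderiv (by norm_num)
  obtain ⟨C, hC⟩ := (hψs.fderiv ℝ).exists_bound_of_continuous hd1
  have hC0 : 0 ≤ C := (norm_nonneg _).trans (hC 0)
  have hM : ∀ t : ℝ, HasDerivAt (fun t : ℝ => ∫ z, η z * ψ (x - t • z))
      (∫ z, η z * fderiv ℝ ψ (x - t • z) (-z)) t := by
    intro t
    refine (hasDerivAt_integral_of_dominated_loc_of_deriv_le
      (F := fun (t : ℝ) z => η z * ψ (x - t • z))
      (F' := fun (t : ℝ) z => η z * fderiv ℝ ψ (x - t • z) (-z)) (bound := fun z => ‖η z‖ * C)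
      (s := univ) Filter.univ_mem ?_ ?_ ?_ ?_ ?_ ?_).2
    · refine Filter.Eventually.of_forall fun t => Continuous.aestronglyMeasurable ?_
      exact hηc.mul (hψ.continuous.comp (continuous_const.sub (continuous_const_smul t)))
    · exact (hηc.mul (hψ.continuous.comp (continuous_const.sub
        (continuous_const_smul t)))).integrable_of_hasCompactSupport hηs.mul_right
    · refine Continuous.aestronglyMeasurable ?_
      exact hηc.mul ((hd1.comp (continuous_const.sub (continuous_const_smul t))).clm_apply
        continuous_neg)
    · refine ae_of_all _ fun z t _ => ?_
      rw [norm_mul]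
      by_cases hz : 1 ≤ ‖z‖
      · simp [hη z hz]
      · refine mul_le_mul_of_nonneg_left ?_ (norm_nonneg _)
        refine ((fderiv ℝ ψ (x - t • z)).le_opNorm (-z)).trans ?_
        rw [norm_neg]
        nlinarith [hC (x - t • z), norm_nonneg z, norm_nonneg (fderiv ℝ ψ (x - t • z))]
    · exact hηi.norm.mul_const C
    · refine ae_of_all _ fun z t _ => ?_
      have ha : HasDerivAt (fun t : ℝ => x - t • z) (-z) t := by
        simpa using ((hasDerivAt_id t).smul_const z).const_sub x
      exact (((hψ.differentiable (by norm_num) _).hasFDerivAt).comp_hasDerivAt t ha).const_mul _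
  simp only [integral_fderiv_apply_smul_eq hζc hζ hηζ hψ] at hM
  have hlc := continuous_lap hψ
  obtain ⟨C', hC'⟩ := (hasCompactSupport_lap hψs).exists_bound_of_continuous hlc
  obtain ⟨h1, h2⟩ := potKernel_convolution_eq (R := R) hζc.continuous hζ hlc.aestronglyMeasurable
    (ae_of_all _ hC') x
  have h3 : ∀ t ∈ Ioo 0 R, ∫ y, (t * (t⁻¹) ^ N * ζ (t⁻¹ • y)) • lap ψ (x - y) =
      ∫ z, (t * ζ z) * lap ψ (x - t • z) := by
    intro t ht
    have := Measure.integral_comp_inv_smul_of_nonneg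
      (volume : Measure (EuclideanSpace ℝ (Fin N)))
      (fun z => (t * ζ z) * lap ψ (x - t • z)) ht.1.le
    simp only [finrank_euclideanSpace, Fintype.card_fin, smul_smul, mul_inv_cancel₀ ht.1.ne',
      one_smul, smul_eq_mul] at this
    have h0 : (t⁻¹) ^ N * t ^ N = 1 := by rw [← mul_pow, inv_mul_cancel₀ ht.1.ne', one_pow]
    rw [← one_mul (∫ z, (t * ζ z) * lap ψ (x - t • z)), ← h0, mul_assoc, ← this,
      ← integral_const_mul]
    refine integral_congr_ae (ae_of_all _ fun y => ?_)
    simp only [smul_eq_mul]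
    ring
  have h4 : IntegrableOn (fun t : ℝ => ∫ z, (t * ζ z) * lap ψ (x - t • z)) (Ioo 0 R) :=
    h1.congr_fun h3 measurableSet_Ioo
  have hftc := intervalIntegral.integral_eq_sub_of_hasDerivAt (a := 0) (b := R)
    (fun t _ => hM t) ((intervalIntegrable_iff_integrableOn_Ioo_of_le hR.le).2 h4)
  rw [intervalIntegral.integral_of_le hR.le, integral_Ioc_eq_integral_Ioo] at hftc
  simp only [zero_smul, sub_zero, integral_mul_const, hη1, one_mul] at hftc
  rw [← hftc]
  refine h2.trans ?_
  exact setIntegral_congr_fun measurableSet_Ioo h3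

end Kernel

section Kernel

variable {N : ℕ}

theorem integral_mul_convolution_eq {k a ψ : EuclideanSpace ℝ (Fin N) → ℝ} (hk : Integrable k)
    (hke : ∀ y, k (-y) = k y) (ha : Integrable a) (hψ : Continuous ψ) {C : ℝ}
    (hC : ∀ x, ‖ψ x‖ ≤ C) :
    Integrable (fun x => (k ⋆[ContinuousLinearMap.lsmul ℝ ℝ, volume] a) x * ψ x) ∧
    ∫ x, a x * (k ⋆[ContinuousLinearMap.lsmul ℝ ℝ, volume] ψ) x =
      ∫ x, (k ⋆[ContinuousLinearMap.lsmul ℝ ℝ, volume] a) x * ψ x := by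
  have h1 := (hk.convolution_integrand (ContinuousLinearMap.lsmul ℝ ℝ) ha)
  have h1' : Integrable (fun q : EuclideanSpace ℝ (Fin N) × EuclideanSpace ℝ (Fin N) =>
      (k q.2 * a (q.1 - q.2)) * ψ q.1) (volume.prod volume) :=
    h1.mul_bdd (hψ.comp continuous_fst).aestronglyMeasurable (ae_of_all _ fun q => hC q.1)
  have h2 : Integrable (fun q : EuclideanSpace ℝ (Fin N) × EuclideanSpace ℝ (Fin N) =>
      (a q.1 * k q.2) * ψ (q.1 - q.2)) (volume.prod volume) :=
    (ha.mul_prod hk).mul_bdd (hψ.comp (continuous_fst.sub continuous_snd)).aestronglyMeasurable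
      (ae_of_all _ fun q => hC _)
  constructor
  · refine h1'.integral_prod_left.congr (ae_of_all _ fun x => ?_)
    simp only [integral_mul_const]
    rfl
  calc ∫ x, a x * (k ⋆[ContinuousLinearMap.lsmul ℝ ℝ, volume] ψ) x
      = ∫ x, ∫ y, (a x * k y) * ψ (x - y) := by
        refine integral_congr_ae (ae_of_all _ fun x => ?_)
        simp only [mul_assoc, integral_const_mul]
        rfl
    _ = ∫ y, ∫ x, (a x * k y) * ψ (x - y) := integral_integral_swap h2
    _ = ∫ y, ∫ x, (a x * k (-y)) * ψ (x - -y) :=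
        (integral_neg_eq_self (fun y => ∫ x, (a x * k y) * ψ (x - y)) volume).symm
    _ = ∫ y, ∫ x, (k y * a (x - y)) * ψ x := by
        refine integral_congr_ae (ae_of_all _ fun y => ?_)
        dsimp only
        rw [← integral_sub_right_eq_self _ y]
        refine integral_congr_ae (ae_of_all _ fun x => ?_)
        simp [hke, mul_comm]
    _ = ∫ x, ∫ y, (k y * a (x - y)) * ψ x := (integral_integral_swap h1').symm
    _ = _ := by
        refine integral_congr_ae (ae_of_all _ fun x => ?_)
        simp only [integral_mul_const]
        rfl

theorem weak_solution_representation (hN : 3 ≤ N) {ζ η : EuclideanSpace ℝ (Fin N) → ℝ}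
    (hζc : ContDiff ℝ ∞ ζ) (hζ : ∀ z, 1 ≤ ‖z‖ → ζ z = 0) (hζe : ∀ z, ζ (-z) = ζ z)
    (hηc : ContDiff ℝ ∞ η) (hη : ∀ z, 1 ≤ ‖z‖ → η z = 0) (hηe : ∀ z, η (-z) = η z)
    (hη1 : ∫ z, η z = 1) (hηζ : ∀ z v, fderiv ℝ ζ z v = -(η z * ⟪z, v⟫))
    {r R : ℝ} (hR : 0 < R) {v g : EuclideanSpace ℝ (Fin N) → ℝ}
    (hv : Integrable v) (hg : Integrable g)
    (hw : ∀ φ : EuclideanSpace ℝ (Fin N) → ℝ, ContDiff ℝ ∞ φ → HasCompactSupport φ →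
      tsupport φ ⊆ Metric.ball 0 (r + R) → ∫ x, v x * lap φ x = -∫ x, g x * φ x) :
    ∀ᵐ x, x ∈ Metric.ball (0 : EuclideanSpace ℝ (Fin N)) r →
      v x = (potKernel ζ R ⋆[ContinuousLinearMap.lsmul ℝ ℝ, volume] g) x +
        ((fun y => (R⁻¹) ^ N * η (R⁻¹ • y)) ⋆[ContinuousLinearMap.lsmul ℝ ℝ, volume] v) x := by
  set k := potKernel ζ R with hkdef
  set κ : EuclideanSpace ℝ (Fin N) → ℝ := fun y => (R⁻¹) ^ N * η (R⁻¹ • y) with hκ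
  have hki : Integrable k := integrable_potKernel hN hζc.continuous hζ
  have hke : ∀ y, k (-y) = k y := potKernel_neg hζe
  have hκi : Integrable κ := ((integrable_of_norm_ge_one_eq_zero hηc.continuous hη).2.comp_smul
    (inv_ne_zero hR.ne')).const_mul _
  have hκe : ∀ y, κ (-y) = κ y := fun y => by simp [hκ, hηe]
  have hkg : Integrable (k ⋆[ContinuousLinearMap.lsmul ℝ ℝ, volume] g) :=
    hki.integrable_convolution (ContinuousLinearMap.lsmul ℝ ℝ) hg
  have hκv : Integrable (κ ⋆[ContinuousLinearMap.lsmul ℝ ℝ, volume] v) :=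
    hκi.integrable_convolution (ContinuousLinearMap.lsmul ℝ ℝ) hv
  have key := Metric.isOpen_ball.ae_eq_zero_of_integral_contDiff_smul_eq_zero (μ := volume)
    (U := Metric.ball (0 : EuclideanSpace ℝ (Fin N)) r)
    (f := fun x => v x - ((k ⋆[ContinuousLinearMap.lsmul ℝ ℝ, volume] g) x +
      (κ ⋆[ContinuousLinearMap.lsmul ℝ ℝ, volume] v) x))
    ((hv.sub (hkg.add hκv)).locallyIntegrable.locallyIntegrableOn _) ?_
  · filter_upwards [key] with x hx hxr
    exact sub_eq_zero.1 (hx hxr)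
  intro ψ hψ hψs hψr
  obtain ⟨C, hC⟩ := hψs.exists_bound_of_continuous hψ.continuous
  have hψ2 : ContDiff ℝ 2 ψ := hψ.of_le (by norm_cast)
  obtain ⟨r₁, hr₁, hr₁'⟩ : ∃ r₁ < r, tsupport ψ ⊆ Metric.closedBall 0 r₁ := by
    obtain ⟨r₁, h1, h2⟩ := exists_lt_subset_ball (isClosed_tsupport ψ) hψr
    exact ⟨r₁, h1, h2.trans Metric.ball_subset_closedBall⟩
  have hφ : ContDiff ℝ ∞ (k ⋆[ContinuousLinearMap.lsmul ℝ ℝ, volume] ψ) :=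
    hψs.contDiff_convolution_right (ContinuousLinearMap.lsmul ℝ ℝ) hki.locallyIntegrable hψ
  have hφt : tsupport (k ⋆[ContinuousLinearMap.lsmul ℝ ℝ, volume] ψ) ⊆
      Metric.closedBall 0 (r₁ + R) := by
    refine closure_minimal ?_ Metric.isClosed_closedBall
    intro x hx
    by_contra hxb
    simp only [Metric.mem_closedBall, dist_zero_right, not_le] at hxb
    refine hx (integral_eq_zero_of_ae (ae_of_all _ fun y => ?_))
    by_cases hy : R ≤ ‖y‖
    · simp [hkdef, potKernel_eq_zero hζ hy]
    · have : x - y ∉ tsupport ψ := fun h => by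
        have h1 := hr₁' h
        simp only [Metric.mem_closedBall, dist_zero_right] at h1
        have h2 := norm_le_norm_sub_add x y
        linarith
      simp [image_eq_zero_of_notMem_tsupport this]
  have hφs : HasCompactSupport (k ⋆[ContinuousLinearMap.lsmul ℝ ℝ, volume] ψ) :=
    (isCompact_closedBall _ _).of_isClosed_subset (isClosed_tsupport _) hφt
  have h1 := hw _ hφ hφs (hφt.trans (Metric.closedBall_subset_ball (by linarith)))
  have hκψ : ∀ x, ∫ z, η z * ψ (x - R • z) =
      (κ ⋆[ContinuousLinearMap.lsmul ℝ ℝ, volume] ψ) x := by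
    intro x
    have := Measure.integral_comp_inv_smul_of_nonneg
      (volume : Measure (EuclideanSpace ℝ (Fin N)))
      (fun z => η z * ψ (x - R • z)) hR.le
    simp only [finrank_euclideanSpace, Fintype.card_fin, smul_smul, mul_inv_cancel₀ hR.ne',
      one_smul, smul_eq_mul] at this
    have h0 : (R⁻¹) ^ N * R ^ N = 1 := by rw [← mul_pow, inv_mul_cancel₀ hR.ne', one_pow]
    rw [← one_mul (∫ z, η z * ψ (x - R • z)), ← h0, mul_assoc, ← this,
      ← integral_const_mul]
    refine integral_congr_ae (ae_of_all _ fun y => ?_)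
    simp only [hκ, ContinuousLinearMap.lsmul_apply, smul_eq_mul]
    ring
  have hlap : ∀ x, lap (k ⋆[ContinuousLinearMap.lsmul ℝ ℝ, volume] ψ) x =
      (κ ⋆[ContinuousLinearMap.lsmul ℝ ℝ, volume] ψ) x - ψ x := by
    intro x
    rw [lap_smul_convolution hki.locallyIntegrable hψ2 hψs,
      potKernel_convolution_lap hζc hζ hηc.continuous hη hη1 hηζ hψ2 hψs hR, hκψ]
  obtain ⟨h2i, h2⟩ := integral_mul_convolution_eq hki hke hg hψ.continuous hC
  obtain ⟨h3i, h3⟩ := integral_mul_convolution_eq hκi hκe hv hψ.continuous hC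
  have h4 : Integrable fun x => v x * ψ x :=
    hv.mul_bdd hψ.continuous.aestronglyMeasurable (ae_of_all _ hC)
  have h5 : Integrable fun x => v x * (κ ⋆[ContinuousLinearMap.lsmul ℝ ℝ, volume] ψ) x := by
    have hc := (hψs.contDiff_convolution_right (ContinuousLinearMap.lsmul ℝ ℝ)
      hκi.locallyIntegrable hψ).continuous
    refine hv.mul_bdd (c := ∫ y, ‖κ y‖ * C) hc.aestronglyMeasurable (ae_of_all _ fun x => ?_)
    refine norm_integral_le_of_norm_le (hκi.norm.mul_const _) (ae_of_all _ fun y => ?_)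
    simp only [ContinuousLinearMap.lsmul_apply, norm_smul]
    exact mul_le_mul_of_nonneg_left (hC _) (norm_nonneg _)
  simp only [hlap, mul_sub] at h1
  rw [integral_sub h5 h4, h2, h3] at h1
  simp only [smul_eq_mul, mul_sub, mul_add]
  simp only [mul_comm (ψ _)]
  have h6 := integral_sub h4 (h2i.add h3i)
  simp only [Pi.add_apply] at h6
  rw [h6, integral_add h2i h3i]
  linarith

end Kernel

end

section

open MeasureTheory
open scoped ENNReal

/-- Young's convolution inequality for non-negative functions, with a finite target exponent. -/
theorem lintegral_convolution_rpow_le {E : Type*} [NormedAddCommGroup E] [MeasurableSpace E]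
    [BorelSpace E] [SecondCountableTopology E] {μ : Measure E} [SFinite μ] [μ.IsAddLeftInvariant]
    [μ.IsNegInvariant] {f g : E → ℝ≥0∞} (hf : Measurable f) (hg : Measurable g) {r s c : ℝ}
    (hr : 0 < r) (hs : 0 < s) (hc : 0 < c) (hrc : r ≤ c) (hsc : s ≤ c)
    (h : 1 / r + 1 / s = 1 + 1 / c) :
    ∫⁻ x, (∫⁻ y, f y * g (x - y) ∂μ) ^ c ∂μ
      ≤ (∫⁻ y, f y ^ r ∂μ) ^ (c / r) * (∫⁻ y, g y ^ s ∂μ) ^ (c / s) := by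
  have hrc' : 0 ≤ 1 / r - 1 / c := sub_nonneg.2 (one_div_le_one_div_of_le hr hrc)
  have hsc' : 0 ≤ 1 / s - 1 / c := sub_nonneg.2 (one_div_le_one_div_of_le hs hsc)
  have hgx : ∀ x, Measurable fun y => g (x - y) := fun x => hg.comp (measurable_const.sub measurable_id)
  set A := ∫⁻ y, f y ^ r ∂μ
  set B := ∫⁻ y, g y ^ s ∂μ
  have hB : ∀ x, ∫⁻ y, g (x - y) ^ s ∂μ = B := fun x =>
    lintegral_sub_left_eq_self (fun y => g y ^ s) x
  have hpt : ∀ x, ∫⁻ y, f y * g (x - y) ∂μ ≤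
      (∫⁻ y, f y ^ r * g (x - y) ^ s ∂μ) ^ (1 / c) * A ^ (1 / r - 1 / c) * B ^ (1 / s - 1 / c) := by
    intro x
    have := ENNReal.lintegral_prod_norm_pow_le (μ := μ) (Finset.univ : Finset (Fin 3))
      (f := ![fun y => f y ^ r * g (x - y) ^ s, fun y => f y ^ r, fun y => g (x - y) ^ s])
      (p := ![1 / c, 1 / r - 1 / c, 1 / s - 1 / c]) (by
        intro i _
        fin_cases i
        · exact ((hf.pow_const _).mul ((hgx x).pow_const _)).aemeasurable
        · exact (hf.pow_const _).aemeasurable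
        · exact ((hgx x).pow_const _).aemeasurable)
      (by simp [Fin.sum_univ_three] at h ⊢; linarith) (by
        intro i _
        fin_cases i
        · simp; positivity
        · simpa using hrc'
        · simpa using hsc')
    simp only [Fin.prod_univ_three, Matrix.cons_val_zero, Matrix.cons_val_one,
      Matrix.cons_val_two, Matrix.head_cons, Matrix.tail_cons, hB] at this
    refine le_trans (le_of_eq ?_) this
    refine lintegral_congr fun y => ?_
    rw [ENNReal.mul_rpow_of_nonneg _ _ (by positivity), ← ENNReal.rpow_mul, ← ENNReal.rpow_mul,
      ← ENNReal.rpow_mul, ← ENNReal.rpow_mul]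
    have e1 : f y = f y ^ (r * (1 / c)) * f y ^ (r * (1 / r - 1 / c)) := by
      rw [← ENNReal.rpow_add_of_nonneg _ _ (by positivity) (by positivity)]
      have : r * (1 / c) + r * (1 / r - 1 / c) = 1 := by field_simp; ring
      rw [this, ENNReal.rpow_one]
    have e2 : g (x - y) = g (x - y) ^ (s * (1 / c)) * g (x - y) ^ (s * (1 / s - 1 / c)) := by
      rw [← ENNReal.rpow_add_of_nonneg _ _ (by positivity) (by positivity)]
      have : s * (1 / c) + s * (1 / s - 1 / c) = 1 := by field_simp; ring
      rw [this, ENNReal.rpow_one]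
    conv_lhs => rw [e1, e2]
    ring
  have hmeas2 : Measurable fun z : E × E => f z.2 ^ r * g (z.1 - z.2) ^ s :=
    ((hf.comp measurable_snd).pow_const _).mul
      ((hg.comp (measurable_fst.sub measurable_snd)).pow_const _)
  calc ∫⁻ x, (∫⁻ y, f y * g (x - y) ∂μ) ^ c ∂μ
      ≤ ∫⁻ x, (∫⁻ y, f y ^ r * g (x - y) ^ s ∂μ) *
          (A ^ (c / r - 1) * B ^ (c / s - 1)) ∂μ := by
        refine lintegral_mono fun x => ?_
        refine (ENNReal.rpow_le_rpow (hpt x) hc.le).trans (le_of_eq ?_)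
        rw [ENNReal.mul_rpow_of_nonneg _ _ hc.le, ENNReal.mul_rpow_of_nonneg _ _ hc.le,
          ← ENNReal.rpow_mul, ← ENNReal.rpow_mul, ← ENNReal.rpow_mul]
        have h1 : 1 / c * c = 1 := by field_simp
        have h2 : (1 / r - 1 / c) * c = c / r - 1 := by field_simp
        have h3 : (1 / s - 1 / c) * c = c / s - 1 := by field_simp
        rw [h1, h2, h3, ENNReal.rpow_one, mul_assoc]
    _ = (∫⁻ x, ∫⁻ y, f y ^ r * g (x - y) ^ s ∂μ ∂μ) * (A ^ (c / r - 1) * B ^ (c / s - 1)) :=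
        lintegral_mul_const _ (Measurable.lintegral_prod_right hmeas2)
    _ = A * B * (A ^ (c / r - 1) * B ^ (c / s - 1)) := by
        congr 1
        rw [lintegral_lintegral_swap hmeas2.aemeasurable]
        have : ∀ y, ∫⁻ x, f y ^ r * g (x - y) ^ s ∂μ = f y ^ r * B := by
          intro y
          have hm : Measurable fun x => g (x - y) ^ s :=
            (hg.comp (measurable_id.sub_const y)).pow_const _
          rw [lintegral_const_mul _ hm]
          congr 1
          have := lintegral_sub_right_eq_self (μ := μ) (fun x => g x ^ s) y
          exact this
        simp_rw [this]
        rw [lintegral_mul_const _ (hf.pow_const _)]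
    _ = (A * A ^ (c / r - 1)) * (B * B ^ (c / s - 1)) := by ring
    _ = A ^ (c / r) * B ^ (c / s) := by
        have h1 : 0 ≤ c / r - 1 := by rw [sub_nonneg, le_div_iff₀ hr]; linarith
        have h2 : 0 ≤ c / s - 1 := by rw [sub_nonneg, le_div_iff₀ hs]; linarith
        have e : ∀ (T : ℝ≥0∞) (a : ℝ), 0 ≤ a - 1 → T * T ^ (a - 1) = T ^ a := by
          intro T a ha
          nth_rewrite 1 [← ENNReal.rpow_one T]
          rw [← ENNReal.rpow_add_of_nonneg _ _ zero_le_one ha]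
          congr 1; ring
        rw [e A _ h1, e B _ h2]

end

section

open MeasureTheory Set
open scoped ENNReal RealInnerProductSpace

section Bootstrap

variable {N : ℕ} {p : ℝ} {v g : EuclideanSpace ℝ (Fin N) → ℝ}

theorem lintegral_ball_add_rpow_lt_top {E : Type*} [MeasurableSpace E] {μ : Measure E} {s : Set E}
    (hs : μ s < ∞) {f : E → ℝ≥0∞} {q : ℝ} (hq : 1 ≤ q) {C : ℝ≥0∞} (hC : C < ∞)
    (hf : ∫⁻ x in s, f x ^ q ∂μ < ∞) : ∫⁻ x in s, (f x + C) ^ q ∂μ < ∞ := by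
  have hq0 : 0 ≤ q := zero_le_one.trans hq
  calc ∫⁻ x in s, (f x + C) ^ q ∂μ ≤ ∫⁻ x in s, 2 ^ (q - 1) * (f x ^ q + C ^ q) ∂μ :=
        lintegral_mono fun x => ENNReal.rpow_add_le_mul_rpow_add_rpow _ _ hq
    _ = 2 ^ (q - 1) * (∫⁻ x in s, f x ^ q ∂μ + C ^ q * μ s) := by
        rw [lintegral_const_mul' _ _ (ENNReal.rpow_ne_top_of_nonneg (by linarith) (by simp)),
          lintegral_add_right _ measurable_const]
        simp
    _ < ∞ := by
        refine ENNReal.mul_lt_top (ENNReal.rpow_lt_top_of_nonneg (by linarith) (by simp)) (ENNReal.add_lt_top.2 ⟨hf, ENNReal.mul_lt_top ?_ hs⟩)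
        exact ENNReal.rpow_lt_top_of_nonneg hq0 hC.ne

theorem ae_bounded_of_subcritical_potential_estimate (hN : 3 ≤ N) (hp1 : 1 < p)
    (hp2 : p < ((N : ℝ) + 2) / ((N : ℝ) - 2)) (hgm : Measurable g)
    (hrep : ∀ r r' : ℝ, 0 < r → r < r' → r' < 1 → ∃ k : EuclideanSpace ℝ (Fin N) → ℝ≥0∞,
      Measurable k ∧ (∀ σ : ℝ, 0 < σ → ((N : ℝ) - 2) * σ < N → ∫⁻ y, k y ^ σ < ∞) ∧
      ∃ C < ∞, ∀ᵐ x, x ∈ Metric.ball (0 : EuclideanSpace ℝ (Fin N)) r →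
        ‖v x‖ₑ ≤ (∫⁻ y, k y * (Metric.ball 0 r').indicator (fun z => ‖g z‖ₑ) (x - y)) + C)
    (hg : ∀ r < 1, ∃ C < ∞, ∀ x ∈ Metric.ball (0 : EuclideanSpace ℝ (Fin N)) r,
      ‖g x‖ₑ ≤ C * (‖v x‖ₑ ^ p + 1))
    (hv : ∀ r < 1, ∫⁻ x in Metric.ball (0 : EuclideanSpace ℝ (Fin N)) r,
      ‖v x‖ₑ ^ (2 * (N : ℝ) / (N - 2)) < ∞) :
    ∀ r < 1, ∃ C < ∞, ∀ᵐ x, x ∈ Metric.ball (0 : EuclideanSpace ℝ (Fin N)) r → ‖v x‖ₑ ≤ C := by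
  have hN' : (3 : ℝ) ≤ N := by exact_mod_cast hN
  have hN2 : (0 : ℝ) < N - 2 := by linarith
  set τ₀ : ℝ := (N - 2) / (2 * N) with hτ₀
  set κ : ℝ := 2 / N - (p - 1) * τ₀ with hκ
  have hκ0 : 0 < κ := by
    rw [lt_div_iff₀ hN2] at hp2
    have : κ = (4 - (p - 1) * (N - 2)) / (2 * N) := by
      rw [hκ, hτ₀]; field_simp; ring
    rw [this]
    apply div_pos _ (by linarith)
    nlinarith
  have hτ₀p : p * τ₀ < 1 := by
    have h1 : p * τ₀ = τ₀ + (2 / N - κ) := by rw [hκ]; ring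
    have h2 : τ₀ + 2 / N = (N + 2) / (2 * N) := by rw [hτ₀]; field_simp; ring
    have h3 : ((N : ℝ) + 2) / (2 * N) < 1 := by rw [div_lt_one (by linarith)]; linarith
    linarith
  have hball : ∀ r, volume (Metric.ball (0 : EuclideanSpace ℝ (Fin N)) r) < ∞ := fun r =>
    measure_ball_lt_top
  -- integrability of the nonlinearity
  have hG : ∀ τ, 0 < τ → τ ≤ τ₀ → (∀ r < 1, ∫⁻ x in Metric.ball (0 : EuclideanSpace ℝ (Fin N)) r,
      ‖v x‖ₑ ^ (1 / τ) < ∞) → ∀ r < 1, ∫⁻ x,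
        (Metric.ball (0 : EuclideanSpace ℝ (Fin N)) r).indicator (fun z => ‖g z‖ₑ) x ^ (1 / (p * τ))
          < ∞ := by
    intro τ hτ hττ₀ hP r hr
    obtain ⟨C, hC, hgC⟩ := hg r hr
    have hpτ : 0 < p * τ := by positivity
    have hq : 1 ≤ 1 / (p * τ) := by
      rw [le_div_iff₀ hpτ]; nlinarith
    have e : ∀ x, (Metric.ball (0 : EuclideanSpace ℝ (Fin N)) r).indicator
        (fun z => ‖g z‖ₑ) x ^ (1 / (p * τ)) = (Metric.ball (0 : EuclideanSpace ℝ (Fin N)) r).indicator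
        (fun z => ‖g z‖ₑ ^ (1 / (p * τ))) x := by
      intro x
      by_cases hx : x ∈ Metric.ball (0 : EuclideanSpace ℝ (Fin N)) r
      · simp [hx]
      · simp only [hx, not_false_eq_true, indicator_of_notMem]
        exact ENNReal.zero_rpow_of_pos (by positivity)
    simp only [e]
    rw [lintegral_indicator measurableSet_ball]
    have h1 := lintegral_ball_add_rpow_lt_top (hball r) hq ENNReal.one_lt_top
      (f := fun x => ‖v x‖ₑ ^ p) (by
        simp only [← ENNReal.rpow_mul]
        have : p * (1 / (p * τ)) = 1 / τ := by field_simp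
        rw [this]
        exact hP r hr)
    refine lt_of_le_of_lt (setLIntegral_mono' measurableSet_ball fun x hx =>
      (ENNReal.rpow_le_rpow (hgC x hx) (by positivity)).trans_eq
        (ENNReal.mul_rpow_of_nonneg _ _ (by positivity))) ?_
    rw [lintegral_const_mul' _ _ (ENNReal.rpow_lt_top_of_nonneg (by positivity) hC.ne).ne]
    exact ENNReal.mul_lt_top (ENNReal.rpow_lt_top_of_nonneg (by positivity) hC.ne) h1
  have hmG : ∀ r, Measurable ((Metric.ball (0 : EuclideanSpace ℝ (Fin N)) r).indicator
      (fun z => ‖g z‖ₑ)) := fun r => hgm.enorm.indicator measurableSet_ball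
  have hσ : ∀ s : ℝ, s < 2 / N → 0 < 1 - s ∧ ((N : ℝ) - 2) * (1 / (1 - s)) < N := by
    intro s hs
    rw [lt_div_iff₀ (by linarith)] at hs
    have h1 : 0 < 1 - s := by nlinarith
    refine ⟨h1, ?_⟩
    rw [mul_one_div, div_lt_iff₀ h1]
    nlinarith
  -- improvement to a bounded function
  have hfin : ∀ τ, 0 < τ → τ ≤ τ₀ → τ ≤ κ / 2 →
      (∀ r < 1, ∫⁻ x in Metric.ball (0 : EuclideanSpace ℝ (Fin N)) r, ‖v x‖ₑ ^ (1 / τ) < ∞) →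
      ∀ r < 1, ∃ C < ∞, ∀ᵐ x, x ∈ Metric.ball (0 : EuclideanSpace ℝ (Fin N)) r → ‖v x‖ₑ ≤ C := by
    intro τ hτ hττ₀ hτκ hP r hr
    obtain ⟨r₁, hr₁, hr₁'⟩ := exists_between (max_lt hr one_pos)
    obtain ⟨r₂, hr₂, hr₂'⟩ := exists_between hr₁'
    obtain ⟨k, hk, hkσ, C, hC, hvC⟩ := hrep r₁ r₂ ((le_max_right _ _).trans_lt hr₁) hr₂ hr₂'
    have hs : p * τ < 2 / N := by
      have : p * τ ≤ (p - 1) * τ₀ + κ / 2 := by nlinarith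
      linarith
    obtain ⟨hs1, hs2⟩ := hσ _ hs
    have hpτ : 0 < p * τ := by positivity
    have hKf := hkσ _ (by positivity) hs2
    have hGf := hG τ hτ hττ₀ hP r₂ hr₂'
    have hconj : (1 / (1 - p * τ)).HolderConjugate (1 / (p * τ)) := by
      rw [Real.holderConjugate_iff]
      constructor
      · rw [lt_div_iff₀ hs1]; linarith
      · simp
    refine ⟨(∫⁻ y, k y ^ (1 / (1 - p * τ))) ^ (1 / (1 / (1 - p * τ))) * (∫⁻ x,
        (Metric.ball (0 : EuclideanSpace ℝ (Fin N)) r₂).indicator (fun z => ‖g z‖ₑ) x ^ (1 / (p * τ)))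
        ^ (1 / (1 / (p * τ))) + C, ?_, ?_⟩
    · refine ENNReal.add_lt_top.2 ⟨ENNReal.mul_lt_top ?_ ?_, hC⟩
      · exact ENNReal.rpow_lt_top_of_nonneg (by positivity) hKf.ne
      · exact ENNReal.rpow_lt_top_of_nonneg (by positivity) hGf.ne
    · filter_upwards [hvC] with x hx hxr
      refine (hx (Metric.ball_subset_ball ((le_max_left _ _).trans hr₁.le) hxr)).trans ?_
      gcongr
      have := ENNReal.lintegral_mul_le_Lp_mul_Lq volume hconj hk.aemeasurable
        (((hmG r₂).comp (measurable_id.const_sub x)).aemeasurable)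
      refine this.trans_eq ?_
      congr 2
      exact lintegral_sub_left_eq_self (fun y => (Metric.ball (0 : EuclideanSpace ℝ (Fin N))
        r₂).indicator (fun z => ‖g z‖ₑ) y ^ (1 / (p * τ))) x
  -- improvement of the exponent
  have hstep : ∀ τ, τ ≤ τ₀ → κ / 2 < τ →
      (∀ r < 1, ∫⁻ x in Metric.ball (0 : EuclideanSpace ℝ (Fin N)) r, ‖v x‖ₑ ^ (1 / τ) < ∞) →
      ∀ r < 1, ∫⁻ x in Metric.ball (0 : EuclideanSpace ℝ (Fin N)) r,
        ‖v x‖ₑ ^ (1 / (τ - κ / 2)) < ∞ := by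
    intro τ hττ₀ hτκ hP r hr
    have hτ : 0 < τ := by linarith
    obtain ⟨r₁, hr₁, hr₁'⟩ := exists_between (max_lt hr one_pos)
    obtain ⟨r₂, hr₂, hr₂'⟩ := exists_between hr₁'
    obtain ⟨k, hk, hkσ, C, hC, hvC⟩ := hrep r₁ r₂ ((le_max_right _ _).trans_lt hr₁) hr₂ hr₂'
    set τ' := τ - κ / 2 with hτ'
    have hτ'0 : 0 < τ' := by linarith
    have hs : p * τ - τ' < 2 / N := by
      have : p * τ - τ' ≤ (p - 1) * τ₀ + κ / 2 := by nlinarith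
      linarith
    obtain ⟨hs1, hs2⟩ := hσ _ hs
    have hpτ : 0 < p * τ := by positivity
    have hpτ1 : p * τ < 1 := by nlinarith
    have hKf := hkσ _ (by positivity) hs2
    have hGf := hG τ hτ hττ₀ hP r₂ hr₂'
    have hY := lintegral_convolution_rpow_le (μ := volume) hk (hmG r₂)
      (r := 1 / (1 - (p * τ - τ'))) (s := 1 / (p * τ)) (c := 1 / τ')
      (by positivity) (by positivity) (by positivity)
      (one_div_le_one_div_of_le hτ'0 (by linarith)) (one_div_le_one_div_of_le hτ'0 (by nlinarith))
      (by simp only [one_div_one_div]; ring)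
    have hY' : ∫⁻ x in Metric.ball (0 : EuclideanSpace ℝ (Fin N)) r₁, (∫⁻ y, k y *
        (Metric.ball 0 r₂).indicator (fun z => ‖g z‖ₑ) (x - y)) ^ (1 / τ') < ∞ := by
      refine (setLIntegral_le_lintegral _ _).trans_lt (hY.trans_lt (ENNReal.mul_lt_top ?_ ?_))
      · exact ENNReal.rpow_lt_top_of_nonneg (by positivity) hKf.ne
      · exact ENNReal.rpow_lt_top_of_nonneg (by positivity) hGf.ne
    have h1 := lintegral_ball_add_rpow_lt_top (hball r₁) (q := 1 / τ')
      (by rw [le_div_iff₀ hτ'0]; nlinarith) hC hY'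
    refine (lintegral_mono_set (Metric.ball_subset_ball
      ((le_max_left _ _).trans hr₁.le))).trans_lt (lt_of_le_of_lt (lintegral_mono_ae ?_) h1)
    filter_upwards [ae_restrict_of_ae hvC, ae_restrict_mem measurableSet_ball] with x hx hxr
    exact ENNReal.rpow_le_rpow (hx hxr) (by positivity)
  have hall : ∀ n : ℕ, ∀ τ, 0 < τ → τ ≤ τ₀ → τ ≤ (n + 1) * (κ / 2) →
      (∀ r < 1, ∫⁻ x in Metric.ball (0 : EuclideanSpace ℝ (Fin N)) r, ‖v x‖ₑ ^ (1 / τ) < ∞) →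
      ∀ r < 1, ∃ C < ∞, ∀ᵐ x, x ∈ Metric.ball (0 : EuclideanSpace ℝ (Fin N)) r → ‖v x‖ₑ ≤ C := by
    intro n
    induction n with
    | zero => exact fun τ h1 h2 h3 => hfin τ h1 h2 (by simpa using h3)
    | succ n ih =>
      intro τ h1 h2 h3 hP
      by_cases h : τ ≤ κ / 2
      · exact hfin τ h1 h2 h hP
      · push Not at h
        refine ih (τ - κ / 2) (by linarith) (by linarith) ?_ (hstep τ h2 h hP)
        push_cast at h3
        linarith
  obtain ⟨n, hn⟩ := exists_nat_ge (τ₀ / (κ / 2))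
  refine hall n τ₀ (by positivity) le_rfl ?_ ?_
  · rw [div_le_iff₀ (by linarith)] at hn
    linarith
  · have : 1 / τ₀ = 2 * (N : ℝ) / (N - 2) := by rw [hτ₀, one_div_div]
    rw [this]
    exact hv

end Bootstrap

end

section

open MeasureTheory Set Metric
open scoped ContDiff RealInnerProductSpace

section Gluing

variable {E : Type*} [NormedAddCommGroup E] [NormedSpace ℝ E] [MeasurableSpace E] [BorelSpace E]
  {μ : Measure E} [μ.IsOpenPosMeasure]

theorem exists_contDiffOn_ball_ae_eq {n : WithTop ℕ∞} {v : E → ℝ}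
    (h : ∀ r < (1 : ℝ), ∃ f : E → ℝ, ContDiffOn ℝ n f (ball 0 r) ∧
      ∀ᵐ x ∂μ, x ∈ ball (0 : E) r → v x = f x) :
    ∃ w : E → ℝ, ContDiffOn ℝ n w (ball 0 1) ∧ ∀ᵐ x ∂μ, x ∈ ball (0 : E) 1 → v x = w x := by
  choose! f hfc hfv using h
  have heq : ∀ r < 1, ∀ r' < 1, EqOn (f r) (f r') (ball 0 r ∩ ball 0 r') := by
    intro r hr r' hr'
    refine Measure.eqOn_open_of_ae_eq (μ := μ) ?_ (isOpen_ball.inter isOpen_ball)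
      ((hfc r hr).continuousOn.mono inter_subset_left)
      ((hfc r' hr').continuousOn.mono inter_subset_right)
    refine (ae_restrict_iff' (isOpen_ball.inter isOpen_ball).measurableSet).2 ?_
    filter_upwards [hfv r hr, hfv r' hr'] with x hx hx' hxm
    rw [← hx hxm.1, hx' hxm.2]
  have hmem : ∀ x : E, x ∈ ball (0 : E) 1 → (1 + ‖x‖) / 2 < 1 ∧ x ∈ ball (0 : E) ((1 + ‖x‖) / 2) := by
    intro x hx
    rw [mem_ball_zero_iff] at hx ⊢
    constructor <;> linarith
  have hF : ∀ r < 1, EqOn (fun x => f ((1 + ‖x‖) / 2) x) (f r) (ball 0 r) := by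
    intro r hr x hx
    have hx1 : x ∈ ball (0 : E) 1 := ball_subset_ball hr.le hx
    exact heq _ (hmem x hx1).1 r hr ⟨(hmem x hx1).2, hx⟩
  refine ⟨fun x => f ((1 + ‖x‖) / 2) x, fun x hx => ?_, ?_⟩
  · obtain ⟨h1, h2⟩ := hmem x hx
    exact (((hfc _ h1).contDiffAt (isOpen_ball.mem_nhds h2)).congr_of_eventuallyEq
      ((hF _ h1).eventuallyEq_of_mem (isOpen_ball.mem_nhds h2))).contDiffWithinAt
  · have : ∀ n : ℕ, 1 - 1 / ((n : ℝ) + 1) < 1 := fun n => by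
      have : (0 : ℝ) < 1 / ((n : ℝ) + 1) := by positivity
      linarith
    have h := ae_all_iff.2 fun n : ℕ => hfv _ (this n)
    filter_upwards [h] with x hx hx1
    rw [mem_ball_zero_iff] at hx1
    obtain ⟨n, hn⟩ := exists_nat_one_div_lt (sub_pos.2 hx1)
    have hxn : x ∈ ball (0 : E) (1 - 1 / ((n : ℝ) + 1)) := by
      rw [mem_ball_zero_iff]; linarith
    rw [hx n hxn]
    exact (hF _ (this n) hxn).symm

end Gluing
theorem hasDerivAt_abs_rpow_mul {p : ℝ} (hp : 1 < p) (t : ℝ) :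
    HasDerivAt (fun t : ℝ => |t| ^ (p - 1) * t) (p * |t| ^ (p - 1)) t := by
  have hp0 : 0 < p - 1 := by linarith
  rcases lt_trichotomy t 0 with ht | rfl | ht
  · have h1 : HasDerivAt (fun t : ℝ => -((-t) ^ p)) (-(-1 * p * (-t) ^ (p - 1))) t :=
      ((hasDerivAt_neg t).rpow_const (Or.inl (by simpa using ht.ne))).neg
    rw [abs_of_neg ht]
    refine (h1.congr_of_eventuallyEq ?_).congr_deriv (by ring)
    filter_upwards [eventually_lt_nhds ht] with s hs
    rw [abs_of_neg hs, Real.rpow_sub_one (by linarith)]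
    have : s ≠ 0 := hs.ne
    field_simp
  · simp only [abs_zero, Real.zero_rpow hp0.ne', mul_zero]
    rw [hasDerivAt_iff_tendsto_slope_zero]
    have : Filter.Tendsto (fun t : ℝ => |t| ^ (p - 1)) (nhdsWithin 0 {0}ᶜ) (nhds 0) := by
      have h : ContinuousAt (fun t : ℝ => |t| ^ (p - 1)) 0 :=
        (continuous_abs.rpow_const fun _ => Or.inr hp0.le).continuousAt
      have h' := h.tendsto
      simp only [abs_zero, Real.zero_rpow hp0.ne'] at h'
      exact h'.mono_left nhdsWithin_le_nhds
    refine this.congr' ?_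
    filter_upwards [self_mem_nhdsWithin] with s hs
    have : s ≠ 0 := hs
    simp
    field_simp
  · have h1 : HasDerivAt (fun t : ℝ => t ^ p) (1 * p * t ^ (p - 1)) t :=
      (hasDerivAt_id t).rpow_const (Or.inl ht.ne')
    rw [abs_of_pos ht]
    refine (h1.congr_of_eventuallyEq ?_).congr_deriv (by ring)
    filter_upwards [eventually_gt_nhds ht] with s hs
    rw [abs_of_pos hs, Real.rpow_sub_one hs.ne']
    field_simp

theorem contDiff_abs_rpow_mul {p : ℝ} (hp : 1 < p) :
    ContDiff ℝ 1 (fun t : ℝ => |t| ^ (p - 1) * t) := by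
  rw [contDiff_one_iff_deriv]
  refine ⟨fun t => (hasDerivAt_abs_rpow_mul hp t).differentiableAt, ?_⟩
  have : deriv (fun t : ℝ => |t| ^ (p - 1) * t) = fun t => p * |t| ^ (p - 1) :=
    funext fun t => (hasDerivAt_abs_rpow_mul hp t).deriv
  rw [this]
  exact continuous_const.mul (continuous_abs.rpow_const fun _ => Or.inr (by linarith))

end

section

open MeasureTheory Set Metric
open scoped ContDiff RealInnerProductSpace ENNReal Convolution

section LocalBound

variable {N : ℕ} {p : ℝ} {v a b : EuclideanSpace ℝ (Fin N) → ℝ}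

theorem contDiff_rescaled {η : EuclideanSpace ℝ (Fin N) → ℝ} (hηc : ContDiff ℝ ∞ η) (R : ℝ) :
    ContDiff ℝ ∞ fun y => (R⁻¹) ^ N * η (R⁻¹ • y) :=
  contDiff_const.mul (hηc.comp (contDiff_const_smul _))

theorem hasCompactSupport_rescaled {η : EuclideanSpace ℝ (Fin N) → ℝ} (hη : HasCompactSupport η)
    {R : ℝ} (hR : 0 < R) : HasCompactSupport fun y => (R⁻¹) ^ N * η (R⁻¹ • y) :=
  (hη.comp_smul (inv_ne_zero hR.ne')).mul_left

theorem exists_norm_le_of_contDiffOn {a : EuclideanSpace ℝ (Fin N) → ℝ}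
    (ha : ContinuousOn a (ball 0 1)) {r : ℝ} (hr : r < 1) :
    ∃ C, 0 ≤ C ∧ ∀ x ∈ ball (0 : EuclideanSpace ℝ (Fin N)) r, ‖a x‖ ≤ C := by
  obtain ⟨C, hC⟩ := (isCompact_closedBall (0 : EuclideanSpace ℝ (Fin N)) r).exists_bound_of_continuousOn
    (ha.mono (closedBall_subset_ball hr))
  exact ⟨max C 0, le_max_right _ _, fun x hx => (hC x (ball_subset_closedBall hx)).trans (le_max_left _ _)⟩

theorem enorm_nonlinearity_le (hp : 1 < p) {α β t A B : ℝ} (hA : |α| ≤ A) (hB : |β| ≤ B) :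
    ‖α * t + β * (|t| ^ (p - 1) * t)‖ₑ ≤ ENNReal.ofReal (A + B) * (‖t‖ₑ ^ p + 1) := by
  have h1 : |t| ^ (p - 1) * |t| = |t| ^ p := by
    rcases eq_or_ne t 0 with rfl | ht
    · simp [Real.zero_rpow (by linarith : p ≠ 0)]
    · rw [Real.rpow_sub_one (abs_ne_zero.2 ht)]
      have := abs_ne_zero.2 ht
      field_simp
  have h2 : |t| ≤ |t| ^ p + 1 := by
    rcases le_total |t| 1 with h | h
    · have : 0 ≤ |t| ^ p := by positivity
      linarith
    · have := Real.self_le_rpow_of_one_le h hp.le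
      linarith
  have h3 : |α * t + β * (|t| ^ (p - 1) * t)| ≤ (A + B) * (|t| ^ p + 1) := by
    have h0 : 0 ≤ |t| ^ p := by positivity
    calc |α * t + β * (|t| ^ (p - 1) * t)| ≤ |α * t| + |β * (|t| ^ (p - 1) * t)| := abs_add_le _ _
      _ = |α| * |t| + |β| * |t| ^ p := by
        rw [abs_mul, abs_mul, abs_mul, abs_of_nonneg (by positivity : 0 ≤ |t| ^ (p - 1)), h1]
      _ ≤ A * (|t| ^ p + 1) + B * (|t| ^ p + 1) := by
        have hA0 := (abs_nonneg α).trans hA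
        have hB0 := (abs_nonneg β).trans hB
        gcongr
        linarith
      _ = _ := by ring
  rw [Real.enorm_eq_ofReal_abs, Real.enorm_eq_ofReal_abs,
    ENNReal.ofReal_rpow_of_nonneg (abs_nonneg t) (by linarith), ← ENNReal.ofReal_one,
    ← ENNReal.ofReal_add (by positivity) zero_le_one,
    ← ENNReal.ofReal_mul (add_nonneg ((abs_nonneg α).trans hA) ((abs_nonneg β).trans hB))]
  exact ENNReal.ofReal_le_ofReal h3

theorem enorm_convolution_le (k f : EuclideanSpace ℝ (Fin N) → ℝ) (x : EuclideanSpace ℝ (Fin N)) :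
    ‖(k ⋆[ContinuousLinearMap.lsmul ℝ ℝ, volume] f) x‖ₑ ≤ ∫⁻ y, ‖k y‖ₑ * ‖f (x - y)‖ₑ := by
  refine (enorm_integral_le_lintegral_enorm _).trans (lintegral_mono fun y => ?_)
  simp [enorm_mul]

theorem integrable_indicator_of_lintegral_rpow {f : EuclideanSpace ℝ (Fin N) → ℝ}
    (hf : Measurable f) {q r : ℝ} (hq : 1 ≤ q)
    (h : ∫⁻ x in ball (0 : EuclideanSpace ℝ (Fin N)) r, ‖f x‖ₑ ^ q < ⊤) :
    Integrable ((ball 0 r).indicator f) := by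
  rw [integrable_indicator_iff measurableSet_ball]
  refine ⟨hf.aestronglyMeasurable, ?_⟩
  have hle : ∀ t : ℝ≥0∞, t ≤ t ^ q + 1 := fun t => by
    rcases le_total t 1 with h | h
    · exact h.trans (by simp)
    · exact (ENNReal.le_rpow_self_of_one_le h hq).trans (by simp)
  refine (lintegral_mono fun x => hle _).trans_lt ?_
  rw [lintegral_add_right _ measurable_const]
  exact ENNReal.add_lt_top.2 ⟨h, by simpa using measure_ball_lt_top⟩

theorem integrable_indicator_nonlinearity (hN : 3 ≤ N) (hp1 : 1 < p)
    (hp2 : p < ((N : ℝ) + 2) / ((N : ℝ) - 2)) (hvm : Measurable v)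
    (ham : Measurable a) (hbm : Measurable b)
    (ha : ContinuousOn a (ball 0 1)) (hb : ContinuousOn b (ball 0 1))
    {r : ℝ} (hr : r < 1)
    (hv : ∫⁻ x in ball (0 : EuclideanSpace ℝ (Fin N)) r, ‖v x‖ₑ ^ (2 * (N : ℝ) / (N - 2)) < ⊤) :
    Integrable ((ball 0 r).indicator fun x => a x * v x + b x * (|v x| ^ (p - 1) * v x)) := by
  have hN' : (3 : ℝ) ≤ N := by exact_mod_cast hN
  have hN2 : (0 : ℝ) < N - 2 := by linarith
  have hps : p ≤ 2 * (N : ℝ) / (N - 2) := hp2.le.trans (by gcongr; linarith)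
  obtain ⟨A, hA0, hA⟩ := exists_norm_le_of_contDiffOn ha hr
  obtain ⟨B, hB0, hB⟩ := exists_norm_le_of_contDiffOn hb hr
  rw [integrable_indicator_iff measurableSet_ball]
  refine ⟨Measurable.aestronglyMeasurable (by fun_prop), ?_⟩
  have hle : ∀ t : ℝ≥0∞, t ^ p + 1 ≤ t ^ (2 * (N : ℝ) / (N - 2)) + 2 := fun t => by
    rcases le_total t 1 with h | h
    · calc t ^ p + 1 ≤ 1 + 1 := by
            gcongr
            exact ENNReal.rpow_le_one h (by linarith)
        _ ≤ _ := by rw [one_add_one_eq_two]; simp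
    · exact add_le_add (ENNReal.rpow_le_rpow_of_exponent_le h hps) one_le_two
  calc ∫⁻ x in ball (0 : EuclideanSpace ℝ (Fin N)) r, ‖a x * v x + b x * (|v x| ^ (p - 1) * v x)‖ₑ
      ≤ ∫⁻ x in ball (0 : EuclideanSpace ℝ (Fin N)) r,
        ENNReal.ofReal (A + B) * (‖v x‖ₑ ^ (2 * (N : ℝ) / (N - 2)) + 2) :=
        setLIntegral_mono' measurableSet_ball fun x hx =>
          (enorm_nonlinearity_le hp1 (hA x hx) (hB x hx)).trans (mul_le_mul' le_rfl (hle _))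
    _ < ⊤ := by
      rw [lintegral_const_mul' _ _ ENNReal.ofReal_ne_top, lintegral_add_right _ measurable_const]
      refine ENNReal.mul_lt_top ENNReal.ofReal_lt_top (ENNReal.add_lt_top.2 ⟨hv, ?_⟩)
      rw [setLIntegral_const]
      exact ENNReal.mul_lt_top (by simp) measure_ball_lt_top

theorem integral_indicator_mul_of_tsupport {E : Type*} [TopologicalSpace E] [MeasurableSpace E]
    {μ : Measure E} {s : Set E} {f g : E → ℝ} (hg : tsupport g ⊆ s) :
    ∫ x, s.indicator f x * g x ∂μ = ∫ x, f x * g x ∂μ := by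
  refine integral_congr_ae (ae_of_all _ fun x => ?_)
  by_cases hx : x ∈ s
  · simp [hx]
  · simp [hx, image_eq_zero_of_notMem_tsupport fun h => hx (hg h)]

theorem tsupport_lap_subset {ψ : EuclideanSpace ℝ (Fin N) → ℝ} : tsupport (lap ψ) ⊆ tsupport ψ :=
  closure_minimal (fun x hx => by
    by_contra h
    exact hx (lap_eq_zero_of_notMem_tsupport h)) (isClosed_tsupport ψ)

theorem weak_solution_ae_bounded (hN : 3 ≤ N) (hp1 : 1 < p)
    (hp2 : p < ((N : ℝ) + 2) / ((N : ℝ) - 2)) (hvm : Measurable v)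
    (ham : Measurable a) (hbm : Measurable b)
    (ha : ContinuousOn a (ball 0 1)) (hb : ContinuousOn b (ball 0 1))
    (hv : ∀ r < 1, ∫⁻ x in ball (0 : EuclideanSpace ℝ (Fin N)) r,
      ‖v x‖ₑ ^ (2 * (N : ℝ) / (N - 2)) < ⊤)
    (hw : ∀ φ : EuclideanSpace ℝ (Fin N) → ℝ, ContDiff ℝ ∞ φ → HasCompactSupport φ →
      tsupport φ ⊆ ball 0 1 →
      ∫ x, v x * lap φ x = -∫ x, (a x * v x + b x * (|v x| ^ (p - 1) * v x)) * φ x) :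
    ∀ r < 1, ∃ C < ⊤, ∀ᵐ x, x ∈ ball (0 : EuclideanSpace ℝ (Fin N)) r → ‖v x‖ₑ ≤ C := by
  have hN' : (3 : ℝ) ≤ N := by exact_mod_cast hN
  have hN2 : (0 : ℝ) < N - 2 := by linarith
  set g := fun x => a x * v x + b x * (|v x| ^ (p - 1) * v x) with hg
  obtain ⟨η, ζ, hηc, hζc, hη, hζ, hηe, hζe, hη1, hηζ⟩ :=
    exists_radial_mollifier (EuclideanSpace ℝ (Fin N)) volume
  refine ae_bounded_of_subcritical_potential_estimate hN hp1 hp2 (g := g) (by fun_prop) ?_ ?_ hv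
  · intro r r' hr hrr' hr'
    have hR : 0 < r' - r := sub_pos.2 hrr'
    have hvi : Integrable ((ball 0 r').indicator v) :=
      integrable_indicator_of_lintegral_rpow hvm
        (by rw [le_div_iff₀ hN2]; linarith) (hv r' hr')
    have hgi : Integrable ((ball 0 r').indicator g) :=
      integrable_indicator_nonlinearity hN hp1 hp2 hvm ham hbm ha hb hr' (hv r' hr')
    have hrepr := weak_solution_representation hN hζc hζ hζe hηc hη hηe hη1 hηζ (r := r) hR hvi hgi
      (fun φ h1 h2 h3 => by
        rw [add_sub_cancel] at h3
        rw [integral_indicator_mul_of_tsupport (tsupport_lap_subset.trans h3),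
          integral_indicator_mul_of_tsupport h3]
        exact hw φ h1 h2 (h3.trans (ball_subset_ball hr'.le)))
    obtain ⟨C, hC⟩ := (hasCompactSupport_rescaled
      (integrable_of_norm_ge_one_eq_zero hηc.continuous hη).1 hR).exists_bound_of_continuous
      (contDiff_rescaled hηc _).continuous
    refine ⟨fun y => ‖potKernel ζ (r' - r) y‖ₑ, (measurable_potKernel hζc.continuous).enorm, ?_,
      ENNReal.ofReal C * ∫⁻ y, ‖(ball 0 r').indicator v y‖ₑ,
      ENNReal.mul_lt_top ENNReal.ofReal_lt_top hvi.2, ?_⟩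
    · intro σ hσ hσN
      have := (integrable_norm_potKernel_rpow (R := r' - r) hN hζc.continuous hζ hσ hσN).2
      refine lt_of_eq_of_lt (lintegral_congr fun y => ?_) this
      rw [Real.enorm_rpow_of_nonneg (norm_nonneg _) hσ.le, enorm_norm]
    · filter_upwards [hrepr] with x hx hxr
      have hx := hx hxr
      rw [indicator_of_mem (ball_subset_ball hrr'.le hxr)] at hx
      rw [hx]
      refine (enorm_add_le _ _).trans (add_le_add ((enorm_convolution_le _ _ _).trans_eq ?_)
        ((enorm_convolution_le _ _ _).trans ?_))
      · simp only [enorm_indicator_eq_indicator_enorm]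
      · calc _ ≤ ∫⁻ y, ENNReal.ofReal C * ‖(ball 0 r').indicator v (x - y)‖ₑ :=
            lintegral_mono fun y => by
              gcongr
              rw [← ofReal_norm]
              exact ENNReal.ofReal_le_ofReal (hC y)
          _ = _ := by
            rw [lintegral_const_mul' _ _ ENNReal.ofReal_ne_top,
              lintegral_sub_left_eq_self (fun y => ‖(ball 0 r').indicator v y‖ₑ) x]
  · intro r hr
    obtain ⟨A, hA0, hA⟩ := exists_norm_le_of_contDiffOn ha hr
    obtain ⟨B, hB0, hB⟩ := exists_norm_le_of_contDiffOn hb hr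
    exact ⟨ENNReal.ofReal (A + B), ENNReal.ofReal_lt_top, fun x hx =>
      enorm_nonlinearity_le hp1 (hA x hx) (hB x hx)⟩

theorem weak_solution_contDiffOn_one (hN : 3 ≤ N) (hp1 : 1 < p)
    (hp2 : p < ((N : ℝ) + 2) / ((N : ℝ) - 2)) (hvm : Measurable v)
    (ham : Measurable a) (hbm : Measurable b)
    (ha : ContinuousOn a (ball 0 1)) (hb : ContinuousOn b (ball 0 1))
    (hv : ∀ r < 1, ∫⁻ x in ball (0 : EuclideanSpace ℝ (Fin N)) r,
      ‖v x‖ₑ ^ (2 * (N : ℝ) / (N - 2)) < ⊤)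
    (hw : ∀ φ : EuclideanSpace ℝ (Fin N) → ℝ, ContDiff ℝ ∞ φ → HasCompactSupport φ →
      tsupport φ ⊆ ball 0 1 →
      ∫ x, v x * lap φ x = -∫ x, (a x * v x + b x * (|v x| ^ (p - 1) * v x)) * φ x) :
    ∃ w : EuclideanSpace ℝ (Fin N) → ℝ, ContDiffOn ℝ 1 w (ball 0 1) ∧
      ∀ᵐ x, x ∈ ball (0 : EuclideanSpace ℝ (Fin N)) 1 → v x = w x := by
  have hN' : (3 : ℝ) ≤ N := by exact_mod_cast hN
  have hN2 : (0 : ℝ) < N - 2 := by linarith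
  have hbd := weak_solution_ae_bounded hN hp1 hp2 hvm ham hbm ha hb hv hw
  set g := fun x => a x * v x + b x * (|v x| ^ (p - 1) * v x) with hg
  obtain ⟨η, ζ, hηc, hζc, hη, hζ, hηe, hζe, hη1, hηζ⟩ :=
    exists_radial_mollifier (EuclideanSpace ℝ (Fin N)) volume
  refine exists_contDiffOn_ball_ae_eq fun r hr => ?_
  set r' := (1 + r) / 2 with hr'def
  have hr' : r' < 1 := by rw [hr'def]; linarith
  have hR : 0 < r' - r := by rw [hr'def]; linarith
  have hvi : Integrable ((ball 0 r').indicator v) :=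
    integrable_indicator_of_lintegral_rpow hvm
      (by rw [le_div_iff₀ hN2]; linarith) (hv r' hr')
  have hgi : Integrable ((ball 0 r').indicator g) :=
    integrable_indicator_nonlinearity hN hp1 hp2 hvm ham hbm ha hb hr' (hv r' hr')
  have hrepr := weak_solution_representation hN hζc hζ hζe hηc hη hηe hη1 hηζ (r := r) hR hvi hgi
    (fun φ h1 h2 h3 => by
      rw [add_sub_cancel] at h3
      rw [integral_indicator_mul_of_tsupport (tsupport_lap_subset.trans h3),
        integral_indicator_mul_of_tsupport h3]
      exact hw φ h1 h2 (h3.trans (ball_subset_ball hr'.le)))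
  obtain ⟨A, hA0, hA⟩ := exists_norm_le_of_contDiffOn ha hr'
  obtain ⟨B, hB0, hB⟩ := exists_norm_le_of_contDiffOn hb hr'
  obtain ⟨V, hV, hVv⟩ := hbd r' hr'
  have hgb : ∀ᵐ x, ‖(ball 0 r').indicator g x‖ ≤
      (ENNReal.ofReal (A + B) * (V ^ p + 1)).toReal := by
    filter_upwards [hVv] with x hx
    by_cases hxm : x ∈ ball (0 : EuclideanSpace ℝ (Fin N)) r'
    · rw [indicator_of_mem hxm, ← toReal_enorm]
      refine ENNReal.toReal_mono (ENNReal.mul_ne_top ENNReal.ofReal_ne_top (by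
        simp [ENNReal.rpow_eq_top_iff, hV.ne, not_lt.2 (by linarith : 0 ≤ p)])) ?_
      refine (enorm_nonlinearity_le hp1 (hA x hxm) (hB x hxm)).trans ?_
      exact mul_le_mul' le_rfl (add_le_add (ENNReal.rpow_le_rpow (hx hxm) (by linarith)) le_rfl)
    · rw [indicator_of_notMem hxm, norm_zero]
      exact ENNReal.toReal_nonneg
  refine ⟨_, ContDiff.contDiffOn ((potKernel_convolution_contDiff_one (R := r' - r)
      (hζc.of_le (by norm_cast)) hζ hgi.aestronglyMeasurable hgb).add
      (((hasCompactSupport_rescaled (integrable_of_norm_ge_one_eq_zero hηc.continuous hη).1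
        hR).contDiff_convolution_left (n := 1) (ContinuousLinearMap.lsmul ℝ ℝ)
        ((contDiff_rescaled hηc (r' - r)).of_le (by norm_cast))
        hvi.locallyIntegrable))), ?_⟩
  filter_upwards [hrepr] with x hx hxr
  have hx := hx hxr
  rwa [indicator_of_mem (ball_subset_ball (by linarith) hxr)] at hx

end LocalBound

section IntegrationByParts

variable {E : Type*} [NormedAddCommGroup E] [NormedSpace ℝ E] [FiniteDimensional ℝ E]
  [MeasurableSpace E] [BorelSpace E] {μ : Measure E} [μ.IsAddHaarMeasure] {U : Set E} {f g : E → ℝ}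

theorem contDiff_mul_of_tsupport_subset {n : WithTop ℕ∞} (hU : IsOpen U) (hf : ContDiffOn ℝ n f U)
    (hg : ContDiff ℝ n g) (hgU : tsupport g ⊆ U) : ContDiff ℝ n fun x => f x * g x := by
  rw [contDiff_iff_contDiffAt]
  intro x
  by_cases hx : x ∈ U
  · exact (hf.contDiffAt (hU.mem_nhds hx)).mul hg.contDiffAt
  · have : (fun x => f x * g x) =ᶠ[nhds x] fun _ => 0 := by
      filter_upwards [(isClosed_tsupport g).isOpen_compl.mem_nhds fun h => hx (hgU h)] with y hy
      rw [image_eq_zero_of_notMem_tsupport hy, mul_zero]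
    exact contDiffAt_const.congr_of_eventuallyEq this

theorem continuous_mul_of_tsupport_subset (hU : IsOpen U) (hf : ContinuousOn f U)
    (hg : Continuous g) (hgU : tsupport g ⊆ U) : Continuous fun x => f x * g x :=
  contDiff_zero.1 (contDiff_mul_of_tsupport_subset hU (contDiffOn_zero.2 hf) (contDiff_zero.2 hg) hgU)

theorem integrable_mul_of_tsupport_subset (hU : IsOpen U) (hf : ContinuousOn f U)
    (hg : Continuous g) (hgs : HasCompactSupport g) (hgU : tsupport g ⊆ U) :
    Integrable (fun x => f x * g x) μ :=
  (continuous_mul_of_tsupport_subset hU hf hg hgU).integrable_of_hasCompactSupport hgs.mul_left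

theorem integral_mul_fderiv_apply_eq (hU : IsOpen U) (hf : ContDiffOn ℝ 1 f U)
    (hg : ContDiff ℝ 1 g) (hgs : HasCompactSupport g) (hgU : tsupport g ⊆ U) (v : E) :
    ∫ x, f x * fderiv ℝ g x v ∂μ = -∫ x, fderiv ℝ f x v * g x ∂μ := by
  have hgv : Continuous fun x => fderiv ℝ g x v :=
    (hg.continuous_fderiv one_ne_zero).clm_apply continuous_const
  have hfv : ContinuousOn (fun x => fderiv ℝ f x v) U :=
    (hf.continuousOn_fderiv_of_isOpen hU le_rfl).clm_apply continuousOn_const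
  have hs := tsupport_fderiv_apply_subset ℝ (f := g) v
  refine integral_mul_fderiv_eq_neg_fderiv_mul_of_integrable
    (integrable_mul_of_tsupport_subset hU hfv hg.continuous hgs hgU)
    (integrable_mul_of_tsupport_subset hU hf.continuousOn hgv
      (hgs.mono' ((subset_tsupport _).trans hs)) (hs.trans hgU))
    (integrable_mul_of_tsupport_subset hU hf.continuousOn hg.continuous hgs hgU)
    (fun x hx => (hf.differentiableOn one_ne_zero).differentiableAt (hU.mem_nhds (hgU hx)))
    (fun x _ => hg.differentiable one_ne_zero x)

end IntegrationByParts

section Laplacian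

variable {N : ℕ} {U : Set (EuclideanSpace ℝ (Fin N))} {f g : EuclideanSpace ℝ (Fin N) → ℝ}

theorem contDiffOn_fderiv_apply (hU : IsOpen U) (hf : ContDiffOn ℝ 2 f U)
    (v : EuclideanSpace ℝ (Fin N)) : ContDiffOn ℝ 1 (fun x => fderiv ℝ f x v) U :=
  (hf.fderiv_of_isOpen hU (m := 1) (by norm_num)).clm_apply contDiffOn_const

theorem continuousOn_lap (hU : IsOpen U) (hf : ContDiffOn ℝ 2 f U) : ContinuousOn (lap f) U :=
  continuousOn_finsetSum _ fun _ _ =>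
    ((contDiffOn_fderiv_apply hU hf _).continuousOn_fderiv_of_isOpen hU le_rfl).clm_apply
      continuousOn_const

theorem integral_mul_lap_eq (hU : IsOpen U) (hf : ContDiffOn ℝ 2 f U)
    (hg : ContDiff ℝ 2 g) (hgs : HasCompactSupport g) (hgU : tsupport g ⊆ U) :
    ∫ x, f x * lap g x = ∫ x, lap f x * g x := by
  have hs := fun i : Fin N =>
    tsupport_fderiv_apply_subset ℝ (f := g) (EuclideanSpace.single i (1 : ℝ))
  have hc := fun i : Fin N => hasCompactSupport_fderiv_apply hgs (EuclideanSpace.single i (1 : ℝ))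
  have hd := fun i : Fin N => contDiff_fderiv_apply' hg (EuclideanSpace.single i (1 : ℝ))
  simp only [lap, Finset.mul_sum, Finset.sum_mul]
  rw [integral_finsetSum, integral_finsetSum]
  · refine Finset.sum_congr rfl fun i _ => ?_
    rw [integral_mul_fderiv_apply_eq hU (hf.of_le (by norm_num)) (hd i) (hc i) ((hs i).trans hgU),
      integral_mul_fderiv_apply_eq hU (contDiffOn_fderiv_apply hU hf _)
        (hg.of_le (by norm_num)) hgs hgU, neg_neg]
  · intro i _
    exact integrable_mul_of_tsupport_subset hU
      (((contDiffOn_fderiv_apply hU hf _).continuousOn_fderiv_of_isOpen hU le_rfl).clm_apply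
      continuousOn_const) hg.continuous hgs hgU
  · intro i _
    exact integrable_mul_of_tsupport_subset hU hf.continuousOn
      (((hd i).continuous_fderiv one_ne_zero).clm_apply continuous_const)
      (hasCompactSupport_fderiv_apply (hc i) _)
      ((tsupport_fderiv_apply_subset ℝ _).trans ((hs i).trans hgU))

end Laplacian

section Cutoff

variable {N : ℕ}

theorem exists_ball_cutoff {r : ℝ} (hr : r < 1) :
    ∃ χ : EuclideanSpace ℝ (Fin N) → ℝ, ContDiff ℝ ∞ χ ∧ HasCompactSupport χ ∧
      tsupport χ ⊆ ball 0 1 ∧ ∀ x ∈ ball (0 : EuclideanSpace ℝ (Fin N)) r, χ x = 1 := by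
  let b : ContDiffBump (0 : EuclideanSpace ℝ (Fin N)) :=
    ⟨max r (1/2), (1 + max r (1/2)) / 2, by positivity, by
      have : max r (1/2) < 1 := max_lt hr (by norm_num)
      linarith⟩
  refine ⟨b, b.contDiff, b.hasCompactSupport, ?_, fun x hx => ?_⟩
  · rw [b.tsupport_eq]
    refine closedBall_subset_ball ?_
    have : max r (1/2) < 1 := max_lt hr (by norm_num)
    change (1 + max r (1/2)) / 2 < 1
    linarith
  · exact b.one_of_mem_closedBall (ball_subset_closedBall (ball_subset_ball (le_max_left _ _) hx))

end Cutoff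

section LocalBound

variable {N : ℕ} {p : ℝ} {v a b : EuclideanSpace ℝ (Fin N) → ℝ}

theorem weak_solution_contDiffOn_two (hN : 3 ≤ N) (hp1 : 1 < p)
    (hp2 : p < ((N : ℝ) + 2) / ((N : ℝ) - 2)) (hvm : Measurable v)
    (ham : Measurable a) (hbm : Measurable b)
    (ha : ContDiffOn ℝ 1 a (ball 0 1)) (hb : ContDiffOn ℝ 1 b (ball 0 1))
    (hv : ∀ r < 1, ∫⁻ x in ball (0 : EuclideanSpace ℝ (Fin N)) r,
      ‖v x‖ₑ ^ (2 * (N : ℝ) / (N - 2)) < ⊤)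
    (hw : ∀ φ : EuclideanSpace ℝ (Fin N) → ℝ, ContDiff ℝ ∞ φ → HasCompactSupport φ →
      tsupport φ ⊆ ball 0 1 →
      ∫ x, v x * lap φ x = -∫ x, (a x * v x + b x * (|v x| ^ (p - 1) * v x)) * φ x) :
    ∃ w : EuclideanSpace ℝ (Fin N) → ℝ, ContDiffOn ℝ 2 w (ball 0 1) ∧
      ∀ᵐ x, x ∈ ball (0 : EuclideanSpace ℝ (Fin N)) 1 → v x = w x := by
  have hN' : (3 : ℝ) ≤ N := by exact_mod_cast hN
  have hN2 : (0 : ℝ) < N - 2 := by linarith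
  obtain ⟨w, hwc, hvw⟩ := weak_solution_contDiffOn_one hN hp1 hp2 hvm ham hbm ha.continuousOn
    hb.continuousOn hv hw
  set g := fun x => a x * w x + b x * (|w x| ^ (p - 1) * w x) with hg
  have hgc : ContDiffOn ℝ 1 g (ball 0 1) :=
    (ha.mul hwc).add (hb.mul ((contDiff_abs_rpow_mul hp1).comp_contDiffOn hwc))
  obtain ⟨η, ζ, hηc, hζc, hη, hζ, hηe, hζe, hη1, hηζ⟩ :=
    exists_radial_mollifier (EuclideanSpace ℝ (Fin N)) volume
  refine exists_contDiffOn_ball_ae_eq fun r hr => ?_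
  set r' := (1 + r) / 2 with hr'def
  have hr' : r' < 1 := by rw [hr'def]; linarith
  have hR : 0 < r' - r := by rw [hr'def]; linarith
  obtain ⟨χ, hχc, hχs, hχU, hχ1⟩ := exists_ball_cutoff (N := N) hr'
  have hvi : Integrable ((ball 0 r').indicator v) :=
    integrable_indicator_of_lintegral_rpow hvm
      (by rw [le_div_iff₀ hN2]; linarith) (hv r' hr')
  have hGc : ContDiff ℝ 1 fun x => g x * χ x :=
    contDiff_mul_of_tsupport_subset isOpen_ball hgc (hχc.of_le (by norm_cast)) hχU
  have hGs : HasCompactSupport fun x => g x * χ x := hχs.mul_left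
  have hrepr := weak_solution_representation hN hζc hζ hζe hηc hη hηe hη1 hηζ (r := r) hR hvi
    (hGc.continuous.integrable_of_hasCompactSupport hGs)
    (fun φ h1 h2 h3 => by
      rw [add_sub_cancel] at h3
      rw [integral_indicator_mul_of_tsupport (tsupport_lap_subset.trans h3),
        hw φ h1 h2 (h3.trans (ball_subset_ball hr'.le))]
      congr 1
      refine integral_congr_ae ?_
      filter_upwards [hvw] with x hx
      by_cases hxm : x ∈ ball (0 : EuclideanSpace ℝ (Fin N)) r'
      · simp only [hg, hx (ball_subset_ball hr'.le hxm), hχ1 x hxm, mul_one]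
      · simp [image_eq_zero_of_notMem_tsupport fun h => hxm (h3 h)])
  refine ⟨_, ContDiff.contDiffOn ((potKernel_convolution_contDiff_two (R := r' - r) hN
      (hζc.of_le (by norm_cast)) hζ hGc hGs).add
      (((hasCompactSupport_rescaled (integrable_of_norm_ge_one_eq_zero hηc.continuous hη).1
        hR).contDiff_convolution_left (n := 2) (ContinuousLinearMap.lsmul ℝ ℝ)
        ((contDiff_rescaled hηc (r' - r)).of_le (by norm_cast))
        hvi.locallyIntegrable))), ?_⟩
  filter_upwards [hrepr] with x hx hxr
  have hx := hx hxr
  rwa [indicator_of_mem (ball_subset_ball (by linarith) hxr)] at hx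

theorem weak_solution_regularity (hN : 3 ≤ N) (hp1 : 1 < p)
    (hp2 : p < ((N : ℝ) + 2) / ((N : ℝ) - 2)) (hvm : Measurable v)
    (ham : Measurable a) (hbm : Measurable b)
    (ha : ContDiffOn ℝ 1 a (ball 0 1)) (hb : ContDiffOn ℝ 1 b (ball 0 1))
    (hv : ∀ r < 1, ∫⁻ x in ball (0 : EuclideanSpace ℝ (Fin N)) r,
      ‖v x‖ₑ ^ (2 * (N : ℝ) / (N - 2)) < ⊤)
    (hw : ∀ φ : EuclideanSpace ℝ (Fin N) → ℝ, ContDiff ℝ ∞ φ → HasCompactSupport φ →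
      tsupport φ ⊆ ball 0 1 →
      ∫ x, v x * lap φ x = -∫ x, (a x * v x + b x * (|v x| ^ (p - 1) * v x)) * φ x) :
    ∃ w : EuclideanSpace ℝ (Fin N) → ℝ, ContDiffOn ℝ 2 w (ball 0 1) ∧
      (∀ᵐ x, x ∈ ball (0 : EuclideanSpace ℝ (Fin N)) 1 → v x = w x) ∧
      ∀ x ∈ ball (0 : EuclideanSpace ℝ (Fin N)) 1,
        lap w x + (a x * w x + b x * (|w x| ^ (p - 1) * w x)) = 0 := by
  obtain ⟨w, hwc, hvw⟩ := weak_solution_contDiffOn_two hN hp1 hp2 hvm ham hbm ha hb hv hw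
  refine ⟨w, hwc, hvw, ?_⟩
  set g := fun x => a x * w x + b x * (|w x| ^ (p - 1) * w x) with hg
  have hgc : ContinuousOn g (ball 0 1) :=
    ((ha.mul (hwc.of_le (by norm_num))).add (hb.mul ((contDiff_abs_rpow_mul hp1).comp_contDiffOn
      (hwc.of_le (by norm_num))))).continuousOn
  have hlc := continuousOn_lap isOpen_ball hwc
  have hc : ContinuousOn (fun x => lap w x + g x) (ball 0 1) := hlc.add hgc
  have hae := isOpen_ball.ae_eq_zero_of_integral_contDiff_smul_eq_zero (μ := volume)
    (hc.locallyIntegrableOn measurableSet_ball) (fun φ h1 h2 h3 => by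
      have e1 := integral_mul_lap_eq isOpen_ball hwc (h1.of_le (by norm_cast)) h2 h3
      have e2 : ∫ x, v x * lap φ x = ∫ x, w x * lap φ x := by
        refine integral_congr_ae ?_
        filter_upwards [hvw] with x hx
        by_cases hxm : x ∈ ball (0 : EuclideanSpace ℝ (Fin N)) 1
        · simp only [hx hxm]
        · simp [lap_eq_zero_of_notMem_tsupport fun h => hxm (h3 h)]
      have e3 : ∫ x, (a x * v x + b x * (|v x| ^ (p - 1) * v x)) * φ x = ∫ x, g x * φ x := by
        refine integral_congr_ae ?_
        filter_upwards [hvw] with x hx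
        by_cases hxm : x ∈ ball (0 : EuclideanSpace ℝ (Fin N)) 1
        · simp only [hg, hx hxm]
        · simp [image_eq_zero_of_notMem_tsupport fun h => hxm (h3 h)]
      have e4 := hw φ h1 h2 h3
      have i1 := integrable_mul_of_tsupport_subset (μ := volume) isOpen_ball hlc h1.continuous h2 h3
      have i2 := integrable_mul_of_tsupport_subset (μ := volume) isOpen_ball hgc h1.continuous h2 h3
      simp only [smul_eq_mul]
      calc ∫ x, φ x * (lap w x + g x) = ∫ x, (lap w x * φ x + g x * φ x) := by
            congr 1; ext x; ring
        _ = 0 := by rw [integral_add i1 i2, ← e1, ← e2, ← e3, e4]; ring)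
  have := Measure.eqOn_open_of_ae_eq (μ := volume) (f := fun x => lap w x + g x) (g := fun _ => 0)
    ((ae_restrict_iff' measurableSet_ball).2 hae) isOpen_ball hc continuousOn_const
  exact fun x hx => this hx

end LocalBound

end

section

open MeasureTheory Set Metric
open scoped ContDiff RealInnerProductSpace ENNReal

/-- The Euclidean space `ℝ^N`. -/
abbrev Euc (N : ℕ) := EuclideanSpace ℝ (Fin N)

section HardyLift

variable {N : ℕ} {c : ℝ}

/-- The weight `1 - |x|²`, positive exactly on the open unit ball. -/
noncomputable def discWeight (x : Euc N) : ℝ := 1 - ‖x‖ ^ 2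

/-- The zeroth-order coefficient left after completing the square in the Hardy form. -/
noncomputable def hardyMass (c : ℝ) (x : Euc N) : ℝ :=
  (1 - c + (N - 1) * discWeight x) / discWeight x ^ 2

/-- The field whose squared `L²` norm is the Hardy form `∫ |∇φ|² - c (1 - |x|²)⁻² φ²`. -/
noncomputable def hardyLift (c : ℝ) (φ : Euc N → ℝ) (x : Euc N) : WithLp 2 (ℝ × Euc N) :=
  WithLp.toLp 2 (√(hardyMass c x) * φ x, gradient φ x + ((discWeight x)⁻¹ * φ x) • x)

/-- Smooth functions with compact support in the open unit ball. -/
def testSpace (N : ℕ) : Submodule ℝ (Euc N → ℝ) where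
  carrier := {φ | ContDiff ℝ ∞ φ ∧ HasCompactSupport φ ∧ tsupport φ ⊆ ball 0 1}
  add_mem' := fun ha hb => ⟨ha.1.add hb.1, ha.2.1.add hb.2.1,
    (tsupport_add _ _).trans (union_subset ha.2.2 hb.2.2)⟩
  zero_mem' := ⟨contDiff_const, HasCompactSupport.zero, by
    rw [tsupport_eq_empty_iff.2 rfl]; exact empty_subset _⟩
  smul_mem' := fun t _ ha => ⟨contDiff_const.smul ha.1, ha.2.1.smul_left,
    (closure_mono (Function.support_const_smul_subset t _)).trans ha.2.2⟩

theorem discWeight_pos {x : Euc N} (hx : x ∈ ball 0 1) : 0 < discWeight x := by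
  rw [mem_ball_zero_iff] at hx
  unfold discWeight
  nlinarith [norm_nonneg x]

theorem discWeight_le_one (x : Euc N) : discWeight x ≤ 1 := by
  unfold discWeight
  nlinarith [norm_nonneg x]

theorem contDiff_discWeight {n : WithTop ℕ∞} : ContDiff ℝ n (discWeight : Euc N → ℝ) :=
  contDiff_const.sub (contDiff_norm_sq ℝ)

theorem contDiffOn_inv_discWeight {n : WithTop ℕ∞} :
    ContDiffOn ℝ n (fun x : Euc N => (discWeight x)⁻¹) (ball 0 1) :=
  contDiff_discWeight.contDiffOn.inv fun _ hx => (discWeight_pos hx).ne'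

theorem hardyMass_ge (hN : 1 ≤ N) {x : Euc N} (hx : x ∈ ball 0 1) :
    (1 - c) / discWeight x ^ 2 ≤ hardyMass c x := by
  have h1 := discWeight_pos hx
  have : (1 : ℝ) ≤ N := by exact_mod_cast hN
  unfold hardyMass
  gcongr
  nlinarith

theorem hardyMass_pos (hN : 1 ≤ N) (hc : c < 1) {x : Euc N} (hx : x ∈ ball 0 1) :
    0 < hardyMass c x :=
  (div_pos (by linarith) (pow_pos (discWeight_pos hx) 2)).trans_le (hardyMass_ge hN hx)

theorem continuousOn_sqrt_hardyMass : ContinuousOn (fun x : Euc N => √(hardyMass c x)) (ball 0 1) := by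
  refine ContinuousOn.sqrt (ContinuousOn.div ?_ ?_ fun x hx => pow_ne_zero _ (discWeight_pos hx).ne')
  · exact (continuous_const.add (continuous_const.mul
      (contDiff_discWeight (n := 0)).continuous)).continuousOn
  · exact ((contDiff_discWeight (n := 0)).continuous.pow 2).continuousOn

variable {φ ψ : Euc N → ℝ}

theorem inner_gradient_eq_fderiv (φ : Euc N → ℝ) (x v : Euc N) : ⟪gradient φ x, v⟫ = fderiv ℝ φ x v :=
  inner_gradient_left

theorem gradient_apply (φ : Euc N → ℝ) (x : Euc N) (i : Fin N) :
    gradient φ x i = fderiv ℝ φ x (EuclideanSpace.single i 1) := by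
  rw [← inner_gradient_eq_fderiv, real_inner_comm, EuclideanSpace.inner_single_left]
  simp

theorem continuous_gradient (hφ : ContDiff ℝ 1 φ) : Continuous (gradient φ) :=
  (InnerProductSpace.toDual ℝ (Euc N)).symm.continuous.comp (hφ.continuous_fderiv one_ne_zero)

theorem gradient_eq_zero_of_notMem_tsupport {x : Euc N} (hx : x ∉ tsupport φ) :
    gradient φ x = 0 := by
  have : fderiv ℝ φ x = 0 := image_eq_zero_of_notMem_tsupport fun h => hx (tsupport_fderiv_subset ℝ h)
  rw [gradient, this, map_zero]

theorem hardyLift_eq_zero_of_notMem_tsupport {x : Euc N} (hx : x ∉ tsupport φ) :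
    hardyLift c φ x = 0 := by
  unfold hardyLift
  rw [gradient_eq_zero_of_notMem_tsupport hx, image_eq_zero_of_notMem_tsupport hx]
  simp

theorem continuous_hardyLift (hφ : φ ∈ testSpace N) : Continuous (hardyLift c φ) := by
  refine (WithLp.prod_continuous_toLp 2 ℝ (Euc N)).comp (Continuous.prodMk ?_ ?_)
  · exact continuous_mul_of_tsupport_subset isOpen_ball continuousOn_sqrt_hardyMass
      hφ.1.continuous hφ.2.2
  · exact (continuous_gradient (hφ.1.of_le (by norm_cast))).add
      ((continuous_mul_of_tsupport_subset isOpen_ball (contDiffOn_inv_discWeight (n := 0)).continuousOn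
      hφ.1.continuous hφ.2.2).smul continuous_id)

theorem hasCompactSupport_hardyLift (hφ : φ ∈ testSpace N) : HasCompactSupport (hardyLift c φ) :=
  HasCompactSupport.intro hφ.2.1 fun _ hx => hardyLift_eq_zero_of_notMem_tsupport hx

theorem memLp_hardyLift (hφ : φ ∈ testSpace N) : MemLp (hardyLift c φ) 2 volume :=
  (continuous_hardyLift hφ).memLp_of_hasCompactSupport (hasCompactSupport_hardyLift hφ)

theorem hardyLift_add (hφ : φ ∈ testSpace N) (hψ : ψ ∈ testSpace N) :
    hardyLift c (φ + ψ) = hardyLift c φ + hardyLift c ψ := by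
  ext x : 1
  have h1 := (hφ.1.differentiable (by simp)) x
  have h2 := (hψ.1.differentiable (by simp)) x
  have : gradient (φ + ψ) x = gradient φ x + gradient ψ x := by
    simp [gradient, fderiv_add h1 h2]
  simp only [hardyLift, Pi.add_apply, ← WithLp.toLp_add, this, Prod.mk_add_mk, mul_add, add_smul]
  congr 2
  abel

theorem hardyLift_smul (hφ : φ ∈ testSpace N) (t : ℝ) :
    hardyLift c (t • φ) = t • hardyLift c φ := by
  ext x : 1
  have h1 := (hφ.1.differentiable (by simp)) x
  have : gradient (t • φ) x = t • gradient φ x := by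
    simp [gradient, fderiv_const_smul h1]
  simp only [hardyLift, Pi.smul_apply, ← WithLp.toLp_smul, this, Prod.smul_mk, smul_eq_mul, smul_add,
    smul_smul, mul_left_comm t]

/-- The lift of test functions to `L²` fields, an isometry for the Hardy form. -/
noncomputable def hardyMap (N : ℕ) (c : ℝ) : testSpace N →ₗ[ℝ] Lp (WithLp 2 (ℝ × Euc N)) 2 (volume : Measure (Euc N)) where
  toFun φ := (memLp_hardyLift (c := c) φ.2).toLp _
  map_add' φ ψ := by
    rw [← MemLp.toLp_add]
    exact MemLp.toLp_congr _ _ (by rw [Submodule.coe_add, hardyLift_add φ.2 ψ.2])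
  map_smul' t φ := by
    rw [RingHom.id_apply, ← MemLp.toLp_const_smul]
    exact MemLp.toLp_congr _ _ (by rw [Submodule.coe_smul, hardyLift_smul φ.2])

theorem norm_gradient_le_hardyLift (hN : 1 ≤ N) (hc : c < 1) (hφ : φ ∈ testSpace N) (x : Euc N) :
    ‖(discWeight x)⁻¹ * φ x‖ ≤ (√(1 - c))⁻¹ * ‖hardyLift c φ x‖ ∧
      ‖gradient φ x‖ ≤ (1 + (√(1 - c))⁻¹) * ‖hardyLift c φ x‖ := by
  by_cases hx : x ∈ ball (0 : Euc N) 1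
  swap
  · have hx : x ∉ tsupport φ := fun h => hx (hφ.2.2 h)
    rw [gradient_eq_zero_of_notMem_tsupport hx, image_eq_zero_of_notMem_tsupport hx]
    have : 0 ≤ (√(1 - c))⁻¹ := by positivity
    constructor <;> simp <;> positivity
  have hsq := WithLp.prod_norm_sq_eq_of_L2 (hardyLift c φ x)
  have hf : ‖(hardyLift c φ x).fst‖ ≤ ‖hardyLift c φ x‖ :=
    abs_le_of_sq_le_sq' (by nlinarith [sq_nonneg ‖(hardyLift c φ x).snd‖]) (norm_nonneg _) |>.2
  have hs : ‖(hardyLift c φ x).snd‖ ≤ ‖hardyLift c φ x‖ :=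
    abs_le_of_sq_le_sq' (by nlinarith [sq_nonneg ‖(hardyLift c φ x).fst‖]) (norm_nonneg _) |>.2
  have hρ := discWeight_pos hx
  have hc0 : 0 < √(1 - c) := Real.sqrt_pos.2 (by linarith)
  have h1 : √(1 - c) * (discWeight x)⁻¹ ≤ √(hardyMass c x) := by
    rw [← div_eq_mul_inv, ← Real.sqrt_sq hρ.le, ← Real.sqrt_div (by linarith)]
    exact Real.sqrt_le_sqrt (hardyMass_ge hN hx)
  have h2 : ‖(discWeight x)⁻¹ * φ x‖ ≤ (√(1 - c))⁻¹ * ‖hardyLift c φ x‖ := by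
    rw [← div_eq_inv_mul ‖hardyLift c φ x‖, le_div_iff₀ hc0]
    refine le_trans ?_ hf
    change ‖(discWeight x)⁻¹ * φ x‖ * √(1 - c) ≤ ‖√(hardyMass c x) * φ x‖
    rw [norm_mul, norm_mul, Real.norm_of_nonneg (Real.sqrt_nonneg _),
      Real.norm_of_nonneg (inv_nonneg.2 hρ.le)]
    calc _ = √(1 - c) * (discWeight x)⁻¹ * ‖φ x‖ := by ring
      _ ≤ _ := by gcongr
  refine ⟨h2, ?_⟩
  have h3 : gradient φ x = (hardyLift c φ x).snd - ((discWeight x)⁻¹ * φ x) • x := by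
    simp [hardyLift]
  rw [h3]
  refine (norm_sub_le _ _).trans ?_
  rw [norm_smul, one_add_mul]
  have hx1 : ‖x‖ ≤ 1 := (mem_ball_zero_iff.1 hx).le
  exact add_le_add hs ((mul_le_of_le_one_right (norm_nonneg _) hx1).trans h2)

end HardyLift

section HardyForm

variable {N : ℕ} {c : ℝ} {φ ψ : Euc N → ℝ}

theorem hasFDerivAt_discWeight (x : Euc N) :
    HasFDerivAt discWeight (-(2 • innerSL ℝ x)) x := by
  have := (hasStrictFDerivAt_norm_sq x).hasFDerivAt
  exact (this.const_sub 1)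

theorem fderiv_inv_discWeight_mul {x : Euc N} (hx : x ∈ ball 0 1) (hψ : DifferentiableAt ℝ ψ x)
    (v : Euc N) : fderiv ℝ (fun y => (discWeight y)⁻¹ * ψ y) x v =
      (discWeight x)⁻¹ * fderiv ℝ ψ x v + 2 * ⟪x, v⟫ * (discWeight x)⁻¹ ^ 2 * ψ x := by
  have h0 := (discWeight_pos hx).ne'
  have h1 : HasFDerivAt (fun y => (discWeight y)⁻¹) _ x :=
    (hasDerivAt_inv h0).comp_hasFDerivAt x (hasFDerivAt_discWeight x)
  rw [(h1.fun_mul hψ.hasFDerivAt).fderiv]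
  simp
  field_simp

/-- The operator `-Δ - c (1 - |x|²)⁻²` associated with the Hardy form. -/
noncomputable def hardyOperator (c : ℝ) (ψ : Euc N → ℝ) (x : Euc N) : ℝ :=
  -lap ψ x - c * (discWeight x)⁻¹ ^ 2 * ψ x

theorem sum_inner_single_mul (x y : Euc N) : ∑ i, x i * y i = ⟪x, y⟫ := by
  rw [PiLp.inner_apply]
  exact Finset.sum_congr rfl fun i _ => by simp [mul_comm]

theorem contDiff_inv_discWeight_mul (hψ : ψ ∈ testSpace N) :
    ContDiff ℝ 1 fun x => (discWeight x)⁻¹ * ψ x :=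
  contDiff_mul_of_tsupport_subset isOpen_ball contDiffOn_inv_discWeight
    (hψ.1.of_le (by norm_cast)) hψ.2.2

theorem inner_hardyLift_eq (hφ : φ ∈ testSpace N) (hψ : ψ ∈ testSpace N) (hN : 1 ≤ N) (hc : c < 1)
    (x : Euc N) :
    ⟪hardyLift c φ x, hardyLift c ψ x⟫ = φ x * hardyOperator c ψ x +
      ∑ i : Fin N, (φ x * fderiv ℝ (fun y => fderiv ℝ ψ y (EuclideanSpace.single i 1) +
        (discWeight y)⁻¹ * ψ y * y i) x (EuclideanSpace.single i 1) +
        fderiv ℝ φ x (EuclideanSpace.single i 1) * (fderiv ℝ ψ x (EuclideanSpace.single i 1) +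
        (discWeight x)⁻¹ * ψ x * x i)) := by
  by_cases hx : x ∈ ball (0 : Euc N) 1
  swap
  · have hx' : x ∉ tsupport φ := fun h => hx (hφ.2.2 h)
    rw [hardyLift_eq_zero_of_notMem_tsupport hx', image_eq_zero_of_notMem_tsupport hx']
    have : fderiv ℝ φ x = 0 :=
      image_eq_zero_of_notMem_tsupport fun h => hx' (tsupport_fderiv_subset ℝ h)
    simp [this]
  have hψd : Differentiable ℝ ψ := hψ.1.differentiable (by simp)
  have hψ2 : ContDiff ℝ 2 ψ := hψ.1.of_le (by norm_cast)
  have hd : ∀ i : Fin N, fderiv ℝ (fun y => fderiv ℝ ψ y (EuclideanSpace.single i 1) +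
        (discWeight y)⁻¹ * ψ y * y i) x (EuclideanSpace.single i 1) =
      fderiv ℝ (fun y => fderiv ℝ ψ y (EuclideanSpace.single i 1)) x (EuclideanSpace.single i 1) +
      (((discWeight x)⁻¹ * (gradient ψ x i) + 2 * x i * (discWeight x)⁻¹ ^ 2 * ψ x) * x i +
        (discWeight x)⁻¹ * ψ x) := by
    intro i
    have h1 : DifferentiableAt ℝ (fun y => fderiv ℝ ψ y (EuclideanSpace.single i 1)) x :=
      (contDiff_fderiv_apply' hψ2 _).differentiable one_ne_zero x
    have h2 : DifferentiableAt ℝ (fun y => (discWeight y)⁻¹ * ψ y) x :=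
      (contDiff_inv_discWeight_mul hψ).differentiable one_ne_zero x
    have h3 : HasFDerivAt (fun y : Euc N => y i) (EuclideanSpace.proj (𝕜 := ℝ) i : Euc N →L[ℝ] ℝ) x :=
      (EuclideanSpace.proj (𝕜 := ℝ) i : Euc N →L[ℝ] ℝ).hasFDerivAt
    rw [(h1.hasFDerivAt.fun_add (h2.hasFDerivAt.fun_mul h3)).fderiv]
    simp only [add_apply, smul_apply,
      fderiv_inv_discWeight_mul hx (hψd x), gradient_apply, smul_eq_mul]
    simp [EuclideanSpace.inner_single_right]
    ring
  simp only [hd, gradient_apply]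
  rw [WithLp.prod_inner_apply]
  have hm := hardyMass_pos hN hc hx
  have hρ := discWeight_pos hx
  simp only [hardyLift, hardyOperator, lap, mul_add, Finset.sum_add_distrib, ← Finset.mul_sum,
    inner_add_left, inner_add_right, real_inner_smul_left, real_inner_smul_right, gradient_apply, ← sum_inner_single_mul]
  have e1 : ⟪√(hardyMass c x) * φ x, √(hardyMass c x) * ψ x⟫ = hardyMass c x * φ x * ψ x := by
    have := Real.mul_self_sqrt hm.le
    simp
    linear_combination φ x * ψ x * this
  rw [e1]
  have e2 : ∑ i, x i * x i = 1 - discWeight x := by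
    rw [sum_inner_single_mul, real_inner_self_eq_norm_sq]; unfold discWeight; ring
  have e3 : ∑ i, fderiv ℝ φ x (EuclideanSpace.single i 1) * ((discWeight x)⁻¹ * ψ x * x i) =
      (discWeight x)⁻¹ * ψ x * ∑ i, fderiv ℝ φ x (EuclideanSpace.single i 1) * x i := by
    rw [Finset.mul_sum]; exact Finset.sum_congr rfl fun i _ => by ring
  have e4 : ∑ i, (((discWeight x)⁻¹ * fderiv ℝ ψ x (EuclideanSpace.single i 1) + 2 * x i * (discWeight x)⁻¹ ^ 2 * ψ x) * x i) =
      (discWeight x)⁻¹ * ∑ i, x i * fderiv ℝ ψ x (EuclideanSpace.single i 1) +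
        2 * (discWeight x)⁻¹ ^ 2 * ψ x * ∑ i, x i * x i := by
    rw [Finset.mul_sum, Finset.mul_sum, ← Finset.sum_add_distrib]
    exact Finset.sum_congr rfl fun i _ => by ring
  have e5 : hardyMass c x = (1 - c + (N - 1) * discWeight x) * (discWeight x)⁻¹ ^ 2 := by
    unfold hardyMass; field_simp
  rw [e3, e4, e2, e5]
  simp
  field_simp
  ring

end HardyForm

section HardySpace

variable {N : ℕ} {c : ℝ} {φ ψ : Euc N → ℝ}

theorem contDiff_hardyFlux (hψ : ψ ∈ testSpace N) (i : Fin N) :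
    ContDiff ℝ 1 fun y => fderiv ℝ ψ y (EuclideanSpace.single i 1) + (discWeight y)⁻¹ * ψ y * y i :=
  (contDiff_fderiv_apply' (hψ.1.of_le (by norm_cast)) _).add
    ((contDiff_inv_discWeight_mul hψ).mul (EuclideanSpace.proj (𝕜 := ℝ) i : Euc N →L[ℝ] ℝ).contDiff)

theorem continuous_hardyOperator (hψ : ψ ∈ testSpace N) : Continuous (hardyOperator c ψ) := by
  have h1 : Continuous fun x => (discWeight x)⁻¹ ^ 2 * ψ x :=
    continuous_mul_of_tsupport_subset isOpen_ball
      ((contDiffOn_inv_discWeight (n := 0)).continuousOn.pow 2) hψ.1.continuous hψ.2.2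
  have h2 : Continuous (lap ψ) :=
    continuousOn_univ.1 (continuousOn_lap isOpen_univ (hψ.1.of_le (by norm_cast)).contDiffOn)
  unfold hardyOperator
  simp only [mul_assoc]
  exact h2.neg.sub (continuous_const.mul h1)

theorem hardyOperator_eq_zero_of_notMem_tsupport {x : Euc N} (hx : x ∉ tsupport ψ) :
    hardyOperator c ψ x = 0 := by
  have : lap ψ x = 0 := image_eq_zero_of_notMem_tsupport fun h => hx (tsupport_lap_subset h)
  rw [hardyOperator, this, image_eq_zero_of_notMem_tsupport hx]
  simp

theorem hasCompactSupport_hardyOperator (hψ : ψ ∈ testSpace N) :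
    HasCompactSupport (hardyOperator c ψ) :=
  HasCompactSupport.intro hψ.2.1 fun _ hx => hardyOperator_eq_zero_of_notMem_tsupport hx

theorem integral_inner_hardyLift (hN : 1 ≤ N) (hc : c < 1) (hφ : φ ∈ testSpace N)
    (hψ : ψ ∈ testSpace N) :
    ∫ x, ⟪hardyLift c φ x, hardyLift c ψ x⟫ = ∫ x, φ x * hardyOperator c ψ x := by
  simp_rw [inner_hardyLift_eq hφ hψ hN hc]
  have hφ1 : ContDiff ℝ 1 φ := hφ.1.of_le (by norm_cast)
  have hi1 : ∀ i : Fin N, Integrable fun x => φ x * fderiv ℝ (fun y =>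
      fderiv ℝ ψ y (EuclideanSpace.single i 1) + (discWeight y)⁻¹ * ψ y * y i) x
      (EuclideanSpace.single i 1) := fun i =>
    (hφ.1.continuous.mul (((contDiff_hardyFlux hψ i).continuous_fderiv one_ne_zero).clm_apply
      continuous_const)).integrable_of_hasCompactSupport hφ.2.1.mul_right
  have hi2 : ∀ i : Fin N, Integrable fun x => fderiv ℝ φ x (EuclideanSpace.single i 1) *
      (fderiv ℝ ψ x (EuclideanSpace.single i 1) + (discWeight x)⁻¹ * ψ x * x i) := fun i =>
    (((hφ1.continuous_fderiv one_ne_zero).clm_apply continuous_const).mul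
      (contDiff_hardyFlux hψ i).continuous).integrable_of_hasCompactSupport
      (hasCompactSupport_fderiv_apply hφ.2.1 _).mul_right
  have hi3 : ∀ i : Fin N, Integrable fun x => φ x * fderiv ℝ (fun y =>
      fderiv ℝ ψ y (EuclideanSpace.single i 1) + (discWeight y)⁻¹ * ψ y * y i) x
      (EuclideanSpace.single i 1) + fderiv ℝ φ x (EuclideanSpace.single i 1) *
      (fderiv ℝ ψ x (EuclideanSpace.single i 1) + (discWeight x)⁻¹ * ψ x * x i) :=
    fun i => (hi1 i).add (hi2 i)
  rw [integral_add _ (integrable_finsetSum _ fun i _ => hi3 i),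
    integral_finsetSum _ fun i _ => hi3 i, Finset.sum_eq_zero, add_zero]
  · intro i _
    rw [integral_add (hi1 i) (hi2 i), add_eq_zero_iff_eq_neg']
    have := integral_mul_fderiv_apply_eq (μ := volume) isOpen_univ (contDiff_hardyFlux hψ i).contDiffOn hφ1
      hφ.2.1 (subset_univ _) (EuclideanSpace.single i 1)
    simp only [mul_comm] at this ⊢
    exact this
  · exact (hφ.1.continuous.mul (continuous_hardyOperator hψ)).integrable_of_hasCompactSupport
      hφ.2.1.mul_right

/-- The completion of the test functions for the Hardy form, as a closed subspace of `L²` fields. -/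
noncomputable def hardySpace (N : ℕ) (c : ℝ) :
    Submodule ℝ (Lp (WithLp 2 (ℝ × Euc N)) 2 (volume : Measure (Euc N))) :=
  (LinearMap.range (hardyMap N c)).topologicalClosure

theorem hardyMap_mem (φ : testSpace N) : hardyMap N c φ ∈ hardySpace N c :=
  Submodule.le_topologicalClosure _ ⟨φ, rfl⟩

theorem coeFn_hardyMap (φ : testSpace N) : hardyMap N c φ =ᵐ[volume] hardyLift c φ :=
  MemLp.coeFn_toLp (memLp_hardyLift φ.2)

theorem hardySpace_induction {P : Lp (WithLp 2 (ℝ × Euc N)) 2 (volume : Measure (Euc N)) → Prop}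
    (hcl : IsClosed {h | P h}) (hP : ∀ φ, P (hardyMap N c φ)) {h} (hh : h ∈ hardySpace N c) : P h := by
  rw [hardySpace, ← SetLike.mem_coe, Submodule.topologicalClosure_coe] at hh
  exact closure_minimal (s := (LinearMap.range (hardyMap N c) : Set _)) (by rintro _ ⟨φ, rfl⟩; exact hP φ)
    hcl hh

theorem inner_toLp_eq_integral (h : Lp (WithLp 2 (ℝ × Euc N)) 2 (volume : Measure (Euc N)))
    {g : Euc N → WithLp 2 (ℝ × Euc N)} (hg : MemLp g 2 volume) :
    ⟪h, hg.toLp g⟫ = ∫ x, ⟪h x, g x⟫ := by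
  rw [L2.inner_def]
  exact integral_congr_ae (hg.coeFn_toLp.mono fun x hx => by simp only [hx])

theorem inner_eq_zero_of_mem_hardySpace {a h : Lp (WithLp 2 (ℝ × Euc N)) 2 (volume : Measure (Euc N))}
    (ha : ∀ φ, ⟪hardyMap N c φ, a⟫ = 0) (hh : h ∈ hardySpace N c) : ⟪h, a⟫ = 0 :=
  hardySpace_induction (P := fun h => ⟪h, a⟫ = 0)
    (isClosed_eq (continuous_id.inner continuous_const) continuous_const) ha hh

/-- The factor recovering a function from the scalar component of its lift. -/
noncomputable def hardyUnlift (c : ℝ) : Euc N → ℝ :=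
  (ball 0 1).indicator fun x => (√(hardyMass c x))⁻¹

theorem measurable_discWeight : Measurable (discWeight : Euc N → ℝ) :=
  (contDiff_discWeight (n := 0)).continuous.measurable

theorem measurable_hardyMass : Measurable (hardyMass c : Euc N → ℝ) := by
  unfold hardyMass
  have := measurable_discWeight (N := N)
  fun_prop

theorem measurable_hardyUnlift : Measurable (hardyUnlift c : Euc N → ℝ) :=
  (measurable_hardyMass.sqrt.inv).indicator measurableSet_ball

theorem hardyUnlift_of_mem {x : Euc N} (hx : x ∈ ball 0 1) :
    hardyUnlift c x = (√(hardyMass c x))⁻¹ := indicator_of_mem hx _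

theorem hardyUnlift_of_notMem {x : Euc N} (hx : x ∉ ball 0 1) : hardyUnlift c x = 0 :=
  indicator_of_notMem hx _

theorem hardyUnlift_nonneg (x : Euc N) : 0 ≤ hardyUnlift c x :=
  indicator_nonneg (fun _ _ => by positivity) x

theorem hardyUnlift_le (hN : 1 ≤ N) (hc : c < 1) {x : Euc N} (hx : x ∈ ball 0 1) :
    hardyUnlift c x ≤ (√(1 - c))⁻¹ * discWeight x := by
  have hρ := discWeight_pos hx
  have hc0 : 0 < √(1 - c) := Real.sqrt_pos.2 (by linarith)
  have h1 : √(1 - c) * (discWeight x)⁻¹ ≤ √(hardyMass c x) := by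
    rw [← div_eq_mul_inv, ← Real.sqrt_sq hρ.le, ← Real.sqrt_div (by linarith)]
    exact Real.sqrt_le_sqrt (hardyMass_ge hN hx)
  rw [hardyUnlift_of_mem hx]
  calc _ ≤ (√(1 - c) * (discWeight x)⁻¹)⁻¹ := inv_anti₀ (by positivity) h1
    _ = _ := by rw [mul_inv, inv_inv]

theorem hardyUnlift_mul_fst (hN : 1 ≤ N) (hc : c < 1) (hφ : φ ∈ testSpace N) (x : Euc N) :
    hardyUnlift c x * (hardyLift c φ x).fst = φ x := by
  by_cases hx : x ∈ ball (0 : Euc N) 1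
  · have := (Real.sqrt_pos.2 (hardyMass_pos hN hc hx)).ne'
    rw [hardyUnlift_of_mem hx]
    exact inv_mul_cancel_left₀ this _
  · rw [hardyUnlift_of_notMem hx, zero_mul, image_eq_zero_of_notMem_tsupport fun h => hx (hφ.2.2 h)]

theorem memLp_hardyUnlift_mul (hN : 1 ≤ N) (hc : c < 1) {g : Euc N → ℝ} (hg : MemLp g 2 volume) :
    MemLp (fun x => hardyUnlift c x * g x) 2 volume := by
  refine MemLp.of_le_mul (c := (√(1 - c))⁻¹) hg
    (measurable_hardyUnlift.aestronglyMeasurable.mul hg.1) (ae_of_all _ fun x => ?_)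
  rw [norm_mul]
  gcongr
  rw [Real.norm_of_nonneg (hardyUnlift_nonneg x)]
  by_cases hx : x ∈ ball (0 : Euc N) 1
  · exact (hardyUnlift_le hN hc hx).trans
      (mul_le_of_le_one_right (by positivity) (discWeight_le_one x))
  · rw [hardyUnlift_of_notMem hx]; positivity

theorem memLp_toLp_prod {f : Euc N → ℝ} {g : Euc N → Euc N} (hf : MemLp f 2 volume)
    (hg : MemLp g 2 volume) : MemLp (fun x => WithLp.toLp 2 (f x, g x)) 2 volume := by
  refine (hf.norm.add hg.norm).of_le
    ((WithLp.prod_continuous_toLp 2 ℝ (Euc N)).comp_aestronglyMeasurable (hf.1.prodMk hg.1))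
    (ae_of_all _ fun x => ?_)
  have h1 : (0:ℝ) ≤ ‖f x‖ + ‖g x‖ := by positivity
  simp only [Pi.add_apply]
  rw [Real.norm_of_nonneg h1]
  refine abs_le_of_sq_le_sq' ?_ h1 |>.2
  rw [WithLp.prod_norm_sq_eq_of_L2]
  change ‖f x‖ ^ 2 + ‖g x‖ ^ 2 ≤ _
  nlinarith [mul_nonneg (norm_nonneg (f x)) (norm_nonneg (g x))]

theorem memLp_toLp_prod_zero {f : Euc N → ℝ} (hf : MemLp f 2 volume) :
    MemLp (fun x => WithLp.toLp 2 (f x, (0 : Euc N))) 2 volume :=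
  memLp_toLp_prod hf (MemLp.zero (ε := Euc N))

theorem inner_hardyMap_eq (hN : 1 ≤ N) (hc : c < 1)
    {h : Lp (WithLp 2 (ℝ × Euc N)) 2 (volume : Measure (Euc N))} (hh : h ∈ hardySpace N c)
    (ψ : testSpace N) :
    ⟪h, hardyMap N c ψ⟫ = ∫ x, hardyUnlift c x * (h x).fst * hardyOperator c ψ x := by
  have hm0 : MemLp (hardyOperator c (ψ : Euc N → ℝ)) 2 volume :=
    (continuous_hardyOperator ψ.2).memLp_of_hasCompactSupport (hasCompactSupport_hardyOperator ψ.2)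
  have hm := memLp_toLp_prod_zero (memLp_hardyUnlift_mul hN hc hm0)
  have key : ∀ φ, ⟪hardyMap N c φ, hardyMap N c ψ - hm.toLp _⟫ = 0 := by
    intro φ
    rw [inner_sub_right, sub_eq_zero, inner_toLp_eq_integral]
    have e1 : ⟪hardyMap N c φ, hardyMap N c ψ⟫ = ∫ x, ⟪hardyLift c φ.1 x, hardyLift c ψ.1 x⟫ := by
      rw [L2.inner_def]
      refine integral_congr_ae ?_
      filter_upwards [coeFn_hardyMap (c := c) φ, coeFn_hardyMap (c := c) ψ] with x h1 h2
      rw [h1, h2]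
    rw [e1, integral_inner_hardyLift hN hc φ.2 ψ.2]
    refine integral_congr_ae ?_
    filter_upwards [coeFn_hardyMap (c := c) φ] with x h1
    rw [h1, WithLp.prod_inner_apply]
    simp only [inner_zero_right, add_zero]
    have := hardyUnlift_mul_fst hN hc φ.2 x
    rw [← this]
    change _ = hardyUnlift c x * hardyOperator c _ x * (hardyLift c _ x).fst
    ring
  have key2 := inner_eq_zero_of_mem_hardySpace key hh
  rw [inner_sub_right, sub_eq_zero] at key2
  rw [key2, inner_toLp_eq_integral]
  refine integral_congr_ae (ae_of_all _ fun x => ?_)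
  simp only [WithLp.prod_inner_apply, inner_zero_right, add_zero]
  change hardyUnlift c x * hardyOperator c _ x * (h x).fst = _
  ring

theorem integral_snd_mul_eq (hN : 1 ≤ N) (hc : c < 1)
    {h : Lp (WithLp 2 (ℝ × Euc N)) 2 (volume : Measure (Euc N))} (hh : h ∈ hardySpace N c)
    (hψ : ψ ∈ testSpace N) (i : Fin N) :
    ∫ x, (hardyUnlift c x * (h x).fst * (fderiv ℝ ψ x (EuclideanSpace.single i 1) -
      (discWeight x)⁻¹ * ψ x * x i) + (h x).snd i * ψ x) = 0 := by
  have hψ1 : ContDiff ℝ 1 ψ := hψ.1.of_le (by norm_cast)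
  have hcont : Continuous fun x => fderiv ℝ ψ x (EuclideanSpace.single i 1) -
      (discWeight x)⁻¹ * ψ x * x i :=
    ((hψ1.continuous_fderiv one_ne_zero).clm_apply continuous_const).sub
      ((contDiff_inv_discWeight_mul hψ).continuous.mul (EuclideanSpace.proj (𝕜 := ℝ) i).continuous)
  have hsupp : HasCompactSupport fun x => fderiv ℝ ψ x (EuclideanSpace.single i 1) -
      (discWeight x)⁻¹ * ψ x * x i :=
    HasCompactSupport.intro hψ.2.1 fun x hx => by
      rw [image_eq_zero_of_notMem_tsupport hx, ← gradient_apply,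
        gradient_eq_zero_of_notMem_tsupport hx]
      simp
  have hm : MemLp (fun x => WithLp.toLp 2 (hardyUnlift c x * (fderiv ℝ ψ x (EuclideanSpace.single i 1) -
      (discWeight x)⁻¹ * ψ x * x i), ψ x • (EuclideanSpace.single i 1 : Euc N))) 2 volume :=
    memLp_toLp_prod (memLp_hardyUnlift_mul hN hc (hcont.memLp_of_hasCompactSupport hsupp))
      ((hψ1.continuous.smul continuous_const).memLp_of_hasCompactSupport hψ.2.1.smul_right)
  have key := inner_eq_zero_of_mem_hardySpace (c := c) (a := hm.toLp _) (h := h) ?_ hh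
  · rw [← key, inner_toLp_eq_integral]
    refine integral_congr_ae (ae_of_all _ fun x => ?_)
    simp only [WithLp.prod_inner_apply]
    simp [real_inner_smul_right, EuclideanSpace.inner_single_right]
    ring
  · intro φ
    have hφ1 : ContDiff ℝ 1 (φ : Euc N → ℝ) := φ.2.1.of_le (by norm_cast)
    rw [inner_toLp_eq_integral]
    have e := integral_mul_fderiv_apply_eq (μ := volume) isOpen_univ hφ1.contDiffOn hψ1
      hψ.2.1 (subset_univ _) (EuclideanSpace.single i 1)
    have hi1 : Integrable fun x => (φ : Euc N → ℝ) x * fderiv ℝ ψ x (EuclideanSpace.single i 1) :=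
      (hφ1.continuous.mul ((hψ1.continuous_fderiv one_ne_zero).clm_apply
        continuous_const)).integrable_of_hasCompactSupport φ.2.2.1.mul_right
    have hi2 : Integrable fun x => fderiv ℝ (φ : Euc N → ℝ) x (EuclideanSpace.single i 1) * ψ x :=
      (((hφ1.continuous_fderiv one_ne_zero).clm_apply
        continuous_const).mul hψ1.continuous).integrable_of_hasCompactSupport hψ.2.1.mul_left
    rw [← add_eq_zero_iff_eq_neg, ← integral_add hi1 hi2] at e
    rw [← e]
    refine integral_congr_ae ?_
    filter_upwards [coeFn_hardyMap (c := c) φ] with x h1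
    rw [h1, WithLp.prod_inner_apply]
    have := hardyUnlift_mul_fst hN hc φ.2 x
    have h2 : (hardyLift c φ x).snd i = fderiv ℝ (φ : Euc N → ℝ) x (EuclideanSpace.single i 1) +
      (discWeight x)⁻¹ * (φ : Euc N → ℝ) x * x i := by
      simp [hardyLift, gradient_apply]
    simp [real_inner_smul_right, EuclideanSpace.inner_single_right]
    rw [h2]
    linear_combination (fderiv ℝ ψ x (EuclideanSpace.single i 1) -
      (discWeight x)⁻¹ * ψ x * x i) * this

end HardySpace

end

section

open MeasureTheory Set Metric
open scoped ContDiff RealInnerProductSpace ENNReal NNReal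

section SobolevBounds

variable {N : ℕ} {c : ℝ} {φ ψ : Euc N → ℝ}

/-- The critical Sobolev exponent `2N / (N - 2)`. -/
noncomputable def critExp (N : ℕ) : ℝ := 2 * (N : ℝ) / (N - 2)

theorem two_lt_critExp (hN : 3 ≤ N) : 2 < critExp N := by
  have : (3 : ℝ) ≤ N := by exact_mod_cast hN
  rw [critExp, lt_div_iff₀ (by linarith)]
  linarith

theorem exists_sobolev_const (hN : 3 ≤ N) : ∃ C : ℝ≥0, ∀ u : Euc N → ℝ, ContDiff ℝ 1 u →
    HasCompactSupport u → ∫⁻ x, ‖u x‖ₑ ^ critExp N ≤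
      C * (∫⁻ x, ‖fderiv ℝ u x‖ₑ ^ (2 : ℝ)) ^ (critExp N / 2) := by
  have hτ := two_lt_critExp hN
  have hN' : (3 : ℝ) ≤ N := by exact_mod_cast hN
  have hτ0 : 0 < critExp N := by linarith
  set K := SNormLESNormFDerivOfEqConst ℝ (volume : Measure (Euc N)) 2
  refine ⟨K ^ critExp N, fun u hu hus => ?_⟩
  have hP : (Real.toNNReal (critExp N) : ℝ) = critExp N := Real.coe_toNNReal _ hτ0.le
  have hP0 : (Real.toNNReal (critExp N) : ℝ≥0∞) ≠ 0 := by simpa using hτ0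
  have h := eLpNorm_le_eLpNorm_fderiv_of_eq (volume : Measure (Euc N)) hu hus (p := 2)
    (p' := Real.toNNReal (critExp N)) (by norm_num) (by simp; omega) (by
      rw [hP, critExp, finrank_euclideanSpace_fin]
      push_cast
      field_simp)
  rw [eLpNorm_eq_lintegral_rpow_enorm_toReal hP0 ENNReal.coe_ne_top,
    eLpNorm_eq_lintegral_rpow_enorm_toReal (by norm_num) ENNReal.coe_ne_top] at h
  simp only [ENNReal.coe_toReal, hP, NNReal.coe_ofNat] at h
  have h2 := ENNReal.rpow_le_rpow h hτ0.le
  rw [ENNReal.mul_rpow_of_nonneg _ _ hτ0.le, ← ENNReal.rpow_mul, ← ENNReal.rpow_mul,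
    one_div_mul_cancel hτ0.ne', ENNReal.rpow_one, one_div_mul_eq_div] at h2
  rw [ENNReal.coe_rpow_of_nonneg _ hτ0.le]
  exact h2

theorem norm_fderiv_eq_norm_gradient (φ : Euc N → ℝ) (x : Euc N) : ‖fderiv ℝ φ x‖ = ‖gradient φ x‖ :=
  ((InnerProductSpace.toDual ℝ (Euc N)).symm.norm_map _).symm

theorem exists_scaled_cutoff (N : ℕ) : ∃ C : ℝ, 0 ≤ C ∧ ∀ (y : Euc N) (δ : ℝ), 0 < δ →
    ∃ χ : Euc N → ℝ, ContDiff ℝ ∞ χ ∧ (∀ x, 0 ≤ χ x ∧ χ x ≤ 1) ∧ (∀ x ∈ ball y δ, χ x = 1) ∧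
      (∀ x ∉ ball y (2 * δ), χ x = 0 ∧ fderiv ℝ χ x = 0) ∧ ∀ x, ‖fderiv ℝ χ x‖ ≤ C / δ := by
  let b : ContDiffBump (0 : Euc N) := ⟨1, 2, one_pos, one_lt_two⟩
  have hb : ContDiff ℝ ∞ (b : Euc N → ℝ) := b.contDiff
  have hb1 : ContDiff ℝ 1 (b : Euc N → ℝ) := b.contDiff
  obtain ⟨C, hC⟩ := (hb1.continuous_fderiv one_ne_zero).bounded_above_of_compact_support
    (b.hasCompactSupport.fderiv ℝ)
  have hf : ∀ (y : Euc N) (δ : ℝ) x, HasFDerivAt (fun x => b (δ⁻¹ • (x - y)))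
      (δ⁻¹ • fderiv ℝ b (δ⁻¹ • (x - y))) x := by
    intro y δ x
    have h1 : HasFDerivAt (fun x : Euc N => δ⁻¹ • (x - y)) (δ⁻¹ • ContinuousLinearMap.id ℝ (Euc N)) x :=
      ((hasFDerivAt_id x).sub_const y).const_smul δ⁻¹
    have h2 := (hb1.differentiable one_ne_zero (δ⁻¹ • (x - y))).hasFDerivAt.comp x h1
    refine h2.congr_fderiv ?_
    ext v
    simp
  refine ⟨C, (norm_nonneg _).trans (hC 0), fun y δ hδ => ⟨fun x => b (δ⁻¹ • (x - y)), ?_, fun x =>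
    ⟨b.nonneg, b.le_one⟩, fun x hx => ?_, fun x hx => ?_, fun x => ?_⟩⟩
  · exact hb.comp ((contDiff_id.sub contDiff_const).const_smul δ⁻¹)
  · refine b.one_of_mem_closedBall ?_
    rw [mem_ball, dist_eq_norm] at hx
    rw [mem_closedBall_zero_iff, norm_smul, norm_inv, Real.norm_of_nonneg hδ.le,
      ← div_eq_inv_mul, div_le_iff₀ hδ]
    change _ ≤ 1 * δ
    linarith
  · have hz : δ⁻¹ • (x - y) ∉ ball (0 : Euc N) 2 := by
      rw [mem_ball, dist_eq_norm] at hx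
      rw [mem_ball_zero_iff, norm_smul, norm_inv, Real.norm_of_nonneg hδ.le,
        ← div_eq_inv_mul, div_lt_iff₀ hδ]
      exact hx
    have h0 : b (δ⁻¹ • (x - y)) = 0 := by
      rw [← Function.notMem_support, b.support_eq]; exact hz
    refine ⟨h0, IsLocalMin.fderiv_eq_zero (Filter.Eventually.of_forall fun z => ?_)⟩
    simp only [h0]
    exact b.nonneg
  · rw [(hf y δ x).fderiv, norm_smul, norm_inv, Real.norm_of_nonneg hδ.le, ← div_eq_inv_mul]
    gcongr
    exact hC _

theorem lintegral_enorm_rpow_critExp_le (hN : 3 ≤ N) (hc : c < 1) : ∃ C : ℝ≥0, ∀ φ ∈ testSpace N,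
    ∫⁻ x, ‖φ x‖ₑ ^ critExp N ≤
      C * (∫⁻ x, ‖hardyLift c φ x‖ₑ ^ (2 : ℝ)) ^ (critExp N / 2) := by
  obtain ⟨C, hC⟩ := exists_sobolev_const hN
  have hτ := two_lt_critExp hN
  set K : ℝ := 1 + (√(1 - c))⁻¹
  have hK : 0 ≤ K := by positivity
  refine ⟨C * ((Real.toNNReal K) ^ (2 : ℝ)) ^ (critExp N / 2), fun φ hφ =>
    (hC φ (hφ.1.of_le (by norm_cast)) hφ.2.1).trans ?_⟩
  rw [ENNReal.coe_mul, mul_assoc, ENNReal.coe_rpow_of_nonneg _ (by linarith),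
    ← ENNReal.mul_rpow_of_nonneg _ _ (by linarith), ← lintegral_const_mul' _ _ ENNReal.coe_ne_top]
  gcongr with x
  rw [ENNReal.coe_rpow_of_nonneg _ (by norm_num), ← ENNReal.mul_rpow_of_nonneg _ _ (by norm_num)]
  gcongr
  rw [← ofReal_norm, ← ofReal_norm, norm_fderiv_eq_norm_gradient, ← ENNReal.ofReal, ← ENNReal.ofReal_mul hK]
  exact ENNReal.ofReal_le_ofReal (norm_gradient_le_hardyLift (by omega) hc hφ x).2

theorem lintegral_ball_enorm_rpow_critExp_le (hN : 3 ≤ N) (hc : c < 1) : ∃ C : ℝ≥0,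
    ∀ φ ∈ testSpace N, ∀ (y : Euc N) (δ : ℝ), 0 < δ → 1 - 2 * δ ≤ ‖y‖ →
    ∫⁻ x in ball y δ, ‖φ x‖ₑ ^ critExp N ≤
      C * (∫⁻ x in ball y (2 * δ), ‖hardyLift c φ x‖ₑ ^ (2 : ℝ)) ^ (critExp N / 2) := by
  obtain ⟨C, hC⟩ := exists_sobolev_const hN
  obtain ⟨C0, hC0, hcut⟩ := exists_scaled_cutoff N
  have hτ := two_lt_critExp hN
  set K : ℝ := 1 + (√(1 - c))⁻¹ + C0 * (8 * (√(1 - c))⁻¹) with hKdef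
  have hK : 0 ≤ K := by positivity
  refine ⟨C * ((Real.toNNReal K) ^ (2 : ℝ)) ^ (critExp N / 2), fun φ hφ y δ hδ hy => ?_⟩
  obtain ⟨χ, hχ, hχ01, hχ1, hχ0, hχd⟩ := hcut y δ hδ
  have hφd := hφ.1.differentiable (by simp)
  have hχ' := hχ.differentiable (by simp)
  have h1 : ∫⁻ x in ball y δ, ‖φ x‖ₑ ^ critExp N ≤ ∫⁻ x, ‖χ x * φ x‖ₑ ^ critExp N := by
    rw [← lintegral_indicator measurableSet_ball]
    refine lintegral_mono fun x => ?_
    by_cases hx : x ∈ ball y δ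
    · rw [indicator_of_mem hx, hχ1 x hx, one_mul]
    · rw [indicator_of_notMem hx]; exact zero_le
  have hu : ContDiff ℝ 1 fun x => χ x * φ x := (hχ.mul hφ.1).of_le (by norm_cast)
  refine h1.trans ((hC _ hu hφ.2.1.mul_left).trans ?_)
  rw [ENNReal.coe_mul, mul_assoc, ENNReal.coe_rpow_of_nonneg _ (by linarith),
    ← ENNReal.mul_rpow_of_nonneg _ _ (by linarith), ← lintegral_const_mul' _ _ ENNReal.coe_ne_top]
  refine mul_le_mul_right (ENNReal.rpow_le_rpow ?_ (by linarith)) _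
  rw [← lintegral_indicator measurableSet_ball]
  refine lintegral_mono fun x => ?_
  simp only
  rw [fderiv_fun_mul (hχ' x) (hφd x)]
  by_cases hx : x ∈ ball y (2 * δ)
  swap
  · have h0 : ‖χ x • fderiv ℝ φ x + φ x • fderiv ℝ χ x‖ₑ = 0 := by
      rw [← ofReal_norm, (hχ0 x hx).1, (hχ0 x hx).2, zero_smul, smul_zero, add_zero, norm_zero,
        ENNReal.ofReal_zero]
    rw [h0, ENNReal.zero_rpow_of_pos two_pos]
    exact zero_le
  rw [indicator_of_mem hx, ENNReal.coe_rpow_of_nonneg _ (by norm_num), ← ENNReal.mul_rpow_of_nonneg _ _ (by norm_num)]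
  gcongr
  rw [← ofReal_norm, ← ofReal_norm, ← ENNReal.ofReal, ← ENNReal.ofReal_mul hK]
  refine ENNReal.ofReal_le_ofReal ((norm_add_le _ _).trans ?_)
  obtain ⟨g1, g2⟩ := norm_gradient_le_hardyLift (by omega) hc hφ x
  rw [norm_smul, norm_smul, norm_fderiv_eq_norm_gradient φ, Real.norm_of_nonneg (hχ01 x).1]
  have e1 : χ x * ‖gradient φ x‖ ≤ (1 + (√(1 - c))⁻¹) * ‖hardyLift c φ x‖ :=
    (mul_le_of_le_one_left (norm_nonneg _) (hχ01 x).2).trans g2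
  have e2 : ‖φ x‖ ≤ 8 * δ * ((√(1 - c))⁻¹ * ‖hardyLift c φ x‖) := by
    by_cases hx1 : x ∈ ball (0 : Euc N) 1
    · have hρ := discWeight_pos hx1
      have hρ8 : discWeight x ≤ 8 * δ := by
        rw [mem_ball_zero_iff] at hx1
        rw [mem_ball, dist_eq_norm] at hx
        have := norm_sub_norm_le y x
        rw [norm_sub_rev] at this
        unfold discWeight
        nlinarith [norm_nonneg x]
      calc ‖φ x‖ = discWeight x * ‖(discWeight x)⁻¹ * φ x‖ := by
            rw [norm_mul, norm_inv, Real.norm_of_nonneg hρ.le, mul_inv_cancel_left₀ hρ.ne']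
        _ ≤ _ := by gcongr
    · rw [image_eq_zero_of_notMem_tsupport fun h => hx1 (hφ.2.2 h), norm_zero]
      positivity
  have e3 : ‖φ x‖ * ‖fderiv ℝ χ x‖ ≤ C0 * (8 * (√(1 - c))⁻¹) * ‖hardyLift c φ x‖ :=
    calc _ ≤ (8 * δ * ((√(1 - c))⁻¹ * ‖hardyLift c φ x‖)) * (C0 / δ) := by gcongr; exact hχd x
      _ = _ := by field_simp
  rw [hKdef]
  linarith

theorem measurable_ball_indicator {f : Euc N → ℝ≥0∞} (hf : Measurable f) (r : ℝ) :
    Measurable (Function.uncurry fun y x : Euc N => (ball y r).indicator f x) := by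
  have hm : MeasurableSet {z : Euc N × Euc N | dist z.2 z.1 < r} :=
    (isOpen_lt (continuous_snd.dist continuous_fst) continuous_const).measurableSet
  exact (hf.comp measurable_snd).indicator hm

theorem measurable_lintegral_ball {f : Euc N → ℝ≥0∞} (hf : Measurable f) (r : ℝ) :
    Measurable fun y => ∫⁻ x in ball y r, f x := by
  simp_rw [← lintegral_indicator measurableSet_ball]
  exact (measurable_ball_indicator hf r).lintegral_prod_right'

theorem lintegral_lintegral_ball {f : Euc N → ℝ≥0∞} (hf : Measurable f) (r : ℝ) :
    ∫⁻ y, ∫⁻ x in ball y r, f x = volume (ball (0 : Euc N) r) * ∫⁻ x, f x := by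
  simp_rw [← lintegral_indicator measurableSet_ball]
  rw [lintegral_lintegral_swap (f := fun y x : Euc N => (ball y r).indicator f x)
    (measurable_ball_indicator hf r).aemeasurable, ← lintegral_const_mul _ hf]
  refine lintegral_congr fun x => ?_
  have h2 : ∀ y : Euc N, (ball y r).indicator f x = (ball x r).indicator (fun _ => f x) y := fun y => by
    simp only [indicator, mem_ball, dist_comm]
  simp_rw [h2]
  rw [lintegral_indicator measurableSet_ball, setLIntegral_const, mul_comm,
    Measure.addHaar_ball_center]

theorem lintegral_boundary_le (hN : 3 ≤ N) (hc : c < 1) : ∃ C : ℝ≥0,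
    ∀ φ ∈ testSpace N, ∀ (δ : ℝ) (κ : ℝ≥0∞), 0 < δ →
    (∀ y : Euc N, 1 - 2 * δ ≤ ‖y‖ → ∫⁻ x in ball y (2 * δ), ‖hardyLift c φ x‖ₑ ^ (2 : ℝ) ≤ κ) →
    ∫⁻ x in {x | 1 - δ < ‖x‖}, ‖φ x‖ₑ ^ critExp N ≤
      C * κ ^ (critExp N / 2 - 1) * ∫⁻ x, ‖hardyLift c φ x‖ₑ ^ (2 : ℝ) := by
  obtain ⟨C, hC⟩ := lintegral_ball_enorm_rpow_critExp_le (N := N) hN hc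
  have hτ := two_lt_critExp hN
  refine ⟨C * 2 ^ N, fun φ hφ δ κ hδ hκ => ?_⟩
  have hS : MeasurableSet {x : Euc N | 1 - δ < ‖x‖} :=
    (isOpen_lt continuous_const continuous_norm).measurableSet
  set f : Euc N → ℝ≥0∞ := {x : Euc N | 1 - δ < ‖x‖}.indicator fun x => ‖φ x‖ₑ ^ critExp N
  have hfm : Measurable f := (hφ.1.continuous.measurable.enorm.pow_const _).indicator hS
  have hJm : Measurable fun x => ‖hardyLift c φ x‖ₑ ^ (2 : ℝ) :=
    (continuous_hardyLift hφ).measurable.enorm.pow_const _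
  have hpt : ∀ y : Euc N, ∫⁻ x in ball y δ, f x ≤
      C * κ ^ (critExp N / 2 - 1) * ∫⁻ x in ball y (2 * δ), ‖hardyLift c φ x‖ₑ ^ (2 : ℝ) := by
    intro y
    by_cases hy : 1 - 2 * δ ≤ ‖y‖
    · calc _ ≤ ∫⁻ x in ball y δ, ‖φ x‖ₑ ^ critExp N := lintegral_mono (indicator_le_self _ _)
        _ ≤ _ := hC φ hφ y δ hδ hy
        _ = C * ((∫⁻ x in ball y (2 * δ), ‖hardyLift c φ x‖ₑ ^ (2 : ℝ)) ^ (critExp N / 2 - 1) *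
            ∫⁻ x in ball y (2 * δ), ‖hardyLift c φ x‖ₑ ^ (2 : ℝ)) := by
          conv_rhs => rw [← ENNReal.rpow_one (∫⁻ x in ball y (2 * δ), ‖hardyLift c φ x‖ₑ ^ (2 : ℝ)),
            ← ENNReal.rpow_mul, one_mul, ← ENNReal.rpow_add_of_nonneg _ _ (by linarith) (by norm_num),
            sub_add_cancel]
        _ ≤ _ := by
          rw [mul_assoc]
          gcongr
          · linarith
          · exact hκ y hy
    · rw [lintegral_eq_zero_of_ae_eq_zero]
      · exact zero_le
      · filter_upwards [ae_restrict_mem measurableSet_ball] with x hx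
        refine indicator_of_notMem (fun h => hy ?_) _
        rw [mem_ball, dist_eq_norm] at hx
        have := norm_sub_norm_le x y
        have h : 1 - δ < ‖x‖ := h
        linarith
  have hv : volume (ball (0 : Euc N) (2 * δ)) = 2 ^ N * volume (ball (0 : Euc N) δ) := by
    rw [Measure.addHaar_ball_mul_of_pos _ _ two_pos, finrank_euclideanSpace_fin, ENNReal.ofReal_pow (by norm_num)]
    norm_num
  have hv0 : volume (ball (0 : Euc N) δ) ≠ 0 := (measure_ball_pos _ _ hδ).ne'
  have hvt : volume (ball (0 : Euc N) δ) ≠ ⊤ := measure_ball_lt_top.ne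
  rw [← lintegral_indicator hS]
  refine (ENNReal.mul_le_mul_iff_right hv0 hvt).1 ?_
  rw [← lintegral_lintegral_ball hfm]
  refine (lintegral_mono hpt).trans ?_
  rw [lintegral_const_mul _ (measurable_lintegral_ball hJm _), lintegral_lintegral_ball hJm, hv]
  push_cast
  exact le_of_eq (by ring)

end SobolevBounds

end

section

open MeasureTheory Set Metric Filter
open scoped ContDiff RealInnerProductSpace ENNReal NNReal Topology

section Rellich

theorem exists_weakly_convergent_subseq {V : Type*} [NormedAddCommGroup V] [InnerProductSpace ℝ V]
    [CompleteSpace V] [TopologicalSpace.SeparableSpace V] (f : ℕ → V) (K : ℝ)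
    (hf : ∀ n, ‖f n‖ ≤ K) : ∃ k : ℕ → ℕ, StrictMono k ∧ ∃ l : V, ∀ g : V,
      Tendsto (fun n => ⟪f (k n), g⟫) atTop (𝓝 ⟪l, g⟫) := by
  obtain ⟨a, -, k, hk, hl⟩ := WeakDual.isSeqCompact_closedBall ℝ V (0 : StrongDual ℝ V) K
    (x := fun n => StrongDual.toWeakDual (InnerProductSpace.toDual ℝ V (f n))) (fun n => by
      rw [mem_preimage, mem_closedBall, dist_zero_right]
      simpa using hf n)
  refine ⟨k, hk, (InnerProductSpace.toDual ℝ V).symm (WeakDual.toStrongDual a), fun g => ?_⟩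
  rw [InnerProductSpace.toDual_symm_apply]
  have := ((WeakDual.eval_continuous g).tendsto a).comp hl
  simpa [Function.comp_def] using this

theorem lintegral_rpow_two_le {α : Type*} [MeasurableSpace α] {ν : Measure α} [IsProbabilityMeasure ν]
    {f : α → ℝ≥0∞} (hf : AEMeasurable f ν) : (∫⁻ x, f x ∂ν) ^ (2 : ℝ) ≤ ∫⁻ x, f x ^ (2 : ℝ) ∂ν := by
  have := ENNReal.lintegral_mul_le_Lp_mul_Lq ν Real.HolderConjugate.two_two hf
    (aemeasurable_const (b := (1 : ℝ≥0∞)))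
  simp only [Pi.mul_apply, mul_one, ENNReal.one_rpow, lintegral_const, measure_univ] at this
  refine (ENNReal.rpow_le_rpow this (by norm_num)).trans ?_
  rw [← ENNReal.rpow_mul]
  norm_num

theorem enorm_integral_rpow_two_le {α : Type*} [MeasurableSpace α] {ν : Measure α}
    [IsProbabilityMeasure ν] {f : α → ℝ} (hf : AEStronglyMeasurable f ν) :
    ‖∫ x, f x ∂ν‖ₑ ^ (2 : ℝ) ≤ ∫⁻ x, ‖f x‖ₑ ^ (2 : ℝ) ∂ν :=
  (ENNReal.rpow_le_rpow (enorm_integral_le_lintegral_enorm _) (by norm_num)).trans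
    (lintegral_rpow_two_le hf.enorm)

variable {E : Type*} [NormedAddCommGroup E] [InnerProductSpace ℝ E] [FiniteDimensional ℝ E]
  [MeasurableSpace E] [BorelSpace E]

theorem lintegral_translate_sub_le {φ : E → ℝ} (hφ : ContDiff ℝ 1 φ) (t : E) :
    ∫⁻ x, ‖φ x - φ (x + t)‖ₑ ^ (2 : ℝ) ≤ ‖t‖ₑ ^ (2 : ℝ) * ∫⁻ x, ‖fderiv ℝ φ x‖ₑ ^ (2 : ℝ) := by
  have hcd : Continuous (fderiv ℝ φ) := hφ.continuous_fderiv one_ne_zero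
  have h1 : ∀ x, ‖φ x - φ (x + t)‖ₑ ^ (2 : ℝ) ≤
      ∫⁻ r in Ioc (0 : ℝ) 1, (‖t‖ₑ ^ (2 : ℝ) * ‖fderiv ℝ φ (x + r • t)‖ₑ ^ (2 : ℝ)) := by
    intro x
    have hd : ∀ r : ℝ, HasDerivAt (fun r : ℝ => φ (x + r • t)) (fderiv ℝ φ (x + r • t) t) r := by
      intro r
      have h2 : HasDerivAt (fun r : ℝ => x + r • t) t r := by
        simpa using ((hasDerivAt_id r).smul_const t).const_add x
      exact (hφ.differentiable one_ne_zero _).hasFDerivAt.comp_hasDerivAt r h2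
    have hc : Continuous fun r : ℝ => fderiv ℝ φ (x + r • t) t :=
      (hcd.comp (by fun_prop)).clm_apply continuous_const
    have h3 := intervalIntegral.integral_eq_sub_of_hasDerivAt (a := 0) (b := 1) (fun r _ => hd r)
      (hc.intervalIntegrable _ _)
    rw [one_smul, zero_smul, add_zero, intervalIntegral.integral_of_le zero_le_one] at h3
    have : IsProbabilityMeasure (volume.restrict (Ioc (0 : ℝ) 1)) := ⟨by simp⟩
    rw [← enorm_neg, neg_sub, ← h3]
    refine (enorm_integral_rpow_two_le hc.aestronglyMeasurable).trans (lintegral_mono fun r => ?_)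
    simp only
    rw [← ENNReal.mul_rpow_of_nonneg _ _ (by norm_num), mul_comm]
    exact ENNReal.rpow_le_rpow (ContinuousLinearMap.le_opENorm _ _) (by norm_num)
  refine (lintegral_mono h1).trans ?_
  rw [lintegral_lintegral_swap]
  · have h4 : ∀ r : ℝ, ∫⁻ x, (‖t‖ₑ ^ (2 : ℝ) * ‖fderiv ℝ φ (x + r • t)‖ₑ ^ (2 : ℝ)) =
        ‖t‖ₑ ^ (2 : ℝ) * ∫⁻ x, ‖fderiv ℝ φ x‖ₑ ^ (2 : ℝ) := by
      intro r
      rw [lintegral_const_mul' _ _ (by finiteness),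
        lintegral_add_right_eq_self (fun x => ‖fderiv ℝ φ x‖ₑ ^ (2 : ℝ)) (r • t)]
    simp_rw [h4]
    simp
  · refine Measurable.aemeasurable ?_
    simp only [Function.uncurry_def]
    have : Continuous fun z : E × ℝ => fderiv ℝ φ (z.1 + z.2 • t) := hcd.comp (by fun_prop)
    exact (this.enorm.measurable.pow_const _).const_mul _

theorem lintegral_sub_average_le {φ : E → ℝ} (hφ : ContDiff ℝ 1 φ) {δ : ℝ} {ν : Measure E}
    [IsProbabilityMeasure ν] (hν : ∀ᵐ t ∂ν, ‖t‖ ≤ δ) (hi : ∀ x, Integrable (fun t => φ (x + t)) ν) :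
    ∫⁻ x, ‖φ x - ∫ t, φ (x + t) ∂ν‖ₑ ^ (2 : ℝ) ≤
      ENNReal.ofReal δ ^ (2 : ℝ) * ∫⁻ x, ‖fderiv ℝ φ x‖ₑ ^ (2 : ℝ) := by
  have hc := hφ.continuous
  have h1 : ∀ x, ‖φ x - ∫ t, φ (x + t) ∂ν‖ₑ ^ (2 : ℝ) ≤ ∫⁻ t, ‖φ x - φ (x + t)‖ₑ ^ (2 : ℝ) ∂ν := by
    intro x
    have : φ x - ∫ t, φ (x + t) ∂ν = ∫ t, (φ x - φ (x + t)) ∂ν := by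
      rw [integral_sub (integrable_const _) (hi x)]; simp
    rw [this]
    exact enorm_integral_rpow_two_le (by fun_prop)
  refine (lintegral_mono h1).trans ?_
  rw [lintegral_lintegral_swap]
  · refine (lintegral_mono fun t => lintegral_translate_sub_le hφ t).trans ?_
    have : ∀ᵐ t ∂ν, ‖t‖ₑ ^ (2 : ℝ) * ∫⁻ x, ‖fderiv ℝ φ x‖ₑ ^ (2 : ℝ) ≤
        ENNReal.ofReal δ ^ (2 : ℝ) * ∫⁻ x, ‖fderiv ℝ φ x‖ₑ ^ (2 : ℝ) := by
      filter_upwards [hν] with t ht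
      gcongr
      rw [← ofReal_norm]
      exact ENNReal.ofReal_le_ofReal ht
    refine (lintegral_mono_ae this).trans ?_
    simp
  · refine Measurable.aemeasurable ?_
    simp only [Function.uncurry_def]
    have : Continuous fun z : E × E => φ z.1 - φ (z.1 + z.2) := by fun_prop
    exact (this.enorm.measurable.pow_const _)

end Rellich

section Rellich

variable {E : Type*} [NormedAddCommGroup E] [InnerProductSpace ℝ E] [FiniteDimensional ℝ E]
  [MeasurableSpace E] [BorelSpace E]

theorem enorm_add_rpow_two_le (a b : ℝ) :
    ‖a + b‖ₑ ^ (2 : ℝ) ≤ 2 * (‖a‖ₑ ^ (2 : ℝ) + ‖b‖ₑ ^ (2 : ℝ)) := by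
  refine (ENNReal.rpow_le_rpow (enorm_add_le a b) (by norm_num)).trans ?_
  have := ENNReal.rpow_add_le_mul_rpow_add_rpow ‖a‖ₑ ‖b‖ₑ (p := 2) (by norm_num)
  norm_num at this
  exact_mod_cast this

theorem integral_cond_ball_translate (φ : E → ℝ) (δ : ℝ) (x : E) :
    ∫ t, φ (x + t) ∂(ProbabilityTheory.cond volume (ball (0 : E) δ)) =
      (volume (ball (0 : E) δ))⁻¹.toReal * ∫ t in ball x δ, φ t := by
  rw [ProbabilityTheory.cond, integral_smul_measure, smul_eq_mul,
    ← (measurePreserving_add_left volume x).setIntegral_preimage_emb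
      (MeasurableEquiv.addLeft x).measurableEmbedding φ (ball x δ)]
  congr 3
  ext t
  simp

theorem tendsto_lintegral_average {φ : ℕ → E → ℝ} {K : ℝ≥0∞} (hK : K ≠ ⊤)
    (hφ : ∀ n, Continuous (φ n)) (hs : ∀ n x, φ n x ≠ 0 → ‖x‖ < 1)
    (h2 : ∀ n, ∫⁻ x, ‖φ n x‖ₑ ^ (2 : ℝ) ≤ K) {δ : ℝ} (hδ : 0 < δ) {G : E → ℝ}
    (hG : ∀ x, Tendsto (fun n => ∫ t in ball x δ, φ n t) atTop (𝓝 (G x))) :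
    Tendsto (fun n => ∫⁻ x, ‖∫ t, φ n (x + t) ∂(ProbabilityTheory.cond volume (ball (0 : E) δ)) -
      (volume (ball (0 : E) δ))⁻¹.toReal * G x‖ₑ ^ (2 : ℝ)) atTop (𝓝 0) := by
  have hv0 : volume (ball (0 : E) δ) ≠ 0 := (measure_ball_pos _ _ hδ).ne'
  have hvt : volume (ball (0 : E) δ) ≠ ⊤ := measure_ball_lt_top.ne
  set ν := ProbabilityTheory.cond volume (ball (0 : E) δ) with hνdef
  have hν : IsProbabilityMeasure ν := ProbabilityTheory.cond_isProbabilityMeasure_of_finite hv0 hvt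
  set A : ℕ → E → ℝ := fun n x => ∫ t, φ n (x + t) ∂ν
  set G' : E → ℝ := fun x => (volume (ball (0 : E) δ))⁻¹.toReal * G x
  have hAG : ∀ x, Tendsto (fun n => A n x) atTop (𝓝 (G' x)) := fun x => by
    simp only [A, hνdef, integral_cond_ball_translate]
    exact (hG x).const_mul _
  have hAm : ∀ n, Measurable (A n) := fun n => by
    have : Continuous fun z : E × E => φ n (z.1 + z.2) := (hφ n).comp (by fun_prop)
    exact (this.stronglyMeasurable.integral_prod_right (ν := ν)).measurable
  have hG'm : Measurable G' := measurable_of_tendsto_metrizable hAm (tendsto_pi_nhds.2 hAG)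
  set bd : E → ℝ≥0∞ := (ball (0 : E) (1 + δ)).indicator fun _ => (volume (ball (0 : E) δ))⁻¹ * K
  have hb : ∀ n x, ‖A n x‖ₑ ^ (2 : ℝ) ≤ bd x := by
    intro n x
    by_cases hx : x ∈ ball (0 : E) (1 + δ)
    · simp only [bd]
      rw [indicator_of_mem hx]
      refine (enorm_integral_rpow_two_le ((hφ n).comp (by fun_prop : Continuous fun t => x + t)).aestronglyMeasurable).trans ?_
      rw [hνdef, ProbabilityTheory.cond, lintegral_smul_measure, smul_eq_mul]
      gcongr
      refine (setLIntegral_le_lintegral _ _).trans ?_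
      exact (lintegral_add_left_eq_self (fun t => ‖φ n t‖ₑ ^ (2 : ℝ)) x).trans_le (h2 n)
    · have h0 : A n x = 0 := by
        simp only [A, hνdef, integral_cond_ball_translate]
        rw [setIntegral_eq_zero_of_forall_eq_zero, mul_zero]
        intro t ht
        by_contra hne
        refine hx ?_
        have h1 := hs n t hne
        rw [mem_ball, dist_eq_norm] at ht
        rw [mem_ball_zero_iff]
        have := norm_sub_norm_le x t
        rw [norm_sub_rev] at this
        linarith
      rw [h0]
      simp
  have hbG : ∀ x, ‖G' x‖ₑ ^ (2 : ℝ) ≤ bd x := fun x =>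
    le_of_tendsto ((ENNReal.continuous_rpow_const.tendsto _).comp (hAG x).enorm)
      (Eventually.of_forall fun n => hb n x)
  have := tendsto_lintegral_of_dominated_convergence (μ := volume)
    (F := fun n x => ‖A n x - G' x‖ₑ ^ (2 : ℝ)) (f := fun _ => 0) (fun x => 4 * bd x)
    (fun n => ((hAm n).sub hG'm).enorm.pow_const _) (fun n => Eventually.of_forall fun x => ?_) ?_
    (Eventually.of_forall fun x => ?_)
  · rwa [lintegral_zero] at this
  · simp only
    rw [sub_eq_add_neg]
    refine (enorm_add_rpow_two_le _ _).trans ?_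
    rw [enorm_neg]
    calc _ ≤ 2 * (bd x + bd x) := by gcongr; exacts [hb n x, hbG x]
      _ = _ := by ring
  · rw [lintegral_const_mul' _ _ (by norm_num), lintegral_indicator measurableSet_ball, setLIntegral_const]
    have : volume (ball (0 : E) (1 + δ)) ≠ ⊤ := measure_ball_lt_top.ne
    exact ENNReal.mul_ne_top (by norm_num) (ENNReal.mul_ne_top (ENNReal.mul_ne_top (ENNReal.inv_ne_top.2 hv0) hK) this)
  · have h := ((hAG x).sub_const (G' x)).enorm
    rw [sub_self, enorm_zero] at h
    have h3 := (ENNReal.continuous_rpow_const (y := (2 : ℝ))).tendsto (0 : ℝ≥0∞)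
    rw [ENNReal.zero_rpow_of_pos two_pos] at h3
    exact h3.comp h

theorem exists_subseq_tendsto_setIntegral {φ : ℕ → E → ℝ} {K : ℝ≥0∞} (hK : K ≠ ⊤)
    (hφ : ∀ n, Continuous (φ n)) (h2 : ∀ n, ∫⁻ x, ‖φ n x‖ₑ ^ (2 : ℝ) ≤ K) :
    ∃ k : ℕ → ℕ, StrictMono k ∧ ∃ G : ℝ → E → ℝ, ∀ (δ : ℝ) (x : E),
      Tendsto (fun n => ∫ t in ball x δ, φ (k n) t) atTop (𝓝 (G δ x)) := by
  have hm : ∀ n, MemLp (φ n) 2 volume := fun n => by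
    refine ⟨(hφ n).aestronglyMeasurable, ?_⟩
    rw [eLpNorm_lt_top_iff_lintegral_rpow_enorm_lt_top (by norm_num) (by norm_num)]
    exact (h2 n).trans_lt hK.lt_top
  have : Fact ((2 : ℝ≥0∞) ≠ ⊤) := ⟨by norm_num⟩
  obtain ⟨k, hk, l, hl⟩ := exists_weakly_convergent_subseq (fun n => (hm n).toLp (φ n))
    (K ^ (1 / (2 : ℝ))).toReal (fun n => by
      rw [Lp.norm_toLp]
      refine ENNReal.toReal_mono (by finiteness) ?_
      rw [eLpNorm_eq_lintegral_rpow_enorm_toReal (by norm_num) (by norm_num)]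
      exact ENNReal.rpow_le_rpow (h2 n) (by norm_num))
  refine ⟨k, hk, fun δ x => ⟪l, indicatorConstLp 2 measurableSet_ball
    (measure_ball_lt_top (x := x) (r := δ) (μ := volume)).ne (1 : ℝ)⟫, fun δ x => ?_⟩
  refine (hl (indicatorConstLp 2 measurableSet_ball
    (measure_ball_lt_top (x := x) (r := δ) (μ := volume)).ne (1 : ℝ))).congr fun n => ?_
  rw [real_inner_comm, L2.inner_indicatorConstLp_one]
  exact setIntegral_congr_ae measurableSet_ball ((hm (k n)).coeFn_toLp.mono fun x hx _ => hx)

theorem exists_cauchy_subseq_of_lintegral_fderiv_le {φ : ℕ → E → ℝ} {K : ℝ≥0∞} (hK : K ≠ ⊤)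
    (hφ : ∀ n, ContDiff ℝ 1 (φ n)) (hs : ∀ n x, φ n x ≠ 0 → ‖x‖ < 1)
    (h2 : ∀ n, ∫⁻ x, ‖φ n x‖ₑ ^ (2 : ℝ) ≤ K)
    (hd : ∀ n, ∫⁻ x, ‖fderiv ℝ (φ n) x‖ₑ ^ (2 : ℝ) ≤ K) :
    ∃ k : ℕ → ℕ, StrictMono k ∧ ∀ ε : ℝ≥0∞, ε ≠ 0 → ∃ n0, ∀ m ≥ n0, ∀ n ≥ n0,
      ∫⁻ x, ‖φ (k m) x - φ (k n) x‖ₑ ^ (2 : ℝ) ≤ ε := by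
  obtain ⟨k, hk, G, hG⟩ := exists_subseq_tendsto_setIntegral hK (fun n => (hφ n).continuous) h2
  refine ⟨k, hk, fun ε hε => ?_⟩
  obtain ⟨δ, hδ, hδε⟩ : ∃ δ : ℝ, 0 < δ ∧ ENNReal.ofReal δ ^ (2 : ℝ) * K ≤ ε / 16 := by
    have h1 : Tendsto (fun δ : ℝ => ENNReal.ofReal δ ^ (2 : ℝ) * K) (𝓝[>] 0) (𝓝 0) := by
      have h2 : Tendsto (fun δ : ℝ => ENNReal.ofReal δ ^ (2 : ℝ) * K) (𝓝 0)
          (𝓝 (ENNReal.ofReal 0 ^ (2 : ℝ) * K)) :=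
        ENNReal.Tendsto.mul_const (((ENNReal.continuous_rpow_const (y := 2)).comp
          ENNReal.continuous_ofReal).tendsto 0) (Or.inr hK)
      simp only [ENNReal.ofReal_zero, ENNReal.zero_rpow_of_pos two_pos, zero_mul] at h2
      exact h2.mono_left nhdsWithin_le_nhds
    have hε' : 0 < ε / 16 := ENNReal.div_pos hε (by norm_num)
    obtain ⟨δ, h3, h4⟩ := ((h1.eventually (ge_mem_nhds hε')).and self_mem_nhdsWithin).exists
    exact ⟨δ, h4, h3⟩
  set ν := ProbabilityTheory.cond volume (ball (0 : E) δ) with hνdef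
  have hv0 : volume (ball (0 : E) δ) ≠ 0 := (measure_ball_pos _ _ hδ).ne'
  have hvt : volume (ball (0 : E) δ) ≠ ⊤ := measure_ball_lt_top.ne
  have hν : IsProbabilityMeasure ν := ProbabilityTheory.cond_isProbabilityMeasure_of_finite hv0 hvt
  have hνb : ∀ᵐ t ∂ν, ‖t‖ ≤ δ := by
    filter_upwards [ProbabilityTheory.ae_cond_mem measurableSet_ball] with t ht
    exact (mem_ball_zero_iff.1 ht).le
  have hi : ∀ n x, Integrable (fun t => φ n (x + t)) ν := fun n x => by
    have h1 : IntegrableOn (fun t => φ n (x + t)) (closedBall 0 δ) :=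
      (((hφ n).continuous.comp (by fun_prop : Continuous fun t => x + t)).continuousOn).integrableOn_compact
        (isCompact_closedBall _ _)
    exact (h1.mono_set ball_subset_closedBall).smul_measure (ENNReal.inv_ne_top.2 hv0)
  have hav := tendsto_lintegral_average hK (fun n => (hφ (k n)).continuous) (fun n => hs (k n))
    (fun n => h2 (k n)) hδ (hG δ)
  have hε' : 0 < ε / 16 := ENNReal.div_pos hε (by norm_num)
  obtain ⟨n0, hn0⟩ := eventually_atTop.1 (hav.eventually (ge_mem_nhds hε'))
  set A : ℕ → E → ℝ := fun n x => ∫ t, φ (k n) (x + t) ∂ν with hA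
  set G' : E → ℝ := fun x => (volume (ball (0 : E) δ))⁻¹.toReal * G δ x with hG'
  have hAm : ∀ n, Measurable (A n) := fun n => by
    have : Continuous fun z : E × E => φ (k n) (z.1 + z.2) := (hφ (k n)).continuous.comp (by fun_prop)
    exact (this.stronglyMeasurable.integral_prod_right (ν := ν)).measurable
  have hG'm : Measurable G' := by
    refine measurable_of_tendsto_metrizable hAm (tendsto_pi_nhds.2 fun x => ?_)
    simp only [A, hνdef, integral_cond_ball_translate]
    exact (hG δ x).const_mul _
  have hone : ∀ n ≥ n0, ∫⁻ x, ‖φ (k n) x - G' x‖ₑ ^ (2 : ℝ) ≤ ε / 4 := by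
    intro n hn
    calc ∫⁻ x, ‖φ (k n) x - G' x‖ₑ ^ (2 : ℝ)
        ≤ ∫⁻ x, 2 * (‖φ (k n) x - A n x‖ₑ ^ (2 : ℝ) + ‖A n x - G' x‖ₑ ^ (2 : ℝ)) := by
          refine lintegral_mono fun x => ?_
          rw [← sub_add_sub_cancel (φ (k n) x) (A n x) (G' x)]
          exact enorm_add_rpow_two_le _ _
      _ = 2 * ((∫⁻ x, ‖φ (k n) x - A n x‖ₑ ^ (2 : ℝ)) + ∫⁻ x, ‖A n x - G' x‖ₑ ^ (2 : ℝ)) := by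
          rw [lintegral_const_mul' _ _ (by norm_num), lintegral_add_right]
          exact ((hAm n).sub hG'm).enorm.pow_const _
      _ ≤ 2 * (ε / 16 + ε / 16) := by
          gcongr
          · exact (lintegral_sub_average_le (hφ (k n)) hνb (hi (k n))).trans
              ((mul_le_mul_right (hd _) _).trans hδε)
          · exact hn0 n hn
      _ = ε / 4 := by
          rw [← two_mul, ← mul_assoc, div_eq_mul_inv, div_eq_mul_inv, mul_left_comm]
          congr 1
          rw [← ENNReal.toReal_eq_toReal_iff' (by finiteness) (by finiteness)]
          norm_num
  refine ⟨n0, fun m hm n hn => ?_⟩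
  calc ∫⁻ x, ‖φ (k m) x - φ (k n) x‖ₑ ^ (2 : ℝ)
      ≤ ∫⁻ x, 2 * (‖φ (k m) x - G' x‖ₑ ^ (2 : ℝ) + ‖φ (k n) x - G' x‖ₑ ^ (2 : ℝ)) := by
        refine lintegral_mono fun x => ?_
        simp only
        rw [← sub_add_sub_cancel (φ (k m) x) (G' x) (φ (k n) x), ← enorm_neg (φ (k n) x - G' x), neg_sub]
        exact enorm_add_rpow_two_le _ _
    _ = 2 * ((∫⁻ x, ‖φ (k m) x - G' x‖ₑ ^ (2 : ℝ)) + ∫⁻ x, ‖φ (k n) x - G' x‖ₑ ^ (2 : ℝ)) := by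
        rw [lintegral_const_mul' _ _ (by norm_num), lintegral_add_right]
        exact ((hφ (k n)).continuous.measurable.sub hG'm).enorm.pow_const _
    _ ≤ 2 * (ε / 4 + ε / 4) := by
        gcongr
        exacts [hone m hm, hone n hn]
    _ = ε := by
        rw [← two_mul, ← mul_assoc, div_eq_mul_inv, mul_left_comm]
        conv_rhs => rw [← mul_one ε]
        congr 1
        rw [← ENNReal.toReal_eq_toReal_iff' (by finiteness) (by finiteness)]
        norm_num

end Rellich

section WeightedBounds

variable {N : ℕ} {c s q τ : ℝ} {φ ψ : Euc N → ℝ}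

/-- The power `(1 - |x|²)^r`, extended by zero outside the unit ball. -/
noncomputable def discPower (r : ℝ) : Euc N → ℝ := (ball 0 1).indicator fun x => discWeight x ^ r

theorem measurable_discPower (r : ℝ) : Measurable (discPower r : Euc N → ℝ) :=
  (measurable_discWeight.pow_const _).indicator measurableSet_ball

theorem discPower_of_mem {r : ℝ} {x : Euc N} (hx : x ∈ ball 0 1) :
    discPower r x = discWeight x ^ r := indicator_of_mem hx _

theorem discPower_of_notMem {r : ℝ} {x : Euc N} (hx : x ∉ ball 0 1) :
    discPower r x = 0 := indicator_of_notMem hx _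

theorem enorm_discPower_mul_rpow_le (hs : 0 < s) (hs2 : s < 2) (hτ : 0 < τ) (hq : 0 < q)
    (hqe : q = s + τ * (1 - s / 2)) (f : ℝ) (x : Euc N) :
    ‖discPower (-(s / q)) x * f‖ₑ ^ q ≤
      (‖(discWeight x)⁻¹ * f‖ₑ ^ (2 : ℝ)) ^ (s / 2) * (‖f‖ₑ ^ τ) ^ (1 - s / 2) := by
  by_cases hx : x ∈ ball (0 : Euc N) 1
  · have hρ := discWeight_pos hx
    have h1 : ‖discPower (-(s / q)) x‖ₑ ^ q = ‖(discWeight x)⁻¹‖ₑ ^ s := by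
      rw [discPower_of_mem hx, ← ofReal_norm, ← ofReal_norm, ENNReal.ofReal_rpow_of_nonneg (norm_nonneg _) hq.le,
        ENNReal.ofReal_rpow_of_nonneg (norm_nonneg _) hs.le, Real.norm_of_nonneg (by positivity),
        Real.norm_of_nonneg (by positivity), ← Real.rpow_mul hρ.le, Real.inv_rpow hρ.le, ← Real.rpow_neg hρ.le,
        neg_mul, div_mul_cancel₀ _ hq.ne']
    rw [enorm_mul, ENNReal.mul_rpow_of_nonneg _ _ hq.le, h1, enorm_mul, ← ENNReal.rpow_mul, ← ENNReal.rpow_mul,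
      ENNReal.mul_rpow_of_nonneg _ _ (by linarith), mul_assoc, ← ENNReal.rpow_add_of_nonneg _ _ (by linarith)
        (mul_nonneg hτ.le (by linarith)), hqe]
    ring_nf
    exact le_rfl
  · rw [discPower_of_notMem hx, zero_mul, enorm_zero, ENNReal.zero_rpow_of_pos hq]
    exact zero_le

theorem lintegral_discPower_mul_le (hs : 0 < s) (hs2 : s < 2) (hτ : 0 < τ) (hq : 0 < q)
    (hqe : q = s + τ * (1 - s / 2)) {f : Euc N → ℝ} (hf : Measurable f) (S : Set (Euc N)) :
    ∫⁻ x in S, ‖discPower (-(s / q)) x * f x‖ₑ ^ q ≤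
      (∫⁻ x in S, ‖(discWeight x)⁻¹ * f x‖ₑ ^ (2 : ℝ)) ^ (s / 2) *
        (∫⁻ x in S, ‖f x‖ₑ ^ τ) ^ (1 - s / 2) := by
  refine (lintegral_mono fun x => enorm_discPower_mul_rpow_le hs hs2 hτ hq hqe (f x) x).trans ?_
  exact ENNReal.lintegral_mul_norm_pow_le
    (((measurable_discWeight.inv.mul hf).enorm.pow_const _).aemeasurable)
    ((hf.enorm.pow_const _).aemeasurable) (by linarith) (by linarith) (by ring)

theorem exists_mul_rpow_le {a b ε : ℝ≥0∞} {r : ℝ} (ha : a ≠ ⊤) (hb : b ≠ ⊤) (hr : 0 < r) (hε : ε ≠ 0) :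
    ∃ t : ℝ≥0∞, t ≠ 0 ∧ t ≠ ⊤ ∧ a * (b * t) ^ r ≤ ε := by
  have h1 : Tendsto (fun t : ℝ≥0∞ => a * (b * t) ^ r) (𝓝 0) (𝓝 (a * (b * 0) ^ r)) := by
    refine ENNReal.Tendsto.const_mul (((ENNReal.continuous_rpow_const).tendsto _).comp
      (ENNReal.Tendsto.const_mul tendsto_id (Or.inr hb))) (Or.inr ha)
  rw [mul_zero, ENNReal.zero_rpow_of_pos hr, mul_zero] at h1
  have h2 := h1.eventually (ge_mem_nhds (pos_iff_ne_zero.2 hε))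
  obtain ⟨t, h3, h4⟩ := ((h2.and (Iio_mem_nhds zero_lt_one)).filter_mono nhdsWithin_le_nhds |>.and
    (self_mem_nhdsWithin (s := Ioi (0 : ℝ≥0∞)))).exists
  exact ⟨t, h4.ne', (h3.2.trans ENNReal.one_lt_top).ne, h3.1⟩

theorem lintegral_inv_discWeight_mul_le (hN : 1 ≤ N) (hc : c < 1) (hφ : φ ∈ testSpace N) :
    ∫⁻ x, ‖(discWeight x)⁻¹ * φ x‖ₑ ^ (2 : ℝ) ≤
      ENNReal.ofReal (√(1 - c))⁻¹ ^ (2 : ℝ) * ∫⁻ x, ‖hardyLift c φ x‖ₑ ^ (2 : ℝ) := by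
  rw [← lintegral_const_mul' _ _ (by finiteness)]
  refine lintegral_mono fun x => ?_
  simp only
  rw [← ENNReal.mul_rpow_of_nonneg _ _ (by norm_num)]
  gcongr
  rw [← ofReal_norm, ← ofReal_norm (hardyLift c φ x), ← ENNReal.ofReal_mul (by positivity)]
  exact ENNReal.ofReal_le_ofReal (norm_gradient_le_hardyLift hN hc hφ x).1

theorem lintegral_rpow_two_le_hardyLift (hN : 1 ≤ N) (hc : c < 1) (hφ : φ ∈ testSpace N) :
    ∫⁻ x, ‖φ x‖ₑ ^ (2 : ℝ) ≤
      ENNReal.ofReal (√(1 - c))⁻¹ ^ (2 : ℝ) * ∫⁻ x, ‖hardyLift c φ x‖ₑ ^ (2 : ℝ) := by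
  refine le_trans (lintegral_mono fun x => ENNReal.rpow_le_rpow ?_ (by norm_num))
    (lintegral_inv_discWeight_mul_le hN hc hφ)
  by_cases hx : x ∈ ball (0 : Euc N) 1
  · have hρ := discWeight_pos hx
    rw [← ofReal_norm, ← ofReal_norm, norm_mul, Real.norm_of_nonneg (inv_nonneg.2 hρ.le)]
    exact ENNReal.ofReal_le_ofReal (le_mul_of_one_le_left (norm_nonneg _)
      ((one_le_inv₀ hρ).2 (discWeight_le_one x)))
  · rw [image_eq_zero_of_notMem_tsupport fun h => hx (hφ.2.2 h)]
    simp

theorem lintegral_fderiv_le_hardyLift (hN : 1 ≤ N) (hc : c < 1) (hφ : φ ∈ testSpace N) :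
    ∫⁻ x, ‖fderiv ℝ φ x‖ₑ ^ (2 : ℝ) ≤
      ENNReal.ofReal (1 + (√(1 - c))⁻¹) ^ (2 : ℝ) * ∫⁻ x, ‖hardyLift c φ x‖ₑ ^ (2 : ℝ) := by
  rw [← lintegral_const_mul' _ _ (by finiteness)]
  refine lintegral_mono fun x => ?_
  simp only
  rw [← ENNReal.mul_rpow_of_nonneg _ _ (by norm_num)]
  gcongr
  rw [← ofReal_norm, ← ofReal_norm (hardyLift c φ x), ← ENNReal.ofReal_mul (by positivity),
    norm_fderiv_eq_norm_gradient]
  exact ENNReal.ofReal_le_ofReal (norm_gradient_le_hardyLift hN hc hφ x).2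

end WeightedBounds

section Compactness

variable {N : ℕ} {c s q : ℝ}

theorem enorm_sub_rpow_le {τ : ℝ} (hτ : 1 ≤ τ) {V : Type*} [NormedAddCommGroup V] (a b : V) :
    ‖a - b‖ₑ ^ τ ≤ 2 ^ (τ - 1) * (‖a‖ₑ ^ τ + ‖b‖ₑ ^ τ) :=
  (ENNReal.rpow_le_rpow (enorm_sub_le (a := a) (b := b)) (by linarith)).trans
    (ENNReal.rpow_add_le_mul_rpow_add_rpow _ _ hτ)

theorem lintegral_hardyLift_sub_le {φ ψ : Euc N → ℝ} (hφ : φ ∈ testSpace N) (hψ : ψ ∈ testSpace N)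
    {K : ℝ≥0∞} (h1 : ∫⁻ x, ‖hardyLift c φ x‖ₑ ^ (2 : ℝ) ≤ K)
    (h2 : ∫⁻ x, ‖hardyLift c ψ x‖ₑ ^ (2 : ℝ) ≤ K) :
    ∫⁻ x, ‖hardyLift c (φ - ψ) x‖ₑ ^ (2 : ℝ) ≤ 4 * K := by
  have he : ∀ x, hardyLift c (φ - ψ) x = hardyLift c φ x - hardyLift c ψ x := fun x => by
    have h3 := hardyLift_add (c := c) hφ ((testSpace N).smul_mem (-1) hψ)
    have h4 := hardyLift_smul (c := c) hψ (-1)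
    have : φ - ψ = φ + (-1 : ℝ) • ψ := by simp [sub_eq_add_neg]
    rw [this, h3, h4]
    simp [sub_eq_add_neg]
  calc ∫⁻ x, ‖hardyLift c (φ - ψ) x‖ₑ ^ (2 : ℝ)
      ≤ ∫⁻ x, 2 * (‖hardyLift c φ x‖ₑ ^ (2 : ℝ) + ‖hardyLift c ψ x‖ₑ ^ (2 : ℝ)) := by
        refine lintegral_mono fun x => ?_
        simp only [he]
        have := enorm_sub_rpow_le (τ := 2) (by norm_num) (hardyLift c φ x) (hardyLift c ψ x)
        norm_num at this
        exact_mod_cast this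
    _ = 2 * ((∫⁻ x, ‖hardyLift c φ x‖ₑ ^ (2 : ℝ)) + ∫⁻ x, ‖hardyLift c ψ x‖ₑ ^ (2 : ℝ)) := by
        rw [lintegral_const_mul' _ _ (by norm_num), lintegral_add_right]
        exact (continuous_hardyLift hψ).enorm.measurable.pow_const _
    _ ≤ 2 * (K + K) := by gcongr
    _ = 4 * K := by ring

theorem exists_cauchy_subseq_of_tail (hN : 3 ≤ N) (hc : c < 1) (hs : 0 < s) (hs2 : s < 2)
    (hq : 0 < q) (hqe : q = s + critExp N * (1 - s / 2)) {φ : ℕ → Euc N → ℝ}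
    (hφ : ∀ n, φ n ∈ testSpace N) {K : ℝ≥0∞} (hK : K ≠ ⊤)
    (hE : ∀ n, ∫⁻ x, ‖hardyLift c (φ n) x‖ₑ ^ (2 : ℝ) ≤ K)
    (ht : ∀ ε : ℝ≥0∞, ε ≠ 0 → ∃ δ : ℝ, 0 < δ ∧ δ < 1 ∧ ∃ n0, ∀ n ≥ n0,
      ∫⁻ x in {x | 1 - δ < ‖x‖}, ‖φ n x‖ₑ ^ critExp N ≤ ε) :
    ∃ k : ℕ → ℕ, StrictMono k ∧ ∀ ε : ℝ≥0∞, ε ≠ 0 → ∃ n0, ∀ m ≥ n0, ∀ n ≥ n0,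
      ∫⁻ x, ‖discPower (-(s / q)) x * (φ (k m) x - φ (k n) x)‖ₑ ^ q ≤ ε := by
  have hτ := two_lt_critExp hN
  have hN1 : 1 ≤ N := by omega
  set D1 := ENNReal.ofReal (√(1 - c))⁻¹ ^ (2 : ℝ) with hD1
  set D2 := ENNReal.ofReal (1 + (√(1 - c))⁻¹) ^ (2 : ℝ) with hD2
  have hD1t : D1 ≠ ⊤ := by finiteness
  have hD2t : D2 ≠ ⊤ := by finiteness
  have hφc : ∀ n, Continuous (φ n) := fun n => (hφ n).1.continuous
  obtain ⟨k, hk, hC⟩ := exists_cauchy_subseq_of_lintegral_fderiv_le (φ := φ) (K := (D1 + D2) * K)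
    (by finiteness) (fun n => (hφ n).1.of_le (by norm_cast)) (fun n x hx => by
      have : x ∈ tsupport (φ n) := subset_tsupport _ hx
      simpa using (hφ n).2.2 this)
    (fun n => (lintegral_rpow_two_le_hardyLift hN1 hc (hφ n)).trans
      (mul_le_mul' le_self_add (hE n)))
    (fun n => (lintegral_fderiv_le_hardyLift hN1 hc (hφ n)).trans
      (mul_le_mul' le_add_self (hE n)))
  obtain ⟨C, hCS⟩ := lintegral_enorm_rpow_critExp_le (N := N) hN hc
  refine ⟨k, hk, fun ε hε => ?_⟩
  have hε2 : ε / 2 ≠ 0 := by simp [hε]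
  obtain ⟨t1, ht10, -, ht1⟩ := exists_mul_rpow_le (a := (D1 * (4 * K)) ^ (s / 2))
    (b := 2 ^ (critExp N - 1) * 2) (r := 1 - s / 2) (ENNReal.rpow_ne_top_of_nonneg (by linarith) (by finiteness))
    (ENNReal.mul_ne_top (by finiteness) (by norm_num)) (by linarith) hε2
  obtain ⟨δ, hδ, hδ1, n1, hn1⟩ := ht t1 ht10
  obtain ⟨t2, ht20, -, ht2⟩ := exists_mul_rpow_le
    (a := (C * (4 * K) ^ (critExp N / 2)) ^ (1 - s / 2))
    (b := ENNReal.ofReal δ⁻¹ ^ (2 : ℝ)) (r := s / 2)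
    (ENNReal.rpow_ne_top_of_nonneg (by linarith) (ENNReal.mul_ne_top ENNReal.coe_ne_top
      (ENNReal.rpow_ne_top_of_nonneg (by linarith) (by finiteness))))
    (by finiteness) (by linarith) hε2
  obtain ⟨n2, hn2⟩ := hC t2 ht20
  refine ⟨max n1 n2, fun m hm n hn => ?_⟩
  have hψ : φ (k m) - φ (k n) ∈ testSpace N := (testSpace N).sub_mem (hφ _) (hφ _)
  set ψ := φ (k m) - φ (k n) with hψdef
  have hψm : Measurable ψ := hψ.1.continuous.measurable
  have hEψ := lintegral_hardyLift_sub_le (c := c) (hφ (k m)) (hφ (k n)) (hE _) (hE _)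
  rw [← hψdef] at hEψ
  have hS : MeasurableSet {x : Euc N | 1 - δ < ‖x‖} :=
    (isOpen_lt continuous_const continuous_norm).measurableSet
  have hout : ∫⁻ x in {x | 1 - δ < ‖x‖}, ‖discPower (-(s / q)) x * ψ x‖ₑ ^ q ≤ ε / 2 := by
    refine (lintegral_discPower_mul_le hs hs2 (by linarith) hq hqe hψm _).trans (le_trans ?_ ht1)
    gcongr
    · exact (setLIntegral_le_lintegral _ _).trans ((lintegral_inv_discWeight_mul_le hN1 hc hψ).trans
        (mul_le_mul_right hEψ _))
    · linarith
    · calc ∫⁻ x in {x | 1 - δ < ‖x‖}, ‖ψ x‖ₑ ^ critExp N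
          ≤ ∫⁻ x in {x | 1 - δ < ‖x‖}, 2 ^ (critExp N - 1) *
              (‖φ (k m) x‖ₑ ^ critExp N + ‖φ (k n) x‖ₑ ^ critExp N) :=
            lintegral_mono fun x => enorm_sub_rpow_le (by linarith) _ _
        _ = 2 ^ (critExp N - 1) * ((∫⁻ x in {x | 1 - δ < ‖x‖}, ‖φ (k m) x‖ₑ ^ critExp N) +
              ∫⁻ x in {x | 1 - δ < ‖x‖}, ‖φ (k n) x‖ₑ ^ critExp N) := by
            rw [lintegral_const_mul' _ _ (by finiteness), lintegral_add_right]
            exact (hφc _).enorm.measurable.pow_const _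
        _ ≤ 2 ^ (critExp N - 1) * (t1 + t1) := by
            gcongr
            · exact hn1 _ ((le_max_left n1 n2).trans (hm.trans (hk.id_le m)))
            · exact hn1 _ ((le_max_left n1 n2).trans (hn.trans (hk.id_le n)))
        _ = _ := by ring
  have hin : ∫⁻ x in {x | 1 - δ < ‖x‖}ᶜ, ‖discPower (-(s / q)) x * ψ x‖ₑ ^ q ≤ ε / 2 := by
    refine (lintegral_discPower_mul_le hs hs2 (by linarith) hq hqe hψm _).trans (le_trans ?_ ht2)
    rw [mul_comm]
    gcongr
    · linarith
    · exact (setLIntegral_le_lintegral _ _).trans ((hCS ψ hψ).trans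
        (mul_le_mul_right (ENNReal.rpow_le_rpow hEψ (by linarith)) _))
    · calc ∫⁻ x in {x | 1 - δ < ‖x‖}ᶜ, ‖(discWeight x)⁻¹ * ψ x‖ₑ ^ (2 : ℝ)
          ≤ ∫⁻ x in {x | 1 - δ < ‖x‖}ᶜ, ENNReal.ofReal δ⁻¹ ^ (2 : ℝ) * ‖ψ x‖ₑ ^ (2 : ℝ) := by
            refine lintegral_mono_ae ?_
            filter_upwards [ae_restrict_mem hS.compl] with x hx
            have hx : ‖x‖ ≤ 1 - δ := not_lt.1 hx
            rw [← ENNReal.mul_rpow_of_nonneg _ _ (by norm_num), enorm_mul]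
            gcongr
            rw [← ofReal_norm]
            refine ENNReal.ofReal_le_ofReal ?_
            have : δ ≤ discWeight x := by
              unfold discWeight
              nlinarith [norm_nonneg x]
            rw [norm_inv, Real.norm_of_nonneg (hδ.le.trans this)]
            exact inv_anti₀ hδ this
        _ = ENNReal.ofReal δ⁻¹ ^ (2 : ℝ) * ∫⁻ x in {x | 1 - δ < ‖x‖}ᶜ, ‖ψ x‖ₑ ^ (2 : ℝ) := by
            rw [lintegral_const_mul' _ _ (by finiteness)]
        _ ≤ _ := by
            gcongr
            exact (setLIntegral_le_lintegral _ _).trans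
              (hn2 m ((le_max_right n1 n2).trans hm) n ((le_max_right n1 n2).trans hn))
  change ∫⁻ x, ‖discPower (-(s / q)) x * ψ x‖ₑ ^ q ≤ ε
  rw [← lintegral_add_compl _ hS, ← ENNReal.add_halves ε]
  exact add_le_add hout hin

theorem exists_cauchy_subseq_of_energy_tail (hN : 3 ≤ N) (hc : c < 1) (hs : 0 < s) (hs2 : s < 2)
    (hq : 0 < q) (hqe : q = s + critExp N * (1 - s / 2)) {φ : ℕ → Euc N → ℝ}
    (hφ : ∀ n, φ n ∈ testSpace N) {K : ℝ≥0∞} (hK : K ≠ ⊤)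
    (hE : ∀ n, ∫⁻ x, ‖hardyLift c (φ n) x‖ₑ ^ (2 : ℝ) ≤ K)
    (ht : ∀ ε : ℝ≥0∞, ε ≠ 0 → ∃ δ : ℝ, 0 < δ ∧ δ < 1 ∧ ∃ n0, ∀ n ≥ n0, ∀ y : Euc N,
      1 - 2 * δ ≤ ‖y‖ → ∫⁻ x in ball y (2 * δ), ‖hardyLift c (φ n) x‖ₑ ^ (2 : ℝ) ≤ ε) :
    ∃ k : ℕ → ℕ, StrictMono k ∧ ∀ ε : ℝ≥0∞, ε ≠ 0 → ∃ n0, ∀ m ≥ n0, ∀ n ≥ n0,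
      ∫⁻ x, ‖discPower (-(s / q)) x * (φ (k m) x - φ (k n) x)‖ₑ ^ q ≤ ε := by
  have hτ := two_lt_critExp hN
  refine exists_cauchy_subseq_of_tail hN hc hs hs2 hq hqe hφ hK hE fun ε hε => ?_
  obtain ⟨C, hC⟩ := lintegral_boundary_le (N := N) hN hc
  obtain ⟨t, ht0, -, ht1⟩ := exists_mul_rpow_le (a := C * K) (b := 1) (r := critExp N / 2 - 1)
    (by finiteness) (by finiteness) (by linarith) hε
  obtain ⟨δ, hδ, hδ1, n0, h⟩ := ht t ht0
  refine ⟨δ, hδ, hδ1, n0, fun n hn => (hC (φ n) (hφ n) δ t hδ (h n hn)).trans (le_trans ?_ ht1)⟩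
  rw [one_mul, mul_right_comm]
  gcongr
  exact hE n

end Compactness

section Embedding

variable {N : ℕ} {c s q : ℝ}

theorem enorm_rpow_eq_lintegral {α F : Type*} [MeasurableSpace α] {μ : Measure α} [NormedAddCommGroup F]
    {q : ℝ} (hq : 0 < q) (f : Lp F (ENNReal.ofReal q) μ) : ‖f‖ₑ ^ q = ∫⁻ x, ‖f x‖ₑ ^ q ∂μ := by
  rw [Lp.enorm_def, eLpNorm_eq_lintegral_rpow_enorm_toReal (by simpa using hq) ENNReal.ofReal_ne_top,
    ENNReal.toReal_ofReal hq.le, ← ENNReal.rpow_mul, one_div_mul_cancel hq.ne', ENNReal.rpow_one]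

theorem enorm_rpow_two_eq_lintegral {α F : Type*} [MeasurableSpace α] {μ : Measure α} [NormedAddCommGroup F]
    (f : Lp F 2 μ) : ‖f‖ₑ ^ (2 : ℝ) = ∫⁻ x, ‖f x‖ₑ ^ (2 : ℝ) ∂μ := by
  rw [Lp.enorm_def, eLpNorm_eq_lintegral_rpow_enorm_toReal (by norm_num) (by norm_num), ← ENNReal.rpow_mul]
  norm_num

theorem enorm_hardyMap_rpow_two (φ : testSpace N) :
    ‖hardyMap N c φ‖ₑ ^ (2 : ℝ) = ∫⁻ x, ‖hardyLift c φ.1 x‖ₑ ^ (2 : ℝ) := by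
  rw [enorm_rpow_two_eq_lintegral]
  refine lintegral_congr_ae ?_
  filter_upwards [coeFn_hardyMap φ] with x hx
  rw [hx]

theorem lintegral_mul_fst_le {w : Euc N → ℝ} {r : ℝ} {C : ℝ≥0∞} (hw : Measurable w)
    (hC : C ≠ ⊤)
    (hφ : ∀ φ ∈ testSpace N, ∫⁻ x, ‖w x * (hardyLift c φ x).fst‖ₑ ^ r ≤
      C * (∫⁻ x, ‖hardyLift c φ x‖ₑ ^ (2 : ℝ)) ^ (r / 2))
    {h : Lp (WithLp 2 (ℝ × Euc N)) 2 (volume : Measure (Euc N))} (hh : h ∈ hardySpace N c) :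
    ∫⁻ x, ‖w x * (h x).fst‖ₑ ^ r ≤ C * ‖h‖ₑ ^ r := by
  refine hardySpace_induction (P := fun h => ∫⁻ x, ‖w x * (h x).fst‖ₑ ^ r ≤ C * ‖h‖ₑ ^ r) ?_ ?_ hh
  · refine IsSeqClosed.isClosed fun f g hf hfg => ?_
    obtain ⟨k, hk, hae⟩ := (tendstoInMeasure_of_tendsto_Lp hfg).exists_seq_tendsto_ae
    have hlim : Tendsto (fun n => C * ‖f (k n)‖ₑ ^ r) atTop (𝓝 (C * ‖g‖ₑ ^ r)) :=
      ENNReal.Tendsto.const_mul (((ENNReal.continuous_rpow_const).tendsto _).comp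
        ((hfg.comp hk.tendsto_atTop).enorm)) (Or.inr hC)
    have hfst : Continuous fun z : WithLp 2 (ℝ × Euc N) => z.fst := by fun_prop
    calc ∫⁻ x, ‖w x * (g x).fst‖ₑ ^ r
        = ∫⁻ x, liminf (fun n => ‖w x * (f (k n) x).fst‖ₑ ^ r) atTop := by
          refine lintegral_congr_ae ?_
          filter_upwards [hae] with x hx
          have h1 : Tendsto (fun n => ‖w x * (f (k n) x).fst‖ₑ ^ r) atTop (𝓝 (‖w x * (g x).fst‖ₑ ^ r)) :=
            ((ENNReal.continuous_rpow_const).tendsto _).comp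
              (((hfst.tendsto _).comp hx).const_mul (w x)).enorm
          exact h1.liminf_eq.symm
      _ ≤ liminf (fun n => ∫⁻ x, ‖w x * (f (k n) x).fst‖ₑ ^ r) atTop := by
          refine lintegral_liminf_le' fun n => ?_
          have : AEMeasurable (fun x => (f (k n) x).fst) volume :=
            hfst.measurable.comp_aemeasurable (Lp.aestronglyMeasurable _).aemeasurable
          exact (hw.aemeasurable.mul this).enorm.pow_const _
      _ ≤ liminf (fun n => C * ‖f (k n)‖ₑ ^ r) atTop := liminf_le_liminf (Eventually.of_forall fun n => hf (k n))
      _ = C * ‖g‖ₑ ^ r := hlim.liminf_eq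
  · intro φ
    have h1 : ‖hardyMap N c φ‖ₑ ^ r = (‖hardyMap N c φ‖ₑ ^ (2 : ℝ)) ^ (r / 2) := by
      rw [← ENNReal.rpow_mul, mul_div_cancel₀ _ (by norm_num : (2 : ℝ) ≠ 0)]
    rw [h1, enorm_hardyMap_rpow_two]
    refine le_trans (le_of_eq (lintegral_congr_ae ?_)) (hφ φ.1 φ.2)
    filter_upwards [coeFn_hardyMap φ] with x hx
    rw [hx]

theorem exists_lintegral_critExp_le (hN : 3 ≤ N) (hc : c < 1) : ∃ C : ℝ≥0∞, C ≠ ⊤ ∧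
    ∀ h ∈ hardySpace N c, ∫⁻ x, ‖hardyUnlift c x * (h x).fst‖ₑ ^ critExp N ≤ C * ‖h‖ₑ ^ critExp N := by
  have hτ := two_lt_critExp hN
  obtain ⟨C, hC⟩ := lintegral_enorm_rpow_critExp_le (N := N) hN hc
  refine ⟨C, ENNReal.coe_ne_top, fun h hh =>
    lintegral_mul_fst_le measurable_hardyUnlift ENNReal.coe_ne_top (fun φ hφ => ?_) hh⟩
  simp_rw [hardyUnlift_mul_fst (N := N) (c := c) (by omega) hc hφ]
  exact hC φ hφ

theorem exists_lintegral_discPower_le (hN : 3 ≤ N) (hc : c < 1) (hs : 0 < s) (hs2 : s < 2)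
    (hq : 0 < q) (hqe : q = s + critExp N * (1 - s / 2)) : ∃ C : ℝ≥0∞, C ≠ ⊤ ∧
    ∀ h ∈ hardySpace N c, ∫⁻ x, ‖discPower (-(s / q)) x * (hardyUnlift c x * (h x).fst)‖ₑ ^ q ≤
      C * ‖h‖ₑ ^ q := by
  have hτ := two_lt_critExp hN
  obtain ⟨C, hC⟩ := lintegral_enorm_rpow_critExp_le (N := N) hN hc
  obtain ⟨D, hD⟩ : ∃ D, D = ENNReal.ofReal (√(1 - c))⁻¹ ^ (2 : ℝ) := ⟨_, rfl⟩
  have hDt : D ≠ ⊤ := by rw [hD]; finiteness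
  have hCt : D ^ (s / 2) * (C : ℝ≥0∞) ^ (1 - s / 2) ≠ ⊤ :=
    ENNReal.mul_ne_top (ENNReal.rpow_ne_top_of_nonneg (by linarith) hDt)
      (ENNReal.rpow_ne_top_of_nonneg (by linarith) ENNReal.coe_ne_top)
  refine ⟨D ^ (s / 2) * (C : ℝ≥0∞) ^ (1 - s / 2), hCt, fun h hh => ?_⟩
  simp_rw [← mul_assoc]
  refine lintegral_mul_fst_le ((measurable_discPower _).mul measurable_hardyUnlift) hCt
    (fun φ hφ => ?_) hh
  simp_rw [Pi.mul_apply, mul_assoc, hardyUnlift_mul_fst (N := N) (c := c) (by omega) hc hφ]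
  have h1 := lintegral_discPower_mul_le (N := N) hs hs2 (by linarith) hq hqe hφ.1.continuous.measurable univ
  simp only [Measure.restrict_univ] at h1
  refine h1.trans ((mul_le_mul' (ENNReal.rpow_le_rpow (lintegral_inv_discWeight_mul_le (by omega) hc hφ)
    (by linarith)) (ENNReal.rpow_le_rpow (hC φ hφ) (by linarith))).trans (le_of_eq ?_))
  rw [← hD, ENNReal.mul_rpow_of_nonneg _ _ (by linarith), ENNReal.mul_rpow_of_nonneg _ _ (by linarith),
    mul_mul_mul_comm, ← ENNReal.rpow_mul, ← ENNReal.rpow_add_of_nonneg _ _ (by linarith)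
      (mul_nonneg (by linarith) (by linarith)), hqe]
  ring_nf

/-- The weighted function underlying a lifted field, to be measured in `L^q`. -/
noncomputable def hardyTrace (c s q : ℝ) (h : Euc N → WithLp 2 (ℝ × Euc N)) (x : Euc N) : ℝ :=
  discPower (-(s / q)) x * (hardyUnlift c x * (h x).fst)

theorem aestronglyMeasurable_hardyTrace {h : Euc N → WithLp 2 (ℝ × Euc N)}
    (hh : AEStronglyMeasurable h volume) : AEStronglyMeasurable (hardyTrace c s q h) volume := by
  have hfst : Continuous fun z : WithLp 2 (ℝ × Euc N) => z.fst := by fun_prop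
  exact ((measurable_discPower _).aemeasurable.mul (measurable_hardyUnlift.aemeasurable.mul
    (hfst.measurable.comp_aemeasurable hh.aemeasurable))).aestronglyMeasurable

theorem memLp_hardyTrace (hN : 3 ≤ N) (hc : c < 1) (hs : 0 < s) (hs2 : s < 2)
    (hq : 0 < q) (hqe : q = s + critExp N * (1 - s / 2)) (h : hardySpace N c) :
    MemLp (hardyTrace c s q (h : Lp (WithLp 2 (ℝ × Euc N)) 2 (volume : Measure (Euc N))))
      (ENNReal.ofReal q) volume := by
  obtain ⟨C, hC, hle⟩ := exists_lintegral_discPower_le (N := N) hN hc hs hs2 hq hqe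
  refine ⟨aestronglyMeasurable_hardyTrace (Lp.aestronglyMeasurable _), ?_⟩
  rw [eLpNorm_lt_top_iff_lintegral_rpow_enorm_lt_top (by simpa using hq) ENNReal.ofReal_ne_top,
    ENNReal.toReal_ofReal hq.le]
  exact (hle h h.2).trans_lt (by finiteness)

theorem hardyTrace_coe_add (f g : Lp (WithLp 2 (ℝ × Euc N)) 2 (volume : Measure (Euc N))) :
    hardyTrace c s q ↑(f + g) =ᵐ[volume] hardyTrace c s q f + hardyTrace c s q g := by
  filter_upwards [Lp.coeFn_add f g] with x hx
  simp only [hardyTrace, hx, Pi.add_apply, WithLp.add_fst]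
  ring

theorem hardyTrace_coe_smul (t : ℝ) (f : Lp (WithLp 2 (ℝ × Euc N)) 2 (volume : Measure (Euc N))) :
    hardyTrace c s q ↑(t • f) =ᵐ[volume] t • hardyTrace c s q f := by
  filter_upwards [Lp.coeFn_smul t f] with x hx
  simp only [hardyTrace, hx, Pi.smul_apply, WithLp.smul_fst, smul_eq_mul]
  ring

theorem exists_hardyTrace_embedding (hN : 3 ≤ N) (hc : c < 1) (hs : 0 < s) (hs2 : s < 2)
    (hq : 0 < q) (hqe : q = s + critExp N * (1 - s / 2)) [Fact (1 ≤ ENNReal.ofReal q)] :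
    ∃ ι : hardySpace N c →L[ℝ] Lp ℝ (ENNReal.ofReal q) (volume : Measure (Euc N)),
      ∀ h : hardySpace N c, ι h =ᵐ[volume]
        hardyTrace c s q (h : Lp (WithLp 2 (ℝ × Euc N)) 2 (volume : Measure (Euc N))) := by
  obtain ⟨C, hC, hle⟩ := exists_lintegral_discPower_le (N := N) hN hc hs hs2 hq hqe
  have hm := memLp_hardyTrace (N := N) hN hc hs hs2 hq hqe
  let ι : hardySpace N c →ₗ[ℝ] Lp ℝ (ENNReal.ofReal q) (volume : Measure (Euc N)) :=
    { toFun := fun h => (hm h).toLp _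
      map_add' := fun f g => by
        rw [← MemLp.toLp_add, MemLp.toLp_eq_toLp_iff]
        exact hardyTrace_coe_add _ _
      map_smul' := fun t f => by
        rw [RingHom.id_apply, ← MemLp.toLp_const_smul, MemLp.toLp_eq_toLp_iff]
        exact hardyTrace_coe_smul _ _ }
  have hb : ∀ h, ‖ι h‖ ≤ (C ^ (1 / q)).toReal * ‖h‖ := by
    intro h
    have h1 : ‖ι h‖ₑ ≤ C ^ (1 / q) * ‖(h : Lp (WithLp 2 (ℝ × Euc N)) 2 (volume : Measure (Euc N)))‖ₑ := by
      rw [← ENNReal.rpow_le_rpow_iff hq, enorm_rpow_eq_lintegral hq, ENNReal.mul_rpow_of_nonneg _ _ hq.le,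
        ← ENNReal.rpow_mul, one_div_mul_cancel hq.ne', ENNReal.rpow_one]
      refine le_trans (le_of_eq (lintegral_congr_ae ?_)) (hle h h.2)
      filter_upwards [(hm h).coeFn_toLp] with x hx
      change ‖((hm h).toLp _ : Euc N → ℝ) x‖ₑ ^ q = _
      rw [hx, hardyTrace]
    have h2 := ENNReal.toReal_mono (by finiteness) h1
    simpa using h2
  exact ⟨ι.mkContinuous _ hb, fun h => (hm h).coeFn_toLp⟩

end Embedding

section GroupAction

variable {N : ℕ} {c s q : ℝ}

/-- The isometry of the fibre `ℝ × ℝ^N` acting by `g⁻¹` on vectors. -/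
noncomputable def fiberRotation (g : Euc N ≃ₗᵢ[ℝ] Euc N) :
    WithLp 2 (ℝ × Euc N) ≃ₗᵢ[ℝ] WithLp 2 (ℝ × Euc N) :=
  LinearIsometryEquiv.withLpProdCongr 2 (LinearIsometryEquiv.refl ℝ ℝ) g.symm

theorem fiberRotation_apply (g : Euc N ≃ₗᵢ[ℝ] Euc N) (z : WithLp 2 (ℝ × Euc N)) :
    fiberRotation g z = WithLp.toLp 2 (z.fst, g.symm z.snd) := rfl

theorem fst_fiberRotation (g : Euc N ≃ₗᵢ[ℝ] Euc N) (z : WithLp 2 (ℝ × Euc N)) :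
    (fiberRotation g z).fst = z.fst := rfl

/-- `fiberRotation` as a continuous linear map. -/
noncomputable def fiberRotationCLM (g : Euc N ≃ₗᵢ[ℝ] Euc N) :
    WithLp 2 (ℝ × Euc N) →L[ℝ] WithLp 2 (ℝ × Euc N) :=
  (fiberRotation g).toContinuousLinearEquiv.toContinuousLinearMap

/-- The action of a linear isometry on `L²` fields, matching `φ ↦ φ ∘ g` on test functions. -/
noncomputable def fieldRotation (g : Euc N ≃ₗᵢ[ℝ] Euc N) :
    Lp (WithLp 2 (ℝ × Euc N)) 2 (volume : Measure (Euc N)) →ₗᵢ[ℝ]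
      Lp (WithLp 2 (ℝ × Euc N)) 2 (volume : Measure (Euc N)) where
  toLinearMap := ((fiberRotationCLM g).compLpL 2 volume).toLinearMap ∘ₗ
    (Lp.compMeasurePreservingₗᵢ ℝ g g.measurePreserving).toLinearMap
  norm_map' f := by
    refine Eq.trans ?_ (Lp.norm_compMeasurePreserving f g.measurePreserving)
    rw [Lp.norm_def, Lp.norm_def]
    congr 1
    refine eLpNorm_congr_norm_ae ?_
    filter_upwards [(fiberRotationCLM g).coeFn_compLp (Lp.compMeasurePreserving g g.measurePreserving f)]
      with x hx
    refine (congrArg norm hx).trans ?_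
    exact (fiberRotation g).norm_map _

theorem coeFn_fieldRotation (g : Euc N ≃ₗᵢ[ℝ] Euc N)
    (h : Lp (WithLp 2 (ℝ × Euc N)) 2 (volume : Measure (Euc N))) :
    fieldRotation g h =ᵐ[volume] fun x => fiberRotation g (h (g x)) := by
  filter_upwards [(fiberRotationCLM g).coeFn_compLp (Lp.compMeasurePreserving g g.measurePreserving h),
    Lp.coeFn_compMeasurePreserving h g.measurePreserving] with x hx hx2
  refine hx.trans ?_
  rw [hx2]
  rfl

theorem comp_mem_testSpace (g : Euc N ≃ₗᵢ[ℝ] Euc N) {φ : Euc N → ℝ} (hφ : φ ∈ testSpace N) :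
    φ ∘ g ∈ testSpace N := by
  refine ⟨hφ.1.comp g.contDiff, hφ.2.1.comp_homeomorph g.toHomeomorph, ?_⟩
  have : tsupport (φ ∘ g) = g ⁻¹' tsupport φ := by
    exact tsupport_comp_eq_preimage φ g.toHomeomorph
  rw [this]
  intro x hx
  have := hφ.2.2 hx
  simpa using this

theorem gradient_comp_isometry (g : Euc N ≃ₗᵢ[ℝ] Euc N) {φ : Euc N → ℝ} {x : Euc N}
    (hφ : DifferentiableAt ℝ φ (g x)) : gradient (φ ∘ g) x = g.symm (gradient φ (g x)) := by
  refine ext_inner_right ℝ fun v => ?_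
  rw [inner_gradient_eq_fderiv, fderiv_comp x hφ g.differentiableAt, LinearIsometryEquiv.inner_map_eq_flip,
    LinearIsometryEquiv.symm_symm, inner_gradient_eq_fderiv, ContinuousLinearMap.comp_apply,
    show fderiv ℝ g x = g.toContinuousLinearEquiv.toContinuousLinearMap from
      g.toContinuousLinearEquiv.hasFDerivAt.fderiv]
  rfl

theorem discWeight_isometry (g : Euc N ≃ₗᵢ[ℝ] Euc N) (x : Euc N) : discWeight (g x) = discWeight x := by
  rw [discWeight, discWeight, g.norm_map]

theorem hardyMass_isometry (g : Euc N ≃ₗᵢ[ℝ] Euc N) (x : Euc N) : hardyMass c (g x) = hardyMass c x := by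
  rw [hardyMass, hardyMass, discWeight_isometry]

theorem mem_ball_isometry (g : Euc N ≃ₗᵢ[ℝ] Euc N) (x : Euc N) (r : ℝ) : g x ∈ ball (0 : Euc N) r ↔ x ∈ ball (0 : Euc N) r := by
  simp

theorem hardyUnlift_isometry (g : Euc N ≃ₗᵢ[ℝ] Euc N) (x : Euc N) : hardyUnlift c (g x) = hardyUnlift c x := by
  by_cases hx : x ∈ ball (0 : Euc N) 1
  · rw [hardyUnlift_of_mem hx, hardyUnlift_of_mem ((mem_ball_isometry g x 1).2 hx), hardyMass_isometry]
  · rw [hardyUnlift_of_notMem hx, hardyUnlift_of_notMem (mt (mem_ball_isometry g x 1).1 hx)]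

theorem discPower_isometry (g : Euc N ≃ₗᵢ[ℝ] Euc N) (r : ℝ) (x : Euc N) : discPower r (g x) = discPower r x := by
  by_cases hx : x ∈ ball (0 : Euc N) 1
  · rw [discPower_of_mem hx, discPower_of_mem ((mem_ball_isometry g x 1).2 hx), discWeight_isometry]
  · rw [discPower_of_notMem hx, discPower_of_notMem (mt (mem_ball_isometry g x 1).1 hx)]

theorem hardyLift_comp_isometry (g : Euc N ≃ₗᵢ[ℝ] Euc N) {φ : Euc N → ℝ} (hφ : φ ∈ testSpace N)
    (x : Euc N) : hardyLift c (φ ∘ g) x = fiberRotation g (hardyLift c φ (g x)) := by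
  rw [fiberRotation_apply, hardyLift, hardyLift, gradient_comp_isometry g (hφ.1.differentiable (by simp) _),
    hardyMass_isometry, discWeight_isometry]
  simp

theorem fieldRotation_hardyMap (g : Euc N ≃ₗᵢ[ℝ] Euc N) (φ : testSpace N) :
    fieldRotation g (hardyMap N c φ) = hardyMap N c ⟨φ.1 ∘ g, comp_mem_testSpace g φ.2⟩ := by
  refine Lp.ext ?_
  filter_upwards [coeFn_fieldRotation g (hardyMap N c φ), g.measurePreserving.quasiMeasurePreserving.ae
    (coeFn_hardyMap (c := c) φ), coeFn_hardyMap (c := c) ⟨φ.1 ∘ g, comp_mem_testSpace g φ.2⟩] with x h1 h2 h3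
  rw [h1, h2, h3, hardyLift_comp_isometry g φ.2]

theorem fieldRotation_mem (g : Euc N ≃ₗᵢ[ℝ] Euc N)
    {h : Lp (WithLp 2 (ℝ × Euc N)) 2 (volume : Measure (Euc N))} (hh : h ∈ hardySpace N c) :
    fieldRotation g h ∈ hardySpace N c := by
  refine hardySpace_induction (P := fun h => fieldRotation g h ∈ hardySpace N c) ?_ ?_ hh
  · exact IsClosed.preimage (fieldRotation g).continuous (Submodule.isClosed_topologicalClosure _)
  · intro φ
    rw [fieldRotation_hardyMap]
    exact hardyMap_mem _

theorem exists_hardyMap_eq_fieldRotation (g : Euc N ≃ₗᵢ[ℝ] Euc N) (φ : testSpace N) :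
    ∃ ψ, hardyMap N c φ = fieldRotation g (hardyMap N c ψ) := by
  refine ⟨⟨φ.1 ∘ g.symm, comp_mem_testSpace g.symm φ.2⟩, ?_⟩
  rw [fieldRotation_hardyMap]
  congr 1
  ext x
  simp

theorem hardyTrace_fieldRotation (g : Euc N ≃ₗᵢ[ℝ] Euc N)
    (h : Lp (WithLp 2 (ℝ × Euc N)) 2 (volume : Measure (Euc N))) :
    hardyTrace c s q (fieldRotation g h) =ᵐ[volume] hardyTrace c s q h ∘ g := by
  filter_upwards [coeFn_fieldRotation g h] with x hx
  rw [Function.comp_apply, hardyTrace, hardyTrace, hx, fst_fiberRotation, discPower_isometry,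
    hardyUnlift_isometry]

theorem setLIntegral_ball_fieldRotation (g : Euc N ≃ₗᵢ[ℝ] Euc N)
    (h : Lp (WithLp 2 (ℝ × Euc N)) 2 (volume : Measure (Euc N))) (y : Euc N) (r : ℝ) :
    ∫⁻ x in ball y r, ‖fieldRotation g h x‖ₑ ^ (2 : ℝ) = ∫⁻ x in ball (g y) r, ‖h x‖ₑ ^ (2 : ℝ) := by
  rw [← g.measurePreserving.setLIntegral_comp_preimage_emb g.toHomeomorph.measurableEmbedding
    (fun x => ‖h x‖ₑ ^ (2 : ℝ)) (ball (g y) r)]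
  have : g ⁻¹' ball (g y) r = ball y r := by
    ext x
    simp
  rw [this]
  refine setLIntegral_congr_fun_ae measurableSet_ball ?_
  filter_upwards [coeFn_fieldRotation g h] with x hx _
  rw [hx, ← ofReal_norm, LinearIsometryEquiv.norm_map, ofReal_norm]

end GroupAction

section SymmetricCompactness

variable {N : ℕ} {c s q : ℝ}

theorem natCast_mul_setLIntegral_ball_le {M : ℕ} {g : Fin M → Euc N ≃ₗᵢ[ℝ] Euc N}
    {h : Lp (WithLp 2 (ℝ × Euc N)) 2 (volume : Measure (Euc N))} (hg : ∀ i, fieldRotation (g i) h = h)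
    {y : Euc N} {r : ℝ} (hr : ∀ i j, i ≠ j → 2 * r ≤ ‖g i y - g j y‖) :
    (M : ℝ≥0∞) * ∫⁻ x in ball y r, ‖h x‖ₑ ^ (2 : ℝ) ≤ ‖h‖ₑ ^ (2 : ℝ) := by
  have h1 : ∀ i, ∫⁻ x in ball (g i y) r, ‖h x‖ₑ ^ (2 : ℝ) = ∫⁻ x in ball y r, ‖h x‖ₑ ^ (2 : ℝ) := by
    intro i
    rw [← setLIntegral_ball_fieldRotation, hg i]
  have hd : Pairwise (Function.onFun Disjoint fun i => ball (g i y) r) := by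
    intro i j hij
    refine ball_disjoint_ball ?_
    rw [dist_eq_norm]
    linarith [hr i j hij]
  calc (M : ℝ≥0∞) * ∫⁻ x in ball y r, ‖h x‖ₑ ^ (2 : ℝ)
      = ∑ i : Fin M, ∫⁻ x in ball (g i y) r, ‖h x‖ₑ ^ (2 : ℝ) := by
        rw [Finset.sum_congr rfl fun i _ => h1 i]
        simp
    _ = ∫⁻ x in ⋃ i, ball (g i y) r, ‖h x‖ₑ ^ (2 : ℝ) := by
        rw [lintegral_iUnion (fun i => measurableSet_ball) hd, tsum_fintype]
    _ ≤ ∫⁻ x, ‖h x‖ₑ ^ (2 : ℝ) := setLIntegral_le_lintegral _ _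
    _ = _ := (enorm_rpow_two_eq_lintegral h).symm

theorem exists_hardyMap_near {h : Lp (WithLp 2 (ℝ × Euc N)) 2 (volume : Measure (Euc N))}
    (hh : h ∈ hardySpace N c) {ε : ℝ} (hε : 0 < ε) : ∃ φ, ‖h - hardyMap N c φ‖ < ε := by
  have h1 : h ∈ closure ((hardyMap N c).range : Set (Lp (WithLp 2 (ℝ × Euc N)) 2 (volume : Measure (Euc N)))) := hh
  obtain ⟨z, ⟨φ, rfl⟩, hz⟩ := Metric.mem_closure_iff.1 h1 ε hε
  exact ⟨φ, by rwa [dist_eq_norm] at hz⟩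

theorem setLIntegral_hardyLift_le (h : Lp (WithLp 2 (ℝ × Euc N)) 2 (volume : Measure (Euc N)))
    (φ : testSpace N) (A : Set (Euc N)) :
    ∫⁻ x in A, ‖hardyLift c (φ : Euc N → ℝ) x‖ₑ ^ (2 : ℝ)
      ≤ 2 * (∫⁻ x in A, ‖h x‖ₑ ^ (2 : ℝ)) + 2 * ‖h - hardyMap N c φ‖ₑ ^ (2 : ℝ) := by
  have hm : AEMeasurable (fun x => ‖h x‖ₑ ^ (2 : ℝ)) (volume.restrict A) :=
    ((Lp.aestronglyMeasurable h).enorm.pow_const _).restrict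
  calc ∫⁻ x in A, ‖hardyLift c (φ : Euc N → ℝ) x‖ₑ ^ (2 : ℝ)
      ≤ ∫⁻ x in A, (2 * ‖h x‖ₑ ^ (2 : ℝ) + 2 * ‖(h - hardyMap N c φ) x‖ₑ ^ (2 : ℝ)) := by
        refine lintegral_mono_ae (ae_restrict_of_ae ?_)
        filter_upwards [coeFn_hardyMap (c := c) φ, Lp.coeFn_sub h (hardyMap N c φ)] with x hx hx2
        rw [hx2, Pi.sub_apply, hx]
        have : hardyLift c (φ : Euc N → ℝ) x = h x + -(h x - hardyLift c (φ : Euc N → ℝ) x) := by abel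
        rw [this]
        refine (ENNReal.rpow_le_rpow (enorm_add_le _ _) (by norm_num)).trans ?_
        rw [enorm_neg, neg_sub, add_sub_cancel]
        refine (ENNReal.rpow_add_le_mul_rpow_add_rpow _ _ (by norm_num)).trans ?_
        norm_num [mul_add]
    _ = 2 * (∫⁻ x in A, ‖h x‖ₑ ^ (2 : ℝ)) + 2 * ∫⁻ x in A, ‖(h - hardyMap N c φ) x‖ₑ ^ (2 : ℝ) := by
        rw [lintegral_add_left' (hm.const_mul _), lintegral_const_mul' _ _ (by simp), lintegral_const_mul' _ _ (by simp)]
    _ ≤ _ := by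
        rw [enorm_rpow_two_eq_lintegral (h - hardyMap N c φ)]
        gcongr
        exact Measure.restrict_le_self

theorem exists_energy_tail {S : Type*} {g : S → Euc N ≃ₗᵢ[ℝ] Euc N} {sgn : S → ℝ}
    (horb : ∀ M : ℕ, ∃ δ > (0 : ℝ), ∀ y : Euc N, 1 / 2 ≤ ‖y‖ → ∃ i : Fin M → S, (∀ j, sgn (i j) = 1) ∧
      ∀ j k, j ≠ k → δ ≤ ‖g (i j) y - g (i k) y‖)
    {x : ℕ → hardySpace N c} {φ : ℕ → testSpace N} {C : ℝ≥0∞} (hC : C ≠ ⊤)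
    (hsym : ∀ n t, fieldRotation (g t) (x n : Lp (WithLp 2 (ℝ × Euc N)) 2 (volume : Measure (Euc N)))
      = sgn t • (x n : Lp (WithLp 2 (ℝ × Euc N)) 2 (volume : Measure (Euc N))))
    (hxC : ∀ n, ‖(x n : Lp (WithLp 2 (ℝ × Euc N)) 2 (volume : Measure (Euc N)))‖ₑ ^ (2 : ℝ) ≤ C)
    (hφ : Tendsto (fun n => ‖(x n : Lp (WithLp 2 (ℝ × Euc N)) 2 (volume : Measure (Euc N)))
      - hardyMap N c (φ n)‖ₑ) atTop (𝓝 0)) {ε : ℝ≥0∞} (hε : ε ≠ 0) :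
    ∃ δ : ℝ, 0 < δ ∧ δ < 1 ∧ ∃ n0, ∀ n ≥ n0, ∀ y : Euc N,
      1 - 2 * δ ≤ ‖y‖ → ∫⁻ z in ball y (2 * δ), ‖hardyLift c (φ n : Euc N → ℝ) z‖ₑ ^ (2 : ℝ) ≤ ε := by
  have hε4 : ε / 4 ≠ 0 := by simp [hε]
  obtain ⟨M, hM⟩ := ENNReal.exists_nat_mul_gt hε4 hC
  obtain ⟨δ, hδ, hsep⟩ := horb M
  have hsq : ∀ᶠ n in atTop, ‖(x n : Lp (WithLp 2 (ℝ × Euc N)) 2 (volume : Measure (Euc N)))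
      - hardyMap N c (φ n)‖ₑ ^ (2 : ℝ) < ε / 4 := by
    have h1 := (ENNReal.continuous_rpow_const (y := 2)).tendsto 0 |>.comp hφ
    rw [ENNReal.zero_rpow_of_pos (by norm_num)] at h1
    exact h1.eventually (gt_mem_nhds (pos_iff_ne_zero.2 hε4))
  obtain ⟨n0, hn0⟩ := eventually_atTop.1 hsq
  refine ⟨min (δ / 4) (1 / 4), by positivity, (min_le_right _ _).trans_lt (by norm_num), n0,
    fun n hn y hy => ?_⟩
  set r := min (δ / 4) (1 / 4) with hr
  have hr1 : r ≤ δ / 4 := min_le_left _ _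
  have hr2 : r ≤ 1 / 4 := min_le_right _ _
  obtain ⟨i, hi, hij⟩ := hsep y (by linarith)
  have hball := natCast_mul_setLIntegral_ball_le (M := M) (g := fun j => g (i j)) (h := (x n)) (y := y) (r := 2 * r)
    (fun j => by rw [hsym, hi, one_smul]) (fun j k hjk => by linarith [hij j k hjk])
  have hM0 : (M : ℝ≥0∞) ≠ 0 := by
    rintro h0
    simp [h0] at hM
  have h2 : ∫⁻ z in ball y (2 * r), ‖(x n : Lp (WithLp 2 (ℝ × Euc N)) 2 (volume : Measure (Euc N))) z‖ₑ ^ (2 : ℝ)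
      ≤ ε / 4 := by
    have h3 := (hball.trans (hxC n)).trans hM.le
    rwa [ENNReal.mul_le_mul_iff_right hM0 (ENNReal.natCast_ne_top M)] at h3
  refine (setLIntegral_hardyLift_le (x n : Lp (WithLp 2 (ℝ × Euc N)) 2 (volume : Measure (Euc N))) (φ n) _).trans ?_
  calc _ ≤ 2 * (ε / 4) + 2 * (ε / 4) := by
        gcongr
        exact (hn0 n hn).le
    _ = ε := by
        rw [← mul_add, ← two_mul, ← mul_assoc]
        norm_num
        exact ENNReal.mul_div_cancel (by norm_num) (by norm_num)

theorem cauchySeq_of_tendsto_sub {Y : Type*} [NormedAddCommGroup Y] {a b : ℕ → Y} (ha : CauchySeq a)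
    (hab : Tendsto (fun n => b n - a n) atTop (𝓝 0)) : CauchySeq b := by
  have := ha.add hab.cauchySeq
  convert this using 1
  ext n
  simp

theorem embedding_hardyMap (hN : 1 ≤ N) (hc : c < 1) [Fact (1 ≤ ENNReal.ofReal q)]
    {ι : hardySpace N c →L[ℝ] Lp ℝ (ENNReal.ofReal q) (volume : Measure (Euc N))}
    (hι : ∀ h : hardySpace N c, ι h =ᵐ[volume]
      hardyTrace c s q (h : Lp (WithLp 2 (ℝ × Euc N)) 2 (volume : Measure (Euc N)))) (φ : testSpace N) :
    ι ⟨hardyMap N c φ, hardyMap_mem φ⟩ =ᵐ[volume] fun x => discPower (-(s / q)) x * φ.1 x := by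
  refine (hι _).trans ?_
  filter_upwards [coeFn_hardyMap (c := c) φ] with x hx
  rw [hardyTrace, hx, hardyUnlift_mul_fst hN hc φ.2]

theorem tendsto_comp_sub {V Y : Type*} [NormedAddCommGroup V] [NormedSpace ℝ V] [NormedAddCommGroup Y]
    [NormedSpace ℝ Y] (ι : V →L[ℝ] Y) {a b : ℕ → V} (h : Tendsto (fun n => a n - b n) atTop (𝓝 0)) {k : ℕ → ℕ}
    (hk : StrictMono k) : Tendsto (fun n => ι (a (k n)) - ι (b (k n))) atTop (𝓝 0) := by
  have := (ι.continuous.tendsto 0).comp (h.comp hk.tendsto_atTop)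
  simpa [Function.comp_def] using this

theorem cauchySeq_embedding_hardyMap (hN : 1 ≤ N) (hc : c < 1) (hq : 0 < q) [Fact (1 ≤ ENNReal.ofReal q)]
    {ι : hardySpace N c →L[ℝ] Lp ℝ (ENNReal.ofReal q) (volume : Measure (Euc N))}
    (hι : ∀ h : hardySpace N c, ι h =ᵐ[volume]
      hardyTrace c s q (h : Lp (WithLp 2 (ℝ × Euc N)) 2 (volume : Measure (Euc N)))) {φ : ℕ → testSpace N}
    (h : ∀ ε : ℝ≥0∞, ε ≠ 0 → ∃ n0, ∀ m ≥ n0, ∀ n ≥ n0,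
      ∫⁻ x, ‖discPower (-(s / q)) x * ((φ m).1 x - (φ n).1 x)‖ₑ ^ q ≤ ε) :
    CauchySeq fun n => ι ⟨hardyMap N c (φ n), hardyMap_mem (φ n)⟩ := by
  rw [Metric.cauchySeq_iff]
  intro ε hε
  obtain ⟨n0, hn⟩ := h (ENNReal.ofReal (ε / 2) ^ q)
    (by simp [ENNReal.rpow_eq_zero_iff, hε])
  refine ⟨n0, fun m hm n hn' => ?_⟩
  have h1 := hn m hm n hn'
  have h2 : ‖ι ⟨hardyMap N c (φ m), hardyMap_mem (φ m)⟩ - ι ⟨hardyMap N c (φ n), hardyMap_mem (φ n)⟩‖ₑ ^ q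
      ≤ ENNReal.ofReal (ε / 2) ^ q := by
    rw [enorm_rpow_eq_lintegral hq]
    refine le_trans (le_of_eq (lintegral_congr_ae ?_)) h1
    filter_upwards [embedding_hardyMap hN hc hι (φ m), embedding_hardyMap hN hc hι (φ n),
      Lp.coeFn_sub (ι ⟨hardyMap N c (φ m), hardyMap_mem (φ m)⟩) (ι ⟨hardyMap N c (φ n), hardyMap_mem (φ n)⟩)]
      with x h1 h2 h3
    rw [h3, Pi.sub_apply, h1, h2, mul_sub]
  rw [ENNReal.rpow_le_rpow_iff hq, ← ofReal_norm, ENNReal.ofReal_le_ofReal_iff (by positivity)] at h2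
  rw [dist_eq_norm]
  linarith

theorem exists_cauchy_subseq_of_symmetric (hN : 3 ≤ N) (hc : c < 1) (hs : 0 < s) (hs2 : s < 2)
    (hq : 0 < q) (hqe : q = s + critExp N * (1 - s / 2)) [Fact (1 ≤ ENNReal.ofReal q)]
    {ι : hardySpace N c →L[ℝ] Lp ℝ (ENNReal.ofReal q) (volume : Measure (Euc N))}
    (hι : ∀ h : hardySpace N c, ι h =ᵐ[volume]
      hardyTrace c s q (h : Lp (WithLp 2 (ℝ × Euc N)) 2 (volume : Measure (Euc N))))
    {S : Type*} {g : S → Euc N ≃ₗᵢ[ℝ] Euc N} {sgn : S → ℝ}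
    (horb : ∀ M : ℕ, ∃ δ > (0 : ℝ), ∀ y : Euc N, 1 / 2 ≤ ‖y‖ → ∃ i : Fin M → S, (∀ j, sgn (i j) = 1) ∧
      ∀ j k, j ≠ k → δ ≤ ‖g (i j) y - g (i k) y‖)
    (x : ℕ → hardySpace N c) (C : ℝ)
    (hsym : ∀ n t, fieldRotation (g t) (x n : Lp (WithLp 2 (ℝ × Euc N)) 2 (volume : Measure (Euc N)))
      = sgn t • (x n : Lp (WithLp 2 (ℝ × Euc N)) 2 (volume : Measure (Euc N)))) (hxC : ∀ n, ‖x n‖ ≤ C) :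
    ∃ k : ℕ → ℕ, StrictMono k ∧ CauchySeq fun n => ι (x (k n)) := by
  choose φ hφ using fun n : ℕ => exists_hardyMap_near (x n).2 (Nat.one_div_pos_of_nat (α := ℝ) (n := n))
  have hlim : Tendsto (fun n => ‖(x n : Lp (WithLp 2 (ℝ × Euc N)) 2 (volume : Measure (Euc N)))
      - hardyMap N c (φ n)‖) atTop (𝓝 0) :=
    squeeze_zero (fun n => norm_nonneg _) (fun n => (hφ n).le) tendsto_one_div_add_atTop_nhds_zero_nat
  have hlim' : Tendsto (fun n => ‖(x n : Lp (WithLp 2 (ℝ × Euc N)) 2 (volume : Measure (Euc N)))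
      - hardyMap N c (φ n)‖ₑ) atTop (𝓝 0) := by
    have := ENNReal.tendsto_ofReal hlim
    simpa using this
  have hC : ∀ n, ‖(x n : Lp (WithLp 2 (ℝ × Euc N)) 2 (volume : Measure (Euc N)))‖ₑ ^ (2 : ℝ)
      ≤ ENNReal.ofReal C ^ (2 : ℝ) := by
    intro n
    rw [← ofReal_norm]
    exact ENNReal.rpow_le_rpow (ENNReal.ofReal_le_ofReal (hxC n)) (by norm_num)
  have hK : ∀ n, ∫⁻ z, ‖hardyLift c (φ n).1 z‖ₑ ^ (2 : ℝ) ≤ ENNReal.ofReal (C + 1) ^ (2 : ℝ) := by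
    intro n
    rw [← enorm_hardyMap_rpow_two, ← ofReal_norm]
    refine ENNReal.rpow_le_rpow (ENNReal.ofReal_le_ofReal ?_) (by norm_num)
    have h1 : 1 / ((n : ℝ) + 1) ≤ 1 := by
      rw [div_le_one (by positivity)]
      linarith [(Nat.cast_nonneg n : (0 : ℝ) ≤ n)]
    have h2 := norm_sub_norm_le (hardyMap N c (φ n)) (x n : Lp (WithLp 2 (ℝ × Euc N)) 2 (volume : Measure (Euc N)))
    rw [norm_sub_rev] at h2
    have h3 : ‖(x n : Lp (WithLp 2 (ℝ × Euc N)) 2 (volume : Measure (Euc N)))‖ ≤ C := hxC n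
    linarith [hφ n]
  obtain ⟨k, hk, hcau⟩ := exists_cauchy_subseq_of_energy_tail hN hc hs hs2 hq hqe (φ := fun n => (φ n).1)
    (fun n => (φ n).2) (K := ENNReal.ofReal (C + 1) ^ (2 : ℝ)) (by finiteness) hK
    fun ε hε => exists_energy_tail horb (by finiteness) hsym hC hlim' hε
  refine ⟨k, hk, ?_⟩
  refine cauchySeq_of_tendsto_sub (cauchySeq_embedding_hardyMap (by lia) hc hq hι (φ := fun n => φ (k n)) hcau) ?_
  refine tendsto_comp_sub ι (a := x) (b := fun n => ⟨hardyMap N c (φ n), hardyMap_mem (φ n)⟩) ?_ hk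
  rw [tendsto_zero_iff_norm_tendsto_zero]
  exact hlim

end SymmetricCompactness

section DualityMap

variable {α : Type*} [MeasurableSpace α] {μ : Measure α} {q : ℝ}

theorem enorm_duality_integrand (hq : 1 < q) (a b : ℝ) :
    ‖|a| ^ (q - 2) * a * b‖ₑ = ‖a‖ₑ ^ (q - 1) * ‖b‖ₑ := by
  rw [enorm_mul, enorm_mul]
  congr 1
  by_cases ha : a = 0
  · simp [ha, ENNReal.zero_rpow_of_pos (by linarith : 0 < q - 1)]
  · have h0 : ‖a‖ₑ ≠ 0 := by simpa using ha
    have h1 : ‖|a| ^ (q - 2)‖ₑ = ‖a‖ₑ ^ (q - 2) := by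
      rw [Real.enorm_of_nonneg (by positivity), ← ofReal_norm, Real.norm_eq_abs,
        ENNReal.ofReal_rpow_of_pos (by positivity)]
    rw [h1]
    nth_rewrite 2 [← ENNReal.rpow_one ‖a‖ₑ]
    rw [← ENNReal.rpow_add _ _ h0 enorm_ne_top]
    congr 1
    ring

theorem lintegral_duality_integrand_le (hq : 1 < q) (y y' : Lp ℝ (ENNReal.ofReal q) μ) :
    ∫⁻ x, ‖|y x| ^ (q - 2) * y x * y' x‖ₑ ∂μ ≤ ‖y‖ₑ ^ (q - 1) * ‖y'‖ₑ := by
  have hc : (q / (q - 1)).HolderConjugate q := (Real.HolderConjugate.conjExponent hq).symm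
  simp_rw [enorm_duality_integrand hq]
  have hm : AEMeasurable (fun x => ‖y x‖ₑ ^ (q - 1)) μ := (Lp.aestronglyMeasurable y).enorm.pow_const _
  refine (ENNReal.lintegral_mul_le_Lp_mul_Lq μ hc hm (Lp.aestronglyMeasurable y').enorm).trans (le_of_eq ?_)
  have h0 : q - 1 ≠ 0 := by linarith
  simp_rw [← ENNReal.rpow_mul, mul_div_cancel₀ q h0]
  rw [← enorm_rpow_eq_lintegral (by linarith) y, ← enorm_rpow_eq_lintegral (by linarith) y', ← ENNReal.rpow_mul,
    ← ENNReal.rpow_mul, mul_one_div_cancel (by linarith), ENNReal.rpow_one]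
  congr 2
  field_simp

theorem integrable_duality_integrand (hq : 1 < q) (y y' : Lp ℝ (ENNReal.ofReal q) μ) :
    Integrable (fun x => |y x| ^ (q - 2) * y x * y' x) μ := by
  have hy := Lp.aestronglyMeasurable y
  have hy' := Lp.aestronglyMeasurable y'
  refine ⟨?_, (lintegral_duality_integrand_le hq y y').trans_lt ?_⟩
  · exact ((hy.aemeasurable.abs.pow_const _).mul hy.aemeasurable).aestronglyMeasurable.mul hy'
  · have : 0 ≤ q - 1 := by linarith
    finiteness

theorem exists_duality_map (hq : 1 < q) [Fact (1 ≤ ENNReal.ofReal q)] :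
    ∃ F : Lp ℝ (ENNReal.ofReal q) μ → Lp ℝ (ENNReal.ofReal q) μ →L[ℝ] ℝ,
      (∀ y y', F y y' = ∫ x, |y x| ^ (q - 2) * y x * y' x ∂μ) ∧
      (∀ y, ‖y‖ = 1 → ∀ y', |F y y'| ≤ ‖y'‖) ∧ ∀ y, ‖y‖ = 1 → F y y = 1 := by
  let L : ∀ y : Lp ℝ (ENNReal.ofReal q) μ, Lp ℝ (ENNReal.ofReal q) μ →ₗ[ℝ] ℝ := fun y =>
    { toFun := fun y' => ∫ x, |y x| ^ (q - 2) * y x * y' x ∂μ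
      map_add' := fun f g => by
        rw [← integral_add (integrable_duality_integrand hq y f) (integrable_duality_integrand hq y g)]
        refine integral_congr_ae ?_
        filter_upwards [Lp.coeFn_add f g] with x hx
        rw [hx, Pi.add_apply, mul_add]
      map_smul' := fun t f => by
        rw [RingHom.id_apply, smul_eq_mul, ← integral_const_mul]
        refine integral_congr_ae ?_
        filter_upwards [Lp.coeFn_smul t f] with x hx
        rw [hx, Pi.smul_apply, smul_eq_mul]
        ring }
  have hb : ∀ y y', ‖L y y'‖ ≤ ‖y‖ ^ (q - 1) * ‖y'‖ := by
    intro y y'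
    refine (norm_integral_le_lintegral_norm _).trans ?_
    have h1 := lintegral_duality_integrand_le hq y y'
    have h3 : 0 ≤ q - 1 := by linarith
    have h2 := ENNReal.toReal_mono (by finiteness) h1
    rw [ENNReal.toReal_mul, ← ENNReal.toReal_rpow, toReal_enorm, toReal_enorm] at h2
    simpa only [ofReal_norm] using h2
  refine ⟨fun y => (L y).mkContinuous _ (hb y), fun y y' => rfl, fun y hy y' => ?_, fun y hy => ?_⟩
  · have := hb y y'
    rwa [hy, Real.one_rpow, one_mul] at this
  · have h1 : ∫⁻ x, ‖y x‖ₑ ^ q ∂μ = 1 := by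
      rw [← enorm_rpow_eq_lintegral (by linarith) y, ← ofReal_norm, hy]
      simp
    change ∫ x, |y x| ^ (q - 2) * y x * y x ∂μ = 1
    rw [integral_eq_lintegral_of_nonneg_ae (ae_of_all _ fun x => by
      rw [Pi.zero_apply, mul_assoc]; exact mul_nonneg (Real.rpow_nonneg (abs_nonneg _) _) (mul_self_nonneg _)) (integrable_duality_integrand hq y y).1]
    rw [lintegral_congr fun x => ?_, h1, ENNReal.toReal_one]
    rw [← Real.enorm_of_nonneg (by rw [mul_assoc]; exact mul_nonneg (Real.rpow_nonneg (abs_nonneg _) _) (mul_self_nonneg _)), enorm_duality_integrand hq]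
    nth_rewrite 2 [← ENNReal.rpow_one ‖y x‖ₑ]
    rw [← ENNReal.rpow_add_of_nonneg _ _ (by linarith) zero_le_one, sub_add_cancel]

end DualityMap

section SymmetricSolution

variable {N : ℕ} {c s q : ℝ}

theorem duality_sign_mul {e : ℝ} (he : e * e = 1) (a : ℝ) (r : ℝ) :
    |e * a| ^ r * (e * a) = e * (|a| ^ r * a) := by
  have : |e| = 1 := by
    rw [← sq_eq_sq₀ (abs_nonneg e) zero_le_one, sq_abs, sq, he, one_pow]
  rw [abs_mul, this, one_mul]
  ring

theorem duality_embedding_fieldRotation [Fact (1 ≤ ENNReal.ofReal q)]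
    {ι : hardySpace N c →L[ℝ] Lp ℝ (ENNReal.ofReal q) (volume : Measure (Euc N))}
    (hι : ∀ h : hardySpace N c, ι h =ᵐ[volume]
      hardyTrace c s q (h : Lp (WithLp 2 (ℝ × Euc N)) 2 (volume : Measure (Euc N))))
    {F : Lp ℝ (ENNReal.ofReal q) (volume : Measure (Euc N)) →
      Lp ℝ (ENNReal.ofReal q) (volume : Measure (Euc N)) →L[ℝ] ℝ}
    (hF : ∀ y y', F y y' = ∫ x, |y x| ^ (q - 2) * y x * y' x) (g : Euc N ≃ₗᵢ[ℝ] Euc N) {e : ℝ}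
    (he : e * e = 1) (x x' : hardySpace N c)
    (hx : fieldRotation g (x : Lp (WithLp 2 (ℝ × Euc N)) 2 (volume : Measure (Euc N)))
      = e • (x : Lp (WithLp 2 (ℝ × Euc N)) 2 (volume : Measure (Euc N)))) :
    F (ι x) (ι ⟨fieldRotation g x', fieldRotation_mem g x'.2⟩) = e * F (ι x) (ι x') := by
  have hmp : MeasurePreserving g volume volume := g.measurePreserving
  rw [hF, hF, ← integral_const_mul]
  rw [← hmp.integral_comp g.toHomeomorph.measurableEmbedding
    (fun z => e * (|ι x z| ^ (q - 2) * ι x z * ι x' z))]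
  have h1 : hardyTrace c s q (fieldRotation g (x : Lp (WithLp 2 (ℝ × Euc N)) 2 (volume : Measure (Euc N))))
      =ᵐ[volume] e • hardyTrace c s q (x : Lp (WithLp 2 (ℝ × Euc N)) 2 (volume : Measure (Euc N))) := by
    rw [hx]
    exact hardyTrace_coe_smul e _
  refine integral_congr_ae ?_
  filter_upwards [h1, hι x, hι ⟨fieldRotation g x', fieldRotation_mem g x'.2⟩,
    hmp.quasiMeasurePreserving.ae (hι x), hmp.quasiMeasurePreserving.ae (hι x'),
    hardyTrace_fieldRotation (s := s) (q := q) (c := c) g (x : Lp (WithLp 2 (ℝ × Euc N)) 2 (volume : Measure (Euc N))),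
    hardyTrace_fieldRotation (s := s) (q := q) (c := c) g (x' : Lp (WithLp 2 (ℝ × Euc N)) 2 (volume : Measure (Euc N)))]
    with z h1 h2 h3 h4 h5 h6 h7
  simp only [Function.comp_apply, Pi.smul_apply, smul_eq_mul] at h1 h6 h7
  rw [h2, h3, h4, h5, h7, ← h6, h1, duality_sign_mul he, ← mul_assoc, ← mul_assoc, ← mul_assoc, he, one_mul]

theorem discPower_duality (hq : q ≠ 0) (x : Euc N) (v t : ℝ) :
    |discPower (-(s / q)) x * v| ^ (q - 2) * (discPower (-(s / q)) x * v) * (discPower (-(s / q)) x * t)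
      = discPower (-s) x * (|v| ^ (q - 2) * v) * t := by
  by_cases hx : x ∈ ball (0 : Euc N) 1
  · have h0 := discWeight_pos hx
    rw [discPower_of_mem hx, discPower_of_mem hx, abs_mul, Real.mul_rpow (abs_nonneg _) (abs_nonneg _),
      abs_of_pos (Real.rpow_pos_of_pos h0 _), ← Real.rpow_mul h0.le]
    have : discWeight x ^ (-s) = discWeight x ^ (-(s / q) * (q - 2)) * discWeight x ^ (-(s / q))
        * discWeight x ^ (-(s / q)) := by
      rw [← Real.rpow_add h0, ← Real.rpow_add h0]
      congr 1
      field_simp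
      ring
    rw [this]
    ring
  · rw [discPower_of_notMem hx, discPower_of_notMem hx]
    simp

theorem exists_symmetric_embedding_ne_zero (hN : 1 ≤ N) (hc : c < 1) [Fact (1 ≤ ENNReal.ofReal q)]
    {ι : hardySpace N c →L[ℝ] Lp ℝ (ENNReal.ofReal q) (volume : Measure (Euc N))}
    (hι : ∀ h : hardySpace N c, ι h =ᵐ[volume]
      hardyTrace c s q (h : Lp (WithLp 2 (ℝ × Euc N)) 2 (volume : Measure (Euc N))))
    {S : Type*} {g : S → Euc N ≃ₗᵢ[ℝ] Euc N} {sgn : S → ℝ}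
    {φ : Euc N → ℝ} (hφ : φ ∈ testSpace N) (hφ0 : φ ≠ 0) (hφs : ∀ t x, φ (g t x) = sgn t * φ x) :
    ∃ x : hardySpace N c, (∀ t, fieldRotation (g t)
      (x : Lp (WithLp 2 (ℝ × Euc N)) 2 (volume : Measure (Euc N))) = sgn t •
      (x : Lp (WithLp 2 (ℝ × Euc N)) 2 (volume : Measure (Euc N)))) ∧ ι x ≠ 0 := by
  refine ⟨⟨hardyMap N c ⟨φ, hφ⟩, hardyMap_mem _⟩, fun t => ?_, fun h0 => hφ0 ?_⟩
  · change fieldRotation (g t) (hardyMap N c ⟨φ, hφ⟩) = sgn t • hardyMap N c ⟨φ, hφ⟩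
    rw [fieldRotation_hardyMap, ← map_smul]
    congr 1
    ext x
    exact hφs t x
  · have h1 := embedding_hardyMap (by lia) hc hι ⟨φ, hφ⟩
    rw [h0] at h1
    have h2 : φ =ᵐ[volume] 0 := by
      filter_upwards [h1, Lp.coeFn_zero ℝ (ENNReal.ofReal q) (volume : Measure (Euc N))] with x h1 h2
      by_cases hx : x ∈ ball (0 : Euc N) 1
      · rw [h2, discPower_of_mem hx] at h1
        have h3 := (Real.rpow_pos_of_pos (discWeight_pos hx) (-(s / q))).ne'
        simpa [h3, eq_comm] using h1
      · exact image_eq_zero_of_notMem_tsupport fun hx' => hx (hφ.2.2 hx')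
    exact hφ.1.continuous.ae_eq_iff_eq volume continuous_zero |>.1 h2

theorem duality_embedding_hardyMap (hN : 1 ≤ N) (hc : c < 1) (hq : q ≠ 0) [Fact (1 ≤ ENNReal.ofReal q)]
    {ι : hardySpace N c →L[ℝ] Lp ℝ (ENNReal.ofReal q) (volume : Measure (Euc N))}
    (hι : ∀ h : hardySpace N c, ι h =ᵐ[volume]
      hardyTrace c s q (h : Lp (WithLp 2 (ℝ × Euc N)) 2 (volume : Measure (Euc N))))
    {F : Lp ℝ (ENNReal.ofReal q) (volume : Measure (Euc N)) →
      Lp ℝ (ENNReal.ofReal q) (volume : Measure (Euc N)) →L[ℝ] ℝ}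
    (hF : ∀ y y', F y y' = ∫ x, |y x| ^ (q - 2) * y x * y' x) (h : hardySpace N c) (ψ : testSpace N) :
    F (ι h) (ι ⟨hardyMap N c ψ, hardyMap_mem ψ⟩) = ∫ x, discPower (-s) x * (|hardyUnlift c x *
      ((h : Lp (WithLp 2 (ℝ × Euc N)) 2 (volume : Measure (Euc N))) x).fst| ^ (q - 2) *
      (hardyUnlift c x * ((h : Lp (WithLp 2 (ℝ × Euc N)) 2 (volume : Measure (Euc N))) x).fst)) * ψ.1 x := by
  rw [hF]
  refine integral_congr_ae ?_
  filter_upwards [hι h, embedding_hardyMap hN hc hι ψ] with x h1 h2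
  rw [h1, h2, hardyTrace, discPower_duality hq]

theorem integrable_discPower_mul_duality (hN : 1 ≤ N) (hc : c < 1) (hq : 1 < q) [Fact (1 ≤ ENNReal.ofReal q)]
    {ι : hardySpace N c →L[ℝ] Lp ℝ (ENNReal.ofReal q) (volume : Measure (Euc N))}
    (hι : ∀ h : hardySpace N c, ι h =ᵐ[volume]
      hardyTrace c s q (h : Lp (WithLp 2 (ℝ × Euc N)) 2 (volume : Measure (Euc N))))
    (h : hardySpace N c) (ψ : testSpace N) :
    Integrable (fun x => discPower (-s) x * (|hardyUnlift c x *
      ((h : Lp (WithLp 2 (ℝ × Euc N)) 2 (volume : Measure (Euc N))) x).fst| ^ (q - 2) *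
      (hardyUnlift c x * ((h : Lp (WithLp 2 (ℝ × Euc N)) 2 (volume : Measure (Euc N))) x).fst)) * ψ.1 x)
      volume := by
  refine (integrable_duality_integrand hq (ι h) (ι ⟨hardyMap N c ψ, hardyMap_mem ψ⟩)).congr ?_
  filter_upwards [hι h, embedding_hardyMap hN hc hι ψ] with x h1 h2
  rw [h1, h2, hardyTrace, discPower_duality (by linarith)]

set_option maxHeartbeats 1000000 in
theorem exists_symmetric_weak_solution (hN : 3 ≤ N) (hc : c < 1) (hs : 0 < s) (hs2 : s < 2)
    (hq : 1 < q) (hqe : q = s + critExp N * (1 - s / 2))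
    {S : Type*} {g : S → Euc N ≃ₗᵢ[ℝ] Euc N} {sgn : S → ℝ} (hsgn : ∀ t, sgn t * sgn t = 1)
    (horb : ∀ M : ℕ, ∃ δ > (0 : ℝ), ∀ y : Euc N, 1 / 2 ≤ ‖y‖ → ∃ i : Fin M → S, (∀ j, sgn (i j) = 1) ∧
      ∀ j k, j ≠ k → δ ≤ ‖g (i j) y - g (i k) y‖)
    {φ : Euc N → ℝ} (hφ : φ ∈ testSpace N) (hφ0 : φ ≠ 0) (hφs : ∀ t x, φ (g t x) = sgn t * φ x) :
    ∃ h ∈ hardySpace N c, (∀ t, fieldRotation (g t) h = sgn t • h) ∧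
      (¬ (fun x => hardyUnlift c x * (h x).fst) =ᵐ[volume] 0) ∧ ∃ M > 0, ∀ ψ : testSpace N,
        Integrable (fun x => discPower (-s) x * (|hardyUnlift c x * (h x).fst| ^ (q - 2) *
          (hardyUnlift c x * (h x).fst)) * ψ.1 x) volume ∧
        ∫ x, hardyUnlift c x * (h x).fst * hardyOperator c ψ x =
          M * ∫ x, discPower (-s) x * (|hardyUnlift c x * (h x).fst| ^ (q - 2) *
            (hardyUnlift c x * (h x).fst)) * ψ.1 x := by
  have hq0 : 0 < q := by linarith
  have : Fact (1 ≤ ENNReal.ofReal q) := ⟨by simpa using hq.le⟩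
  obtain ⟨ι, hι⟩ := exists_hardyTrace_embedding (N := N) hN hc hs hs2 hq0 hqe
  obtain ⟨F, hF, hF1, hF2⟩ := exists_duality_map (α := Euc N) (μ := volume) hq
  have hne := exists_symmetric_embedding_ne_zero (by lia) hc hι hφ hφ0 hφs
  obtain ⟨h, hsym, hnorm, hcrit⟩ := exists_symmetric_critical (H := hardySpace N c) (J := hardyMap N c)
    (U := fun t => fieldRotation (g t)) (sgn := sgn) (Submodule.isClosed_topologicalClosure _)
    hardyMap_mem (fun a ha h hh => inner_eq_zero_of_mem_hardySpace ha hh)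
    (fun t x hx => fieldRotation_mem (g t) hx) (fun t φ => exists_hardyMap_eq_fieldRotation (g t) φ) hsgn ι
    (fun x C hx hC => exists_cauchy_subseq_of_symmetric hN hc hs hs2 hq0 hqe hι horb x C hx hC) hne F hF1 hF2
    (fun x hx t x' => duality_embedding_fieldRotation hι hF (g t) (hsgn t) x x' (hx t))
  refine ⟨h, h.2, hsym, fun h0 => ?_, ‖h‖ ^ 2, ?_, fun ψ => ?_⟩
  · have : ι h = 0 := by
      refine Lp.ext ?_
      filter_upwards [h0, hι h, Lp.coeFn_zero ℝ (ENNReal.ofReal q) (volume : Measure (Euc N))] with x h1 h2 h3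
      rw [h2, h3, hardyTrace, h1, Pi.zero_apply, mul_zero]
    simp [this] at hnorm
  · have : h ≠ 0 := by
      rintro rfl
      simp at hnorm
    positivity
  · refine ⟨integrable_discPower_mul_duality (by lia) hc hq hι h ψ, ?_⟩
    rw [← inner_hardyMap_eq (by lia) hc h.2 ψ]
    refine (hcrit ⟨hardyMap N c ψ, hardyMap_mem ψ⟩).trans ?_
    rw [duality_embedding_hardyMap (by lia) hc (by linarith) hι hF h ψ]

end SymmetricSolution

section ClassicalSolution

variable {N : ℕ} {c s q : ℝ}

theorem measurable_fst_hardyField (h : Lp (WithLp 2 (ℝ × Euc N)) 2 (volume : Measure (Euc N))) :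
    Measurable fun x => (h x).fst :=
  ((WithLp.continuous_fst (p := 2) (α := ℝ) (β := Euc N)).comp_stronglyMeasurable
    (Lp.stronglyMeasurable h)).measurable

theorem measurable_profile (h : Lp (WithLp 2 (ℝ × Euc N)) 2 (volume : Measure (Euc N))) :
    Measurable fun x => hardyUnlift c x * (h x).fst :=
  measurable_hardyUnlift.mul (measurable_fst_hardyField h)

theorem memLp_fst_hardyField (h : Lp (WithLp 2 (ℝ × Euc N)) 2 (volume : Measure (Euc N))) :
    MemLp (fun x => (h x).fst) 2 volume :=
  (Lp.memLp h).mono (measurable_fst_hardyField h).aestronglyMeasurable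
    (ae_of_all _ fun _ => WithLp.norm_fst_le _ _)

theorem memLp_profile (hN : 1 ≤ N) (hc : c < 1)
    (h : Lp (WithLp 2 (ℝ × Euc N)) 2 (volume : Measure (Euc N))) :
    MemLp (fun x => hardyUnlift c x * (h x).fst) 2 volume :=
  memLp_hardyUnlift_mul hN hc (memLp_fst_hardyField h)

theorem profile_weak_equation (hN : 1 ≤ N) (hc : c < 1)
    {h : Lp (WithLp 2 (ℝ × Euc N)) 2 (volume : Measure (Euc N))} {M : ℝ} {ψ : testSpace N}
    (hi : Integrable (fun x => discPower (-s) x * (|hardyUnlift c x * (h x).fst| ^ (q - 2) *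
          (hardyUnlift c x * (h x).fst)) * ψ.1 x) volume)
    (he : ∫ x, hardyUnlift c x * (h x).fst * hardyOperator c ψ x =
          M * ∫ x, discPower (-s) x * (|hardyUnlift c x * (h x).fst| ^ (q - 2) *
            (hardyUnlift c x * (h x).fst)) * ψ.1 x) :
    ∫ x, hardyUnlift c x * (h x).fst * lap ψ.1 x =
      -∫ x, (c * (discWeight x)⁻¹ ^ 2 * (hardyUnlift c x * (h x).fst) + M * discPower (-s) x *
        (|hardyUnlift c x * (h x).fst| ^ (q - 2) * (hardyUnlift c x * (h x).fst))) * ψ.1 x := by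
  have hv := memLp_profile hN hc h
  have hcont : Continuous fun x : Euc N => c * (discWeight x)⁻¹ ^ 2 * ψ.1 x := by
    refine continuous_mul_of_tsupport_subset (U := ball 0 1) isOpen_ball ?_ ψ.2.1.continuous ψ.2.2.2
    exact continuousOn_const.mul ((contDiffOn_inv_discWeight (n := 0)).continuousOn.pow 2)
  have hsupp : HasCompactSupport fun x : Euc N => c * (discWeight x)⁻¹ ^ 2 * ψ.1 x := ψ.2.2.1.mul_left
  have h1 : Integrable (fun x => hardyUnlift c x * (h x).fst * hardyOperator c ψ x) volume :=
    MemLp.integrable_mul (p := 2) (q := 2) hv ((continuous_hardyOperator ψ.2).memLp_of_hasCompactSupport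
      (hasCompactSupport_hardyOperator ψ.2))
  have h2 : Integrable (fun x => hardyUnlift c x * (h x).fst * (c * (discWeight x)⁻¹ ^ 2 * ψ.1 x)) volume :=
    MemLp.integrable_mul (p := 2) (q := 2) hv (hcont.memLp_of_hasCompactSupport hsupp)
  have e1 : ∀ x, hardyUnlift c x * (h x).fst * lap ψ.1 x =
      -(hardyUnlift c x * (h x).fst * hardyOperator c ψ x +
        hardyUnlift c x * (h x).fst * (c * (discWeight x)⁻¹ ^ 2 * ψ.1 x)) := by
    intro x
    rw [hardyOperator]
    ring
  have e2 : ∀ x, (c * (discWeight x)⁻¹ ^ 2 * (hardyUnlift c x * (h x).fst) + M * discPower (-s) x *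
        (|hardyUnlift c x * (h x).fst| ^ (q - 2) * (hardyUnlift c x * (h x).fst))) * ψ.1 x =
      M * (discPower (-s) x * (|hardyUnlift c x * (h x).fst| ^ (q - 2) *
            (hardyUnlift c x * (h x).fst)) * ψ.1 x) +
        hardyUnlift c x * (h x).fst * (c * (discWeight x)⁻¹ ^ 2 * ψ.1 x) := by
    intro x
    ring
  rw [integral_congr_ae (ae_of_all _ e1), integral_congr_ae (ae_of_all _ e2), integral_neg,
    integral_add h1 h2, integral_add (hi.const_mul M) h2, integral_const_mul, he]

theorem lintegral_profile_critExp_lt_top (hN : 3 ≤ N) (hc : c < 1)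
    {h : Lp (WithLp 2 (ℝ × Euc N)) 2 (volume : Measure (Euc N))} (hh : h ∈ hardySpace N c) :
    ∫⁻ x, ‖hardyUnlift c x * (h x).fst‖ₑ ^ critExp N < ⊤ := by
  obtain ⟨C, hC, hle⟩ := exists_lintegral_critExp_le (N := N) hN hc
  have := two_lt_critExp hN
  refine (hle h hh).trans_lt ?_
  have : 0 ≤ critExp N := by linarith
  finiteness

theorem exists_classical_profile (hN : 3 ≤ N) (hc : c < 1) {p : ℝ} (hp1 : 1 < p)
    (hp2 : p < ((N : ℝ) + 2) / ((N : ℝ) - 2))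
    {h : Lp (WithLp 2 (ℝ × Euc N)) 2 (volume : Measure (Euc N))} (hh : h ∈ hardySpace N c) {M : ℝ}
    (he : ∀ ψ : testSpace N, Integrable (fun x => discPower (-s) x * (|hardyUnlift c x * (h x).fst| ^ (p - 1) *
          (hardyUnlift c x * (h x).fst)) * ψ.1 x) volume ∧
      ∫ x, hardyUnlift c x * (h x).fst * hardyOperator c ψ x =
          M * ∫ x, discPower (-s) x * (|hardyUnlift c x * (h x).fst| ^ (p - 1) *
            (hardyUnlift c x * (h x).fst)) * ψ.1 x) :
    ∃ w : Euc N → ℝ, ContDiffOn ℝ 2 w (ball 0 1) ∧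
      (∀ᵐ x, x ∈ ball (0 : Euc N) 1 → hardyUnlift c x * (h x).fst = w x) ∧
      ∀ x ∈ ball (0 : Euc N) 1, lap w x + (c * (discWeight x)⁻¹ ^ 2 * w x +
        M * discWeight x ^ (-s) * (|w x| ^ (p - 1) * w x)) = 0 := by
  have ha : ContDiffOn ℝ 1 (fun x : Euc N => c * (discWeight x)⁻¹ ^ 2) (ball 0 1) :=
    contDiffOn_const.mul (contDiffOn_inv_discWeight.pow 2)
  have hb : ContDiffOn ℝ 1 (fun x : Euc N => M * discPower (-s) x) (ball 0 1) := by
    refine contDiffOn_const.mul ?_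
    refine ContDiffOn.congr (f := fun x : Euc N => discWeight x ^ (-s)) ?_ fun x hx => discPower_of_mem hx
    exact (contDiff_discWeight.contDiffOn).rpow_const_of_ne fun x hx => (discWeight_pos hx).ne'
  obtain ⟨w, hw, hwe, heq⟩ := weak_solution_regularity hN hp1 hp2 (measurable_profile h)
    (a := fun x : Euc N => c * (discWeight x)⁻¹ ^ 2) (b := fun x : Euc N => M * discPower (-s) x)
    (measurable_const.mul (measurable_discWeight.inv.pow_const 2))
    (measurable_const.mul (measurable_discPower _)) ha hb
    (fun r hr => (setLIntegral_le_lintegral _ _).trans_lt (lintegral_profile_critExp_lt_top hN hc hh))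
    (fun ψ h1 h2 h3 => by
      have h4 := he ⟨ψ, h1, h2, h3⟩
      have e : p - 1 = (p + 1) - 2 := by ring
      rw [e] at h4 ⊢
      exact profile_weak_equation (by lia) hc h4.1 h4.2)
  refine ⟨w, hw, hwe, fun x hx => ?_⟩
  have := heq x hx
  rwa [discPower_of_mem hx] at this

end ClassicalSolution

section ProfileGradient

variable {N : ℕ} {c s q : ℝ}

theorem measurable_snd_hardyField (h : Lp (WithLp 2 (ℝ × Euc N)) 2 (volume : Measure (Euc N))) :
    Measurable fun x => (h x).snd :=
  ((WithLp.continuous_snd (p := 2) (α := ℝ) (β := Euc N)).comp_stronglyMeasurable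
    (Lp.stronglyMeasurable h)).measurable

theorem memLp_snd_hardyField (h : Lp (WithLp 2 (ℝ × Euc N)) 2 (volume : Measure (Euc N))) :
    MemLp (fun x => (h x).snd) 2 volume :=
  (Lp.memLp h).mono (measurable_snd_hardyField h).aestronglyMeasurable
    (ae_of_all _ fun _ => WithLp.norm_snd_le _ _)

theorem memLp_snd_apply_hardyField (h : Lp (WithLp 2 (ℝ × Euc N)) 2 (volume : Measure (Euc N))) (i : Fin N) :
    MemLp (fun x => (h x).snd i) 2 volume :=
  (memLp_snd_hardyField h).mono (by
    have : Measurable fun z : Euc N => z i := (continuous_apply i |>.comp (PiLp.continuous_ofLp 2 _)).measurable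
    exact (this.comp (measurable_snd_hardyField h)).aestronglyMeasurable)
    (ae_of_all _ fun _ => PiLp.norm_apply_le _ _)

theorem continuous_discWeight_inv_mul_apply {ψ : Euc N → ℝ} (hψ : ψ ∈ testSpace N) (i : Fin N) :
    Continuous fun x => (discWeight x)⁻¹ * ψ x * x i :=
  (continuous_mul_of_tsupport_subset isOpen_ball ((contDiffOn_inv_discWeight (n := 0)).continuousOn)
    hψ.1.continuous hψ.2.2).mul (by fun_prop)

theorem fderiv_profile_eq (hN : 1 ≤ N) (hc : c < 1)
    {h : Lp (WithLp 2 (ℝ × Euc N)) 2 (volume : Measure (Euc N))} (hh : h ∈ hardySpace N c)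
    {w : Euc N → ℝ} (hw : ContDiffOn ℝ 2 w (ball 0 1))
    (hwe : ∀ᵐ x, x ∈ ball (0 : Euc N) 1 → hardyUnlift c x * (h x).fst = w x) (i : Fin N) :
    ∀ᵐ x, x ∈ ball (0 : Euc N) 1 →
      (h x).snd i - (discWeight x)⁻¹ * w x * x i - fderiv ℝ w x (EuclideanSpace.single i 1) = 0 := by
  have hw1 : ContDiffOn ℝ 1 w (ball 0 1) := hw.of_le (by norm_cast)
  have hdw : ContinuousOn (fun x => fderiv ℝ w x (EuclideanSpace.single i 1)) (ball 0 1) :=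
    (hw.continuousOn_fderiv_of_isOpen isOpen_ball (by norm_cast)).clm_apply continuousOn_const
  have hxw : ContinuousOn (fun x : Euc N => (discWeight x)⁻¹ * w x * x i) (ball 0 1) :=
    ((contDiffOn_inv_discWeight (n := 0)).continuousOn.mul hw.continuousOn).mul (by fun_prop)
  refine isOpen_ball.ae_eq_zero_of_integral_contDiff_smul_eq_zero ?_ fun ψ h1 h2 h3 => ?_
  · refine LocallyIntegrableOn.sub (LocallyIntegrableOn.sub ?_ ?_) ?_
    · exact ((memLp_snd_apply_hardyField h i).locallyIntegrable (by norm_num)).locallyIntegrableOn _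
    · exact hxw.locallyIntegrableOn measurableSet_ball
    · exact hdw.locallyIntegrableOn measurableSet_ball
  · have hψ : ψ ∈ testSpace N := ⟨h1, h2, h3⟩
    have hψ1 : ContDiff ℝ 1 ψ := h1.of_le (by norm_cast)
    have hcont : Continuous fun x => fderiv ℝ ψ x (EuclideanSpace.single i 1) -
        (discWeight x)⁻¹ * ψ x * x i :=
      ((hψ1.continuous_fderiv one_ne_zero).clm_apply continuous_const).sub
        (continuous_discWeight_inv_mul_apply hψ i)
    have hsupp : HasCompactSupport fun x => fderiv ℝ ψ x (EuclideanSpace.single i 1) -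
        (discWeight x)⁻¹ * ψ x * x i := by
      refine HasCompactSupport.sub (hasCompactSupport_fderiv_apply h2 _) ?_
      exact (h2.mul_left).mul_right
    have i1 : Integrable (fun x => hardyUnlift c x * (h x).fst * (fderiv ℝ ψ x (EuclideanSpace.single i 1) -
        (discWeight x)⁻¹ * ψ x * x i)) volume :=
      MemLp.integrable_mul (p := 2) (q := 2) (memLp_profile hN hc h) (hcont.memLp_of_hasCompactSupport hsupp)
    have i2 : Integrable (fun x => (h x).snd i * ψ x) volume :=
      MemLp.integrable_mul (p := 2) (q := 2) (memLp_snd_apply_hardyField h i)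
        (h1.continuous.memLp_of_hasCompactSupport h2)
    have hψt : tsupport (fun x => fderiv ℝ ψ x (EuclideanSpace.single i 1)) ⊆ ball 0 1 :=
      (tsupport_fderiv_apply_subset ℝ _).trans h3
    have i3 : Integrable (fun x => w x * fderiv ℝ ψ x (EuclideanSpace.single i 1)) volume :=
      integrable_mul_of_tsupport_subset isOpen_ball hw.continuousOn
        ((hψ1.continuous_fderiv one_ne_zero).clm_apply continuous_const) (hasCompactSupport_fderiv_apply h2 _) hψt
    have i4 : Integrable (fun x => fderiv ℝ w x (EuclideanSpace.single i 1) * ψ x) volume :=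
      integrable_mul_of_tsupport_subset isOpen_ball hdw h1.continuous h2 h3
    have e : ∀ᵐ x, ψ x • ((h x).snd i - (discWeight x)⁻¹ * w x * x i - fderiv ℝ w x (EuclideanSpace.single i 1))
        = (hardyUnlift c x * (h x).fst * (fderiv ℝ ψ x (EuclideanSpace.single i 1) -
          (discWeight x)⁻¹ * ψ x * x i) + (h x).snd i * ψ x) -
          w x * fderiv ℝ ψ x (EuclideanSpace.single i 1) -
          fderiv ℝ w x (EuclideanSpace.single i 1) * ψ x := by
      filter_upwards [hwe] with x hx
      by_cases hxb : x ∈ ball (0 : Euc N) 1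
      · rw [hx hxb, smul_eq_mul]
        ring
      · rw [image_eq_zero_of_notMem_tsupport fun hx' => hxb (h3 hx'),
          image_eq_zero_of_notMem_tsupport (f := fun x => fderiv ℝ ψ x (EuclideanSpace.single i 1))
            fun hx' => hxb (hψt hx')]
        simp
    have i12 : Integrable (fun x => hardyUnlift c x * (h x).fst * (fderiv ℝ ψ x (EuclideanSpace.single i 1) -
        (discWeight x)⁻¹ * ψ x * x i) + (h x).snd i * ψ x) volume := i1.add i2
    rw [integral_congr_ae e, integral_sub ?_ i4, integral_sub i12 i3, integral_snd_mul_eq hN hc hh hψ i,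
      integral_mul_fderiv_apply_eq (μ := volume) isOpen_ball hw1 hψ1 h2 h3]
    · ring
    · exact i12.sub i3

theorem gradient_profile_eq (hN : 1 ≤ N) (hc : c < 1)
    {h : Lp (WithLp 2 (ℝ × Euc N)) 2 (volume : Measure (Euc N))} (hh : h ∈ hardySpace N c)
    {w : Euc N → ℝ} (hw : ContDiffOn ℝ 2 w (ball 0 1))
    (hwe : ∀ᵐ x, x ∈ ball (0 : Euc N) 1 → hardyUnlift c x * (h x).fst = w x) :
    ∀ᵐ x, x ∈ ball (0 : Euc N) 1 → gradient w x = (h x).snd - ((discWeight x)⁻¹ * w x) • x := by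
  filter_upwards [ae_all_iff.2 fun i => fderiv_profile_eq hN hc hh hw hwe i] with x hx hxb
  ext i
  rw [gradient_apply]
  have := hx i hxb
  simp only [PiLp.sub_apply, PiLp.smul_apply, smul_eq_mul]
  linarith

theorem integrableOn_profile (hN : 1 ≤ N) (hc : c < 1)
    {h : Lp (WithLp 2 (ℝ × Euc N)) 2 (volume : Measure (Euc N))} (hh : h ∈ hardySpace N c)
    {w : Euc N → ℝ} (hw : ContDiffOn ℝ 2 w (ball 0 1))
    (hwe : ∀ᵐ x, x ∈ ball (0 : Euc N) 1 → hardyUnlift c x * (h x).fst = w x) :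
    IntegrableOn (fun x => ((discWeight x)⁻¹ * w x) ^ 2) (ball (0 : Euc N) 1) ∧
      IntegrableOn (fun x => ‖gradient w x‖ ^ 2) (ball (0 : Euc N) 1) := by
  have hcw : ContinuousOn (fun x : Euc N => (discWeight x)⁻¹ * w x) (ball 0 1) :=
    (contDiffOn_inv_discWeight (n := 0)).continuousOn.mul hw.continuousOn
  have hcg : ContinuousOn (gradient w) (ball 0 1) :=
    (LinearIsometryEquiv.continuous _).comp_continuousOn (hw.continuousOn_fderiv_of_isOpen isOpen_ball (by norm_cast))
  have hi1 : IntegrableOn (fun x => ((discWeight x)⁻¹ * w x) ^ 2) (ball (0 : Euc N) 1) := by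
    refine Integrable.mono' (((memLp_fst_hardyField h).integrable_sq.const_mul ((√(1 - c))⁻¹ ^ 2)).integrableOn
      (s := ball (0 : Euc N) 1)) ((hcw.pow 2).aestronglyMeasurable measurableSet_ball) ?_
    filter_upwards [ae_restrict_of_ae hwe, ae_restrict_mem measurableSet_ball] with x hx hxb
    have h0 := discWeight_pos hxb
    rw [Real.norm_of_nonneg (by positivity), ← hx hxb, ← mul_assoc, mul_pow]
    refine mul_le_mul_of_nonneg_right ?_ (sq_nonneg _)
    refine pow_le_pow_left₀ (mul_nonneg (by positivity) (hardyUnlift_nonneg _)) ?_ 2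
    rw [inv_mul_le_iff₀ h0, mul_comm]
    exact hardyUnlift_le hN hc hxb
  refine ⟨hi1, ?_⟩
  refine Integrable.mono' ((((memLp_snd_hardyField h).integrable_norm_pow (by norm_num)).integrableOn.const_mul 2).add
    (hi1.const_mul 2)) ((hcg.norm.pow 2).aestronglyMeasurable measurableSet_ball) ?_
  filter_upwards [ae_restrict_of_ae (gradient_profile_eq hN hc hh hw hwe), ae_restrict_mem measurableSet_ball]
    with x hx hxb
  rw [Real.norm_of_nonneg (by positivity), hx hxb]
  have h1 := norm_sub_le (h x).snd (((discWeight x)⁻¹ * w x) • x)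
  have h2 : ‖((discWeight x)⁻¹ * w x) • x‖ ≤ |(discWeight x)⁻¹ * w x| := by
    rw [norm_smul, Real.norm_eq_abs]
    exact mul_le_of_le_one_right (abs_nonneg _) (mem_ball_zero_iff.1 hxb).le
  rw [Pi.add_apply, ← sq_abs ((discWeight x)⁻¹ * w x)]
  refine (pow_le_pow_left₀ (norm_nonneg _) (h1.trans (add_le_add_right h2 _)) 2).trans ?_
  refine le_of_le_of_eq (add_sq_le) ?_
  ring

theorem profile_symmetric {h : Lp (WithLp 2 (ℝ × Euc N)) 2 (volume : Measure (Euc N))}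
    {w : Euc N → ℝ} (hw : ContDiffOn ℝ 2 w (ball 0 1))
    (hwe : ∀ᵐ x, x ∈ ball (0 : Euc N) 1 → hardyUnlift c x * (h x).fst = w x)
    {g : Euc N ≃ₗᵢ[ℝ] Euc N} {e : ℝ} (hg : fieldRotation g h = e • h) {x : Euc N}
    (hx : x ∈ ball (0 : Euc N) 1) : w (g x) = e * w x := by
  have h1 := coeFn_fieldRotation g h
  rw [hg] at h1
  have hae : ∀ᵐ x, x ∈ ball (0 : Euc N) 1 → w (g x) = e * w x := by
    filter_upwards [h1, Lp.coeFn_smul e h, hwe, g.measurePreserving.quasiMeasurePreserving.ae hwe]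
      with x h1 h2 h3 h4 hx
    rw [← h3 hx, ← h4 ((mem_ball_isometry g x 1).2 hx), hardyUnlift_isometry, ← fst_fiberRotation g, ← h1, h2,
      Pi.smul_apply, WithLp.smul_fst, smul_eq_mul]
    ring
  have hc1 : ContinuousOn (fun x => w (g x)) (ball 0 1) :=
    hw.continuousOn.comp g.continuous.continuousOn fun x hx => (mem_ball_isometry g x 1).2 hx
  refine Measure.eqOn_of_ae_eq (μ := volume) ((ae_restrict_iff' measurableSet_ball).2 hae) hc1
    (continuousOn_const.mul hw.continuousOn) ?_ hx
  rw [isOpen_ball.interior_eq]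
  exact subset_closure

end ProfileGradient

section SymmetricProfile

variable {N : ℕ} {c s : ℝ}

theorem exists_symmetric_classical_profile (hN : 3 ≤ N) (hc : c < 1) (hs : 0 < s) (hs2 : s < 2) {p : ℝ}
    (hp1 : 1 < p) (hp2 : p < ((N : ℝ) + 2) / ((N : ℝ) - 2)) (hpe : p + 1 = s + critExp N * (1 - s / 2))
    {S : Type*} {g : S → Euc N ≃ₗᵢ[ℝ] Euc N} {sgn : S → ℝ} (hsgn : ∀ t, sgn t * sgn t = 1)
    (horb : ∀ M : ℕ, ∃ δ > (0 : ℝ), ∀ y : Euc N, 1 / 2 ≤ ‖y‖ → ∃ i : Fin M → S, (∀ j, sgn (i j) = 1) ∧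
      ∀ j k, j ≠ k → δ ≤ ‖g (i j) y - g (i k) y‖)
    {φ : Euc N → ℝ} (hφ : φ ∈ testSpace N) (hφ0 : φ ≠ 0) (hφs : ∀ t x, φ (g t x) = sgn t * φ x) :
    ∃ w : Euc N → ℝ, ContDiffOn ℝ 2 w (ball 0 1) ∧
      (∃ M > 0, ∀ x ∈ ball (0 : Euc N) 1, lap w x + (c * (discWeight x)⁻¹ ^ 2 * w x +
        M * discWeight x ^ (-s) * (|w x| ^ (p - 1) * w x)) = 0) ∧
      (∀ t, ∀ x ∈ ball (0 : Euc N) 1, w (g t x) = sgn t * w x) ∧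
      (∃ x ∈ ball (0 : Euc N) 1, w x ≠ 0) ∧
      IntegrableOn (fun x => ((discWeight x)⁻¹ * w x) ^ 2) (ball (0 : Euc N) 1) ∧
      IntegrableOn (fun x => ‖gradient w x‖ ^ 2) (ball (0 : Euc N) 1) := by
  obtain ⟨h, hh, hsym, hne, M, hM, heq⟩ := exists_symmetric_weak_solution hN hc hs hs2 (by linarith : 1 < p + 1)
    hpe hsgn horb hφ hφ0 hφs
  rw [show p + 1 - 2 = p - 1 by ring] at heq
  obtain ⟨w, hw, hwe, hpde⟩ := exists_classical_profile hN hc hp1 hp2 hh heq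
  refine ⟨w, hw, ⟨M, hM, hpde⟩, fun t x hx => profile_symmetric hw hwe (hsym t) hx, ?_,
    integrableOn_profile (by lia) hc hh hw hwe⟩
  by_contra! h0
  refine hne ?_
  filter_upwards [hwe] with x hx
  by_cases hxb : x ∈ ball (0 : Euc N) 1
  · rw [hx hxb, h0 x hxb, Pi.zero_apply]
  · rw [hardyUnlift_of_notMem hxb, zero_mul, Pi.zero_apply]

end SymmetricProfile

section ConformalChange

variable {N : ℕ} {c s r : ℝ} {w : Euc N → ℝ} {x : Euc N}

theorem hasFDerivAt_discWeight_rpow (r : ℝ) (hx : x ∈ ball (0 : Euc N) 1) :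
    HasFDerivAt (fun y : Euc N => discWeight y ^ r)
      ((-2 * r * discWeight x ^ (r - 1)) • innerSL ℝ x) x := by
  have h1 := (hasFDerivAt_discWeight x).rpow_const (p := r) (Or.inl (discWeight_pos hx).ne')
  refine h1.congr_fderiv ?_
  ext v
  simp
  ring

theorem hasFDerivAt_discWeight_rpow_mul (r : ℝ) (hw : ContDiffOn ℝ 2 w (ball 0 1)) (hx : x ∈ ball (0 : Euc N) 1) :
    HasFDerivAt (fun y : Euc N => discWeight y ^ r * w y)
      (discWeight x ^ r • fderiv ℝ w x + w x • ((-2 * r * discWeight x ^ (r - 1)) • innerSL ℝ x)) x :=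
  (hasFDerivAt_discWeight_rpow r hx).mul
    ((hw.contDiffAt (isOpen_ball.mem_nhds hx)).differentiableAt (by norm_num)).hasFDerivAt

theorem fderiv_discWeight_rpow_mul_apply (r : ℝ) (hw : ContDiffOn ℝ 2 w (ball 0 1)) (hx : x ∈ ball (0 : Euc N) 1)
    (v : Euc N) : fderiv ℝ (fun y : Euc N => discWeight y ^ r * w y) x v =
      discWeight x ^ r * fderiv ℝ w x v + w x * ((-2 * r * discWeight x ^ (r - 1)) * ⟪x, v⟫) := by
  rw [(hasFDerivAt_discWeight_rpow_mul r hw hx).fderiv]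
  simp

theorem gradient_discWeight_rpow_mul (r : ℝ) (hw : ContDiffOn ℝ 2 w (ball 0 1)) (hx : x ∈ ball (0 : Euc N) 1) :
    gradient (fun y : Euc N => discWeight y ^ r * w y) x =
      discWeight x ^ r • gradient w x + (w x * (-2 * r * discWeight x ^ (r - 1))) • x := by
  refine ext_inner_right ℝ fun v => ?_
  rw [inner_gradient_eq_fderiv, fderiv_discWeight_rpow_mul_apply r hw hx, inner_add_left, real_inner_smul_left,
    real_inner_smul_left, inner_gradient_eq_fderiv, mul_assoc (w x)]

theorem fderiv_fderiv_discWeight_rpow_mul (r : ℝ) (hw : ContDiffOn ℝ 2 w (ball 0 1))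
    (hx : x ∈ ball (0 : Euc N) 1) (i : Fin N) :
    fderiv ℝ (fun y => fderiv ℝ (fun y : Euc N => discWeight y ^ r * w y) y (EuclideanSpace.single i 1)) x
      (EuclideanSpace.single i 1) =
      discWeight x ^ r * fderiv ℝ (fun y => fderiv ℝ w y (EuclideanSpace.single i 1)) x (EuclideanSpace.single i 1)
      + (-4 * r * discWeight x ^ (r - 1)) * (x i * gradient w x i) + w x * (-2 * r * discWeight x ^ (r - 1))
      + w x * (4 * r * (r - 1) * discWeight x ^ (r - 2)) * (x i * x i) := by
  have hnear : (fun y => fderiv ℝ (fun y : Euc N => discWeight y ^ r * w y) y (EuclideanSpace.single i 1))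
      =ᶠ[𝓝 x] fun y => discWeight y ^ r * fderiv ℝ w y (EuclideanSpace.single i 1) +
        w y * ((-2 * r) * (discWeight y ^ (r - 1) * y i)) := by
    filter_upwards [isOpen_ball.mem_nhds hx] with y hy
    rw [fderiv_discWeight_rpow_mul_apply r hw hy, real_inner_comm, EuclideanSpace.inner_single_left]
    simp only [map_one, one_mul]
    ring
  have hwa := hw.contDiffAt (isOpen_ball.mem_nhds hx)
  have hd1 : HasFDerivAt w (fderiv ℝ w x) x := (hwa.differentiableAt (by norm_num)).hasFDerivAt
  have hd2 : HasFDerivAt (fun y => fderiv ℝ w y (EuclideanSpace.single i 1))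
      (fderiv ℝ (fun y => fderiv ℝ w y (EuclideanSpace.single i 1)) x) x := by
    refine DifferentiableAt.hasFDerivAt ?_
    exact ((hwa.fderiv_right (m := 1) (by norm_num)).differentiableAt one_ne_zero).clm_apply
      (differentiableAt_const _)
  have hp : HasFDerivAt (fun y : Euc N => y i) (EuclideanSpace.proj i : Euc N →L[ℝ] ℝ) x :=
    (EuclideanSpace.proj i : Euc N →L[ℝ] ℝ).hasFDerivAt
  have h1 := ((hasFDerivAt_discWeight_rpow r hx).mul hd2).add
    (hd1.mul (((hasFDerivAt_discWeight_rpow (r - 1) hx).mul hp).const_mul (-2 * r)))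
  have hxi : ⟪x, EuclideanSpace.single i (1 : ℝ)⟫ = x i := by
    rw [real_inner_comm, EuclideanSpace.inner_single_left]
    simp
  rw [hnear.fderiv_eq]
  refine (congrArg (fun L : Euc N →L[ℝ] ℝ => L (EuclideanSpace.single i 1)) h1.fderiv).trans ?_
  simp [hxi, ← gradient_apply]
  ring_nf

theorem lap_discWeight_rpow_mul (r : ℝ) (hw : ContDiffOn ℝ 2 w (ball 0 1))
    (hx : x ∈ ball (0 : Euc N) 1) :
    lap (fun y : Euc N => discWeight y ^ r * w y) x =
      discWeight x ^ r * lap w x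
      + (-4 * r * discWeight x ^ (r - 1)) * ⟪x, gradient w x⟫ + N * (w x * (-2 * r * discWeight x ^ (r - 1)))
      + w x * (4 * r * (r - 1) * discWeight x ^ (r - 2)) * ‖x‖ ^ 2 := by
  rw [lap, Finset.sum_congr rfl fun i _ => fderiv_fderiv_discWeight_rpow_mul r hw hx i, Finset.sum_add_distrib,
    Finset.sum_add_distrib, Finset.sum_add_distrib, ← Finset.mul_sum, ← Finset.mul_sum, Finset.sum_const, ← Finset.mul_sum,
    sum_inner_single_mul, sum_inner_single_mul, real_inner_self_eq_norm_sq, lap]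
  simp

end ConformalChange

section ConformalSolution

variable {N : ℕ} {c s p lam : ℝ} {w : Euc N → ℝ} {x : Euc N}

theorem lap_const_mul (K : ℝ) (w : Euc N → ℝ) (x : Euc N) : lap (fun y => K * w y) x = K * lap w x := by
  have h : ∀ (f : Euc N → ℝ) (y v : Euc N), fderiv ℝ (fun z => K * f z) y v = K * fderiv ℝ f y v := by
    intro f y v
    change fderiv ℝ (K • f) y v = _
    rw [fderiv_const_smul_field]
    simp
  rw [lap, lap, Finset.mul_sum]
  refine Finset.sum_congr rfl fun i _ => ?_
  simp_rw [h]

theorem rescaled_equation (hp : 1 < p) {M : ℝ} (hM : 0 < M) {A B W L : ℝ}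
    (h : L + (A * W + M * B * (|W| ^ (p - 1) * W)) = 0) :
    (M / 4) ^ (1 / (p - 1)) * L + (A * ((M / 4) ^ (1 / (p - 1)) * W) + 4 * B *
      (|(M / 4) ^ (1 / (p - 1)) * W| ^ (p - 1) * ((M / 4) ^ (1 / (p - 1)) * W))) = 0 := by
  set K := (M / 4) ^ (1 / (p - 1)) with hK
  have hK0 : 0 < K := by positivity
  have hKp : K ^ (p - 1) = M / 4 := by
    rw [hK, ← Real.rpow_mul (by positivity), one_div_mul_cancel (by linarith), Real.rpow_one]
  rw [abs_mul, abs_of_pos hK0, Real.mul_rpow hK0.le (abs_nonneg _), hKp]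
  linear_combination K * h

theorem hyperbolic_equation (hc : c = 4 * lam - N * (N - 2)) (hs : s = 2 - ((N : ℝ) - 2) / 2 * (p - 1))
    (hw : ContDiffOn ℝ 2 w (ball 0 1)) (hx : x ∈ ball (0 : Euc N) 1)
    (h : lap w x + (c * (discWeight x)⁻¹ ^ 2 * w x + 4 * discWeight x ^ (-s) * (|w x| ^ (p - 1) * w x)) = 0) :
    (discWeight x ^ 2 / 4) * lap (fun y => discWeight y ^ (((N : ℝ) - 2) / 2) * w y) x +
      ((N : ℝ) - 2) * (discWeight x / 2) * ⟪x, gradient (fun y => discWeight y ^ (((N : ℝ) - 2) / 2) * w y) x⟫ +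
      lam * (discWeight x ^ (((N : ℝ) - 2) / 2) * w x) +
      |discWeight x ^ (((N : ℝ) - 2) / 2) * w x| ^ (p - 1) * (discWeight x ^ (((N : ℝ) - 2) / 2) * w x) = 0 := by
  have h0 := discWeight_pos hx
  have hn : ‖x‖ ^ 2 = 1 - discWeight x := by
    rw [discWeight]
    ring
  rw [lap_discWeight_rpow_mul _ hw hx, gradient_discWeight_rpow_mul _ hw hx, inner_add_right,
    real_inner_smul_right, real_inner_smul_right, real_inner_self_eq_norm_sq, hn, abs_mul,
    Real.mul_rpow (abs_nonneg _) (abs_nonneg _), abs_of_pos (Real.rpow_pos_of_pos h0 _), ← Real.rpow_mul h0.le,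
    Real.rpow_sub h0, Real.rpow_sub h0, Real.rpow_one, Real.rpow_two]
  have h2 : discWeight x ^ (((N : ℝ) - 2) / 2 * (p - 1)) = discWeight x ^ 2 * discWeight x ^ (-s) := by
    rw [← Real.rpow_two, ← Real.rpow_add h0, hs]
    congr 1
    ring
  rw [h2]
  set R := discWeight x ^ (((N : ℝ) - 2) / 2)
  set d := discWeight x
  set T := d ^ (-s)
  have h3 : lap w x = -(c * d⁻¹ ^ 2 * w x + 4 * T * (|w x| ^ (p - 1) * w x)) := by linarith
  rw [h3, hc]
  field_simp
  ring

theorem sq_discWeight_rpow (hN : 2 ≤ N) (hx : x ∈ ball (0 : Euc N) 1) :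
    (discWeight x ^ (((N : ℝ) - 2) / 2)) ^ 2 = discWeight x ^ (N - 2) := by
  rw [← Real.rpow_two, ← Real.rpow_mul (discWeight_pos hx).le, div_mul_cancel₀ _ (by norm_num),
    ← Real.rpow_natCast, Nat.cast_sub hN, Nat.cast_two]

theorem integrableOn_hyperbolic_sq (hN : 2 ≤ N)
    (hi : IntegrableOn (fun x => ((discWeight x)⁻¹ * w x) ^ 2) (ball (0 : Euc N) 1)) :
    IntegrableOn (fun x => (discWeight x ^ (((N : ℝ) - 2) / 2) * w x) ^ 2 * (2 / discWeight x) ^ N)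
      (ball (0 : Euc N) 1) := by
  refine IntegrableOn.congr_fun (hi.const_mul (2 ^ N)) (fun x hx => ?_) measurableSet_ball
  have h0 := discWeight_pos hx
  rw [mul_pow (discWeight x ^ _) (w x), sq_discWeight_rpow hN hx]
  obtain ⟨n, rfl⟩ := Nat.exists_eq_add_of_le hN
  rw [Nat.add_sub_cancel_left, div_pow, pow_add (discWeight x)]
  field_simp

theorem integrableOn_hyperbolic_gradient (hN : 2 ≤ N) (hw : ContDiffOn ℝ 2 w (ball 0 1))
    (hi : IntegrableOn (fun x => ((discWeight x)⁻¹ * w x) ^ 2) (ball (0 : Euc N) 1))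
    (hg : IntegrableOn (fun x => ‖gradient w x‖ ^ 2) (ball (0 : Euc N) 1)) :
    IntegrableOn (fun x => ‖gradient (fun y => discWeight y ^ (((N : ℝ) - 2) / 2) * w y) x‖ ^ 2 *
      (2 / discWeight x) ^ (N - 2)) (ball (0 : Euc N) 1) := by
  have hcw : ContinuousOn (fun x : Euc N => (discWeight x)⁻¹ * w x) (ball 0 1) :=
    (contDiffOn_inv_discWeight (n := 0)).continuousOn.mul hw.continuousOn
  have hcg : ContinuousOn (gradient w) (ball 0 1) :=
    (LinearIsometryEquiv.continuous _).comp_continuousOn (hw.continuousOn_fderiv_of_isOpen isOpen_ball (by norm_cast))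
  have h1 : IntegrableOn (fun x => ‖gradient w x - (((N : ℝ) - 2) * ((discWeight x)⁻¹ * w x)) • x‖ ^ 2)
      (ball (0 : Euc N) 1) := by
    refine Integrable.mono' ((hg.const_mul 2).add (hi.const_mul (2 * ((N : ℝ) - 2) ^ 2)))
      (((hcg.sub ((continuousOn_const.mul hcw).smul continuousOn_id)).norm.pow 2).aestronglyMeasurable
        measurableSet_ball) ?_
    filter_upwards [ae_restrict_mem measurableSet_ball] with x hx
    rw [Real.norm_of_nonneg (by positivity), Pi.add_apply]
    have h1 := norm_sub_le (gradient w x) ((((N : ℝ) - 2) * ((discWeight x)⁻¹ * w x)) • x)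
    have h2 : ‖(((N : ℝ) - 2) * ((discWeight x)⁻¹ * w x)) • x‖ ≤ |((N : ℝ) - 2) * ((discWeight x)⁻¹ * w x)| := by
      rw [norm_smul, Real.norm_eq_abs]
      exact mul_le_of_le_one_right (abs_nonneg _) (mem_ball_zero_iff.1 hx).le
    refine (pow_le_pow_left₀ (norm_nonneg _) (h1.trans (add_le_add_right h2 _)) 2).trans ?_
    refine le_of_le_of_eq add_sq_le ?_
    rw [sq_abs]
    ring
  refine IntegrableOn.congr_fun (h1.const_mul (2 ^ (N - 2))) (fun x hx => ?_) measurableSet_ball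
  have h0 := discWeight_pos hx
  have h2 : gradient (fun y => discWeight y ^ (((N : ℝ) - 2) / 2) * w y) x = discWeight x ^ (((N : ℝ) - 2) / 2) •
      (gradient w x - (((N : ℝ) - 2) * ((discWeight x)⁻¹ * w x)) • x) := by
    rw [gradient_discWeight_rpow_mul _ hw hx, smul_sub, smul_smul, sub_eq_add_neg (_ • _), ← neg_smul,
      Real.rpow_sub_one h0.ne']
    congr 2
    field_simp
  rw [h2, norm_smul, mul_pow ‖_‖ ‖_‖, Real.norm_eq_abs, sq_abs, sq_discWeight_rpow hN hx, div_pow]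
  field_simp

end ConformalSolution

section HyperbolicSolution

variable {N : ℕ} {p lam : ℝ}

theorem exists_pair_of_symmetric_profile (hN : 4 ≤ N) (hlam : lam < ((N : ℝ) - 1) ^ 2 / 4)
    (hp1 : 1 < p) (hp2 : p < ((N : ℝ) + 2) / ((N : ℝ) - 2)) {S : Type*} {g : S → Euc N ≃ₗᵢ[ℝ] Euc N}
    {sgn : S → ℝ} (hsgn : ∀ t, sgn t * sgn t = 1)
    (horb : ∀ M : ℕ, ∃ δ > (0 : ℝ), ∀ y : Euc N, 1 / 2 ≤ ‖y‖ → ∃ i : Fin M → S,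
      (∀ j, sgn (i j) = 1) ∧ ∀ j k, j ≠ k → δ ≤ ‖g (i j) y - g (i k) y‖)
    {φ : Euc N → ℝ} (hφ : φ ∈ testSpace N) (hφ0 : φ ≠ 0) (hφs : ∀ t x, φ (g t x) = sgn t * φ x)
    {t₀ : S} (ht₀ : sgn t₀ = -1) :
    ∃ u₁ u₂ : Euc N → ℝ, u₁ ≠ u₂ ∧ ∀ u : Euc N → ℝ, (u = u₁ ∨ u = u₂) →
      ContDiffOn ℝ 2 u (ball 0 1) ∧ (∃ x ∈ ball 0 1, u x ≠ 0) ∧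
      (∀ x ∈ ball 0 1, (discWeight x ^ 2 / 4) * lap u x +
        ((N : ℝ) - 2) * (discWeight x / 2) * ⟪x, gradient u x⟫ + lam * u x + |u x| ^ (p - 1) * u x = 0) ∧
      IntegrableOn (fun x => u x ^ 2 * (2 / discWeight x) ^ N) (ball 0 1) ∧
      IntegrableOn (fun x => ‖gradient u x‖ ^ 2 * (2 / discWeight x) ^ (N - 2)) (ball 0 1) ∧
      (∃ x ∈ ball 0 1, 0 < u x) ∧ (∃ x ∈ ball 0 1, u x < 0) ∧
      (∃ x ∈ ball 0 1, ∃ y ∈ ball 0 1, ‖x‖ = ‖y‖ ∧ u x ≠ u y) := by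
  have hN4 : (4 : ℝ) ≤ N := by exact_mod_cast hN
  have hN2 : (0 : ℝ) < (N : ℝ) - 2 := by linarith
  have hpN : p * ((N : ℝ) - 2) < N + 2 := (lt_div_iff₀ hN2).1 hp2
  obtain ⟨w, hw, ⟨M, hM, heq⟩, hsym, ⟨x₀, hx₀, hwx⟩, hi, hg⟩ :=
    exists_symmetric_classical_profile (N := N) (c := 4 * lam - N * (N - 2))
      (s := 2 - ((N : ℝ) - 2) / 2 * (p - 1)) (p := p) (by omega) (by nlinarith) (by nlinarith)
      (by nlinarith) hp1 hp2 (by rw [critExp]; field_simp; ring) hsgn horb hφ hφ0 hφs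
  set K := (M / 4) ^ (1 / (p - 1)) with hK
  have hK0 : 0 < K := by positivity
  have hball : ∀ {x : Euc N} t, x ∈ ball (0 : Euc N) 1 → g t x ∈ ball (0 : Euc N) 1 := by
    intro x t hx
    rw [mem_ball_zero_iff] at hx ⊢
    rwa [LinearIsometryEquiv.norm_map]
  have hgx : w (g t₀ x₀) = -w x₀ := by rw [hsym t₀ x₀ hx₀, ht₀, neg_one_mul]
  have hnn : ‖g t₀ x₀‖ = ‖x₀‖ := LinearIsometryEquiv.norm_map _ _
  have hdg : discWeight (g t₀ x₀) = discWeight x₀ := by rw [discWeight, discWeight, hnn]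
  have hD : 0 < discWeight x₀ ^ (((N : ℝ) - 2) / 2) := Real.rpow_pos_of_pos (discWeight_pos hx₀) _
  have main : ∀ e : ℝ, e * e = 1 → ∀ u : Euc N → ℝ,
      (u = fun y => discWeight y ^ (((N : ℝ) - 2) / 2) * (e * K * w y)) →
      ContDiffOn ℝ 2 u (ball 0 1) ∧ (∃ x ∈ ball 0 1, u x ≠ 0) ∧
      (∀ x ∈ ball 0 1, (discWeight x ^ 2 / 4) * lap u x +
        ((N : ℝ) - 2) * (discWeight x / 2) * ⟪x, gradient u x⟫ + lam * u x + |u x| ^ (p - 1) * u x = 0) ∧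
      IntegrableOn (fun x => u x ^ 2 * (2 / discWeight x) ^ N) (ball 0 1) ∧
      IntegrableOn (fun x => ‖gradient u x‖ ^ 2 * (2 / discWeight x) ^ (N - 2)) (ball 0 1) ∧
      (∃ x ∈ ball 0 1, 0 < u x) ∧ (∃ x ∈ ball 0 1, u x < 0) ∧
      (∃ x ∈ ball 0 1, ∃ y ∈ ball 0 1, ‖x‖ = ‖y‖ ∧ u x ≠ u y) := by
    rintro e he u hu
    have he0 : e ≠ 0 := by
      rintro rfl
      norm_num at he
    have hea : |e| = 1 := by
      rcases mul_self_eq_one_iff.1 he with rfl | rfl <;> simp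
    have hW : ContDiffOn ℝ 2 (fun y => e * K * w y) (ball 0 1) := contDiffOn_const.mul hw
    have hWi : IntegrableOn (fun x => ((discWeight x)⁻¹ * (e * K * w x)) ^ 2) (ball (0 : Euc N) 1) := by
      refine IntegrableOn.congr_fun (hi.const_mul ((e * K) ^ 2)) (fun x _ => ?_) measurableSet_ball
      ring
    have hWg : IntegrableOn (fun x => ‖gradient (fun y => e * K * w y) x‖ ^ 2) (ball (0 : Euc N) 1) := by
      refine IntegrableOn.congr_fun (hg.const_mul ((e * K) ^ 2)) (fun x _ => ?_) measurableSet_ball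
      have : gradient (fun y => e * K * w y) x = (e * K) • gradient w x := by
        refine ext_inner_right ℝ fun v => ?_
        rw [inner_gradient_eq_fderiv, real_inner_smul_left, inner_gradient_eq_fderiv]
        change fderiv ℝ ((e * K) • w) x v = _
        rw [fderiv_const_smul_field]
        simp
      rw [this, norm_smul, mul_pow ‖_‖ ‖_‖, Real.norm_eq_abs, sq_abs]
    have hux : u x₀ ≠ 0 := by
      rw [hu]
      exact mul_ne_zero hD.ne' (mul_ne_zero (mul_ne_zero he0 hK0.ne') hwx)
    have hug : u (g t₀ x₀) = -u x₀ := by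
      rw [hu]
      simp only
      rw [hgx, hdg]
      ring
    have hcs : ContDiffOn ℝ 2 u (ball 0 1) := by
      rw [hu]
      exact (contDiff_discWeight.contDiffOn.rpow_const_of_ne fun x hx => (discWeight_pos hx).ne').mul hW
    refine ⟨hcs, ⟨x₀, hx₀, hux⟩, fun x hx => ?_, ?_, ?_, ?_, ?_, x₀, hx₀, g t₀ x₀, hball t₀ hx₀, hnn.symm, ?_⟩
    · rw [hu]
      refine hyperbolic_equation (c := 4 * lam - N * (N - 2)) rfl rfl hW hx ?_
      have h1 := rescaled_equation hp1 hM (heq x hx)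
      rw [lap_const_mul, abs_mul (e * K), abs_mul e, hea, one_mul, ← abs_of_pos hK0, ← abs_mul]
      rw [abs_of_pos hK0]
      linear_combination e * h1
    · rw [hu]
      exact integrableOn_hyperbolic_sq (by omega) hWi
    · rw [hu]
      exact integrableOn_hyperbolic_gradient (by omega) hW hWi hWg
    · rcases lt_or_gt_of_ne hux with h | h
      · exact ⟨_, hball t₀ hx₀, by rw [hug]; linarith⟩
      · exact ⟨x₀, hx₀, h⟩
    · rcases lt_or_gt_of_ne hux with h | h
      · exact ⟨x₀, hx₀, h⟩
      · exact ⟨_, hball t₀ hx₀, by rw [hug]; linarith⟩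
    · rw [hug]
      exact fun h => hux (by linarith)
  refine ⟨fun y => discWeight y ^ (((N : ℝ) - 2) / 2) * (1 * K * w y),
    fun y => discWeight y ^ (((N : ℝ) - 2) / 2) * (-1 * K * w y), fun h => ?_, ?_⟩
  · have h1 := congrFun h x₀
    have h2 := mul_ne_zero hD.ne' (mul_ne_zero hK0.ne' hwx)
    exact h2 (by linarith)
  · rintro u (hu | hu)
    · exact main 1 (by norm_num) u hu
    · exact main (-1) (by norm_num) u hu

end HyperbolicSolution

section SymmetryData

variable {N : ℕ}

theorem exists_uniformly_separated_orbit {G : Set (Euc N ≃ₗᵢ[ℝ] Euc N)}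
    (hG : ∀ y : Euc N, y ≠ 0 → ((fun g : Euc N ≃ₗᵢ[ℝ] Euc N => g y) '' G).Infinite) (M : ℕ) :
    ∃ δ > (0 : ℝ), ∀ y : Euc N, 1 / 2 ≤ ‖y‖ → ∃ i : Fin M → Euc N ≃ₗᵢ[ℝ] Euc N,
      (∀ j, i j ∈ G) ∧ ∀ j k, j ≠ k → δ ≤ ‖i j y - i k y‖ := by
  have key : ∃ δ > (0 : ℝ), ∀ y ∈ sphere (0 : Euc N) 1, ∃ i : Fin M → Euc N ≃ₗᵢ[ℝ] Euc N,
      (∀ j, i j ∈ G) ∧ ∀ j k, j ≠ k → δ ≤ ‖i j y - i k y‖ := by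
    refine (isCompact_sphere (0 : Euc N) 1).induction_on
      (p := fun s => ∃ δ > (0 : ℝ), ∀ y ∈ s, ∃ i : Fin M → Euc N ≃ₗᵢ[ℝ] Euc N,
        (∀ j, i j ∈ G) ∧ ∀ j k, j ≠ k → δ ≤ ‖i j y - i k y‖) ⟨1, one_pos, by simp⟩ ?_ ?_ ?_
    · rintro s t hst ⟨δ, hδ, h⟩
      exact ⟨δ, hδ, fun y hy => h y (hst hy)⟩
    · rintro s t ⟨δ, hδ, h⟩ ⟨δ', hδ', h'⟩
      refine ⟨min δ δ', lt_min hδ hδ', fun y hy => ?_⟩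
      rcases hy with hy | hy
      · obtain ⟨i, hi, hs⟩ := h y hy
        exact ⟨i, hi, fun j k hjk => (min_le_left _ _).trans (hs j k hjk)⟩
      · obtain ⟨i, hi, hs⟩ := h' y hy
        exact ⟨i, hi, fun j k hjk => (min_le_right _ _).trans (hs j k hjk)⟩
    · intro y hy
      have hy0 : y ≠ 0 := ne_of_mem_sphere hy one_ne_zero
      let e := (hG y hy0).natEmbedding
      choose i hi hie using fun j : Fin M => (e j).2
      have hne : ∀ j k, j ≠ k → 0 < ‖i j y - i k y‖ := by
        intro j k hjk
        rw [norm_pos_iff, sub_ne_zero]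
        intro h
        refine hjk (Fin.ext (e.injective (Subtype.ext ?_)))
        rw [← hie, ← hie]
        exact h
      have hev : ∀ᶠ δ : ℝ in 𝓝[>] 0, ∀ j k, j ≠ k → δ < ‖i j y - i k y‖ := by
        simp only [eventually_all]
        intro j k hjk
        exact (eventually_lt_nhds (hne j k hjk)).filter_mono nhdsWithin_le_nhds
      obtain ⟨δ, hδ, hδ0⟩ := (hev.and self_mem_nhdsWithin).exists
      refine ⟨{z | ∀ j k, j ≠ k → δ < ‖i j z - i k z‖}, mem_nhdsWithin_of_mem_nhds ?_, δ, hδ0, fun z hz =>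
        ⟨i, hi, fun j k hjk => (hz j k hjk).le⟩⟩
      change ∀ᶠ z in 𝓝 y, ∀ j k, j ≠ k → δ < ‖i j z - i k z‖
      simp only [eventually_all]
      intro j k hjk
      have hc : Continuous fun z => ‖i j z - i k z‖ :=
        ((i j).continuous.sub (i k).continuous).norm
      exact hc.continuousAt.eventually_const_lt (hδ j k hjk)
  obtain ⟨δ, hδ, h⟩ := key
  refine ⟨δ / 2, by positivity, fun y hy => ?_⟩
  have hy0 : y ≠ 0 := by
    rintro rfl
    norm_num at hy
  obtain ⟨i, hi, hs⟩ := h (‖y‖⁻¹ • y) (by simp [norm_smul, hy0])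
  refine ⟨i, hi, fun j k hjk => ?_⟩
  have h1 := hs j k hjk
  rw [map_smul, map_smul, ← smul_sub, norm_smul, norm_inv, norm_norm, inv_mul_eq_div,
    le_div_iff₀ (norm_pos_iff.2 hy0)] at h1
  nlinarith

theorem exists_radial_localization {P : Euc N → ℝ} (hP : ContDiff ℝ ∞ P) {x₀ : Euc N} (hx₀ : ‖x₀‖ ≤ 1 / 2)
    (hP₀ : P x₀ ≠ 0) : ∃ φ ∈ testSpace N, φ ≠ 0 ∧ ∀ (g : Euc N ≃ₗᵢ[ℝ] Euc N) (e : ℝ),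
      (∀ x, P (g x) = e * P x) → ∀ x, φ (g x) = e * φ x := by
  let η : ContDiffBump (0 : ℝ) := ⟨1 / 4, 1 / 2, by norm_num, by norm_num⟩
  have hsub : tsupport (fun x : Euc N => η (‖x‖ ^ 2) * P x) ⊆ {x | ‖x‖ ^ 2 ≤ 1 / 2} := by
    refine closure_minimal (fun x hx => ?_) (isClosed_le (by fun_prop) continuous_const)
    by_contra h
    refine hx ?_
    simp only [mem_ofPred_eq, not_le] at h
    simp only
    rw [η.zero_of_le_dist, zero_mul]
    rw [Real.dist_0_eq_abs, abs_of_nonneg (by positivity)]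
    exact h.le
  have hball : {x : Euc N | ‖x‖ ^ 2 ≤ 1 / 2} ⊆ ball 0 1 := by
    intro x hx
    rw [mem_ofPred_eq] at hx
    rw [mem_ball_zero_iff]
    nlinarith [norm_nonneg x]
  refine ⟨fun x => η (‖x‖ ^ 2) * P x, ⟨?_, ?_, hsub.trans hball⟩, fun h => ?_, fun g e hg x => ?_⟩
  · exact (η.contDiff.comp (contDiff_norm_sq ℝ)).mul hP
  · exact (isCompact_closedBall (0 : Euc N) 1).of_isClosed_subset (isClosed_tsupport _)
      ((hsub.trans hball).trans ball_subset_closedBall)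
  · have h1 := congrFun h x₀
    simp only [Pi.zero_apply] at h1
    rw [η.one_of_mem_closedBall, one_mul] at h1
    · exact hP₀ h1
    · rw [mem_closedBall, Real.dist_0_eq_abs, abs_of_nonneg (by positivity)]
      change _ ≤ (1 / 4 : ℝ)
      nlinarith [norm_nonneg x₀]
  · simp only
    rw [LinearIsometryEquiv.norm_map, hg]
    ring

theorem exists_pair_of_symmetric_function {p lam : ℝ} (hN : 4 ≤ N) (hlam : lam < ((N : ℝ) - 1) ^ 2 / 4)
    (hp1 : 1 < p) (hp2 : p < ((N : ℝ) + 2) / ((N : ℝ) - 2)) {P : Euc N → ℝ} (hP : ContDiff ℝ ∞ P)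
    {x₀ : Euc N} (hx₀ : ‖x₀‖ ≤ 1 / 2) (hP₀ : P x₀ ≠ 0)
    (horb : ∀ y : Euc N, y ≠ 0 →
      ((fun g : Euc N ≃ₗᵢ[ℝ] Euc N => g y) '' {g | ∀ x, P (g x) = P x}).Infinite)
    {σ : Euc N ≃ₗᵢ[ℝ] Euc N} (hσ : ∀ x, P (σ x) = -P x) :
    ∃ u₁ u₂ : Euc N → ℝ, u₁ ≠ u₂ ∧ ∀ u : Euc N → ℝ, (u = u₁ ∨ u = u₂) →
      ContDiffOn ℝ 2 u (ball 0 1) ∧ (∃ x ∈ ball 0 1, u x ≠ 0) ∧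
      (∀ x ∈ ball 0 1, (discWeight x ^ 2 / 4) * lap u x +
        ((N : ℝ) - 2) * (discWeight x / 2) * ⟪x, gradient u x⟫ + lam * u x + |u x| ^ (p - 1) * u x = 0) ∧
      IntegrableOn (fun x => u x ^ 2 * (2 / discWeight x) ^ N) (ball 0 1) ∧
      IntegrableOn (fun x => ‖gradient u x‖ ^ 2 * (2 / discWeight x) ^ (N - 2)) (ball 0 1) ∧
      (∃ x ∈ ball 0 1, 0 < u x) ∧ (∃ x ∈ ball 0 1, u x < 0) ∧
      (∃ x ∈ ball 0 1, ∃ y ∈ ball 0 1, ‖x‖ = ‖y‖ ∧ u x ≠ u y) := by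
  obtain ⟨φ, hφ, hφ0, hφs⟩ := exists_radial_localization hP hx₀ hP₀
  refine exists_pair_of_symmetric_profile hN hlam hp1 hp2
    (S := {q : (Euc N ≃ₗᵢ[ℝ] Euc N) × ℝ // q.2 * q.2 = 1 ∧ ∀ x, P (q.1 x) = q.2 * P x})
    (g := fun q => q.1.1) (sgn := fun q => q.1.2) (fun q => q.2.1) (fun M => ?_) hφ hφ0
    (fun q => hφs q.1.1 q.1.2 q.2.2) (t₀ := ⟨(σ, -1), by norm_num, fun x => by simp [hσ x]⟩) rfl
  obtain ⟨δ, hδ, h⟩ := exists_uniformly_separated_orbit horb M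
  refine ⟨δ, hδ, fun y hy => ?_⟩
  obtain ⟨i, hi, hs⟩ := h y hy
  exact ⟨fun j => ⟨(i j, 1), one_mul 1, fun x => by rw [one_mul]; exact hi j x⟩, fun j => rfl, hs⟩

end SymmetryData

section SymmetryGroups

variable {N : ℕ}

theorem exists_linearIsometryEquiv_apply (T : Euc N → Fin N → ℝ) (hadd : ∀ x y i, T (x + y) i = T x i + T y i)
    (hsmul : ∀ (r : ℝ) x i, T (r • x) i = r * T x i) (hT : ∀ x, ∑ i, T x i ^ 2 = ∑ i, x i ^ 2) :
    ∃ g : Euc N ≃ₗᵢ[ℝ] Euc N, ∀ x i, g x i = T x i := by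
  let f : Euc N →ₗ[ℝ] Euc N :=
    { toFun := fun x => WithLp.toLp 2 (T x)
      map_add' := fun x y => by ext i; simp [hadd]
      map_smul' := fun r x => by ext i; simp [hsmul] }
  let h : Euc N →ₗᵢ[ℝ] Euc N := ⟨f, fun x => by
    rw [← sq_eq_sq₀ (norm_nonneg _) (norm_nonneg _), EuclideanSpace.real_norm_sq_eq, EuclideanSpace.real_norm_sq_eq]
    exact hT x⟩
  exact ⟨h.toLinearIsometryEquiv rfl, fun x i => rfl⟩

theorem exists_planeRotation {k l : Fin N} (hkl : k ≠ l) (t : ℝ) :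
    ∃ g : Euc N ≃ₗᵢ[ℝ] Euc N, ∀ x, g x k = Real.cos t * x k - Real.sin t * x l ∧
      g x l = Real.sin t * x k + Real.cos t * x l ∧ ∀ i, i ≠ k → i ≠ l → g x i = x i := by
  obtain ⟨g, hg⟩ := exists_linearIsometryEquiv_apply (N := N)
    (fun x i => if i = k then Real.cos t * x k - Real.sin t * x l else
      if i = l then Real.sin t * x k + Real.cos t * x l else x i)
    (fun x y i => by simp only [PiLp.add_apply]; split_ifs <;> ring)
    (fun r x i => by simp only [PiLp.smul_apply, smul_eq_mul]; split_ifs <;> ring)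
    (fun x => by
      rw [← sub_eq_zero, ← Finset.sum_sub_distrib, Fintype.sum_eq_add k l hkl]
      · simp only [if_true, if_neg hkl.symm]
        linear_combination (x k ^ 2 + x l ^ 2) * Real.sin_sq_add_cos_sq t
      · rintro i ⟨h1, h2⟩
        simp only [if_neg h1, if_neg h2, sub_self])
  refine ⟨g, fun x => ⟨?_, ?_, fun i h1 h2 => ?_⟩⟩
  · rw [hg, if_pos rfl]
  · rw [hg, if_neg hkl.symm, if_pos rfl]
  · rw [hg, if_neg h1, if_neg h2]

theorem infinite_orbit_of_curve {G : Set (Euc N ≃ₗᵢ[ℝ] Euc N)} {y : Euc N} {k : Fin N} {γ : ℝ → ℝ}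
    (hγ : Continuous γ) (hG : ∀ t, ∃ g ∈ G, g y k = γ t) {a b : ℝ} (hab : γ a ≠ γ b) :
    ((fun g : Euc N ≃ₗᵢ[ℝ] Euc N => g y) '' G).Infinite := by
  refine Set.Infinite.of_image (fun z : Euc N => z k) (Set.Infinite.mono (s := range γ) ?_ ?_)
  · rintro _ ⟨t, rfl⟩
    obtain ⟨g, hg, h⟩ := hG t
    exact ⟨g y, ⟨g, hg, rfl⟩, h⟩
  · exact (isPreconnected_range hγ).infinite_of_nontrivial ⟨γ a, ⟨a, rfl⟩, γ b, ⟨b, rfl⟩, hab⟩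

theorem infinite_orbit_of_planeRotation {G : Set (Euc N ≃ₗᵢ[ℝ] Euc N)} {y : Euc N} {k l : Fin N} (hkl : k ≠ l)
    (hG : ∀ (t : ℝ) (g : Euc N ≃ₗᵢ[ℝ] Euc N), (∀ x, g x k = Real.cos t * x k - Real.sin t * x l ∧
      g x l = Real.sin t * x k + Real.cos t * x l ∧ ∀ i, i ≠ k → i ≠ l → g x i = x i) → g ∈ G) (hy : y k ≠ 0) :
    ((fun g : Euc N ≃ₗᵢ[ℝ] Euc N => g y) '' G).Infinite := by
  refine infinite_orbit_of_curve (k := k) (γ := fun t => Real.cos t * y k - Real.sin t * y l) (by fun_prop)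
    (fun t => ?_) (a := 0) (b := Real.pi) ?_
  · obtain ⟨g, hg⟩ := exists_planeRotation hkl t
    exact ⟨g, hG t g hg, (hg y).1⟩
  · simp only [Real.cos_zero, Real.sin_zero, Real.cos_pi, Real.sin_pi]
    intro h
    exact hy (by linarith)

theorem exists_symmetric_quadratic (hN : 4 ≤ N) (hN5 : N ≠ 5) : ∃ P : Euc N → ℝ, ContDiff ℝ ∞ P ∧
    (∃ x₀, ‖x₀‖ ≤ 1 / 2 ∧ P x₀ ≠ 0) ∧
    (∀ y : Euc N, y ≠ 0 → ((fun g : Euc N ≃ₗᵢ[ℝ] Euc N => g y) '' {g | ∀ x, P (g x) = P x}).Infinite) ∧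
    ∃ σ : Euc N ≃ₗᵢ[ℝ] Euc N, ∀ x, P (σ x) = -P x := by
  obtain ⟨n, rfl⟩ := Nat.exists_eq_add_of_le' hN
  let a : Fin (n + 4) := ⟨0, by omega⟩
  let b : Fin (n + 4) := ⟨1, by omega⟩
  let c : Fin (n + 4) := ⟨2, by omega⟩
  let d : Fin (n + 4) := ⟨3, by omega⟩
  have hab : a ≠ b := by simp [a, b]
  have hac : a ≠ c := by simp [a, c]
  have had : a ≠ d := by simp [a, d]
  have hbc : b ≠ c := by simp [b, c]
  have hbd : b ≠ d := by simp [b, d]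
  have hcd : c ≠ d := by simp [c, d]
  refine ⟨fun x => x a ^ 2 + x b ^ 2 - x c ^ 2 - x d ^ 2, by fun_prop,
    ⟨EuclideanSpace.single a (1 / 2), ?_, ?_⟩, fun y hy => ?_,
    LinearIsometryEquiv.piLpCongrLeft 2 ℝ ℝ (Equiv.swap a c * Equiv.swap b d), fun x => ?_⟩
  · simp
  · simp [hab.symm, hac.symm, had.symm]
  · obtain ⟨k, hk⟩ : ∃ k, y k ≠ 0 := by
      by_contra! h
      exact hy (by ext i; simp [h i])
    by_cases h1 : k = a
    · subst h1
      refine infinite_orbit_of_planeRotation hab (fun t g hg x => ?_) hk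
      obtain ⟨h1, h2, h3⟩ := hg x
      simp only
      rw [h1, h2, h3 c hac.symm hbc.symm, h3 d had.symm hbd.symm]
      linear_combination (x a ^ 2 + x b ^ 2) * Real.sin_sq_add_cos_sq t
    by_cases h2 : k = b
    · subst h2
      refine infinite_orbit_of_planeRotation hab.symm (fun t g hg x => ?_) hk
      obtain ⟨h1, h2, h3⟩ := hg x
      simp only
      rw [h1, h2, h3 c hbc.symm hac.symm, h3 d hbd.symm had.symm]
      linear_combination (x b ^ 2 + x a ^ 2) * Real.sin_sq_add_cos_sq t
    by_cases h3 : k = c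
    · subst h3
      refine infinite_orbit_of_planeRotation hcd (fun t g hg x => ?_) hk
      obtain ⟨h1, h2, h3⟩ := hg x
      simp only
      rw [h1, h2, h3 a hac had, h3 b hbc hbd]
      linear_combination -(x c ^ 2 + x d ^ 2) * Real.sin_sq_add_cos_sq t
    by_cases h4 : k = d
    · subst h4
      refine infinite_orbit_of_planeRotation hcd.symm (fun t g hg x => ?_) hk
      obtain ⟨h1, h2, h3⟩ := hg x
      simp only
      rw [h1, h2, h3 a had hac, h3 b hbd hbc]
      linear_combination -(x d ^ 2 + x c ^ 2) * Real.sin_sq_add_cos_sq t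
    obtain ⟨l, hl, hkl⟩ : ∃ l : Fin (n + 4), 4 ≤ l.1 ∧ k ≠ l := by
      by_cases h5 : k.1 = 4
      · have := k.2
        exact ⟨⟨5, by omega⟩, by simp, by simp [Fin.ext_iff, h5]⟩
      · have := k.2
        simp only [Fin.ext_iff, a, b, c, d] at h1 h2 h3 h4
        exact ⟨⟨4, by omega⟩, by simp, by simp [Fin.ext_iff, h5]⟩
    have hla : ∀ i : Fin (n + 4), i.1 < 4 → i ≠ l := by
      rintro i hi rfl
      omega
    refine infinite_orbit_of_planeRotation hkl (fun t g hg x => ?_) hk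
    obtain ⟨-, -, h⟩ := hg x
    simp only
    rw [h a (Ne.symm h1) (hla a (by simp [a])), h b (Ne.symm h2) (hla b (by simp [b])),
      h c (Ne.symm h3) (hla c (by simp [c])), h d (Ne.symm h4) (hla d (by simp [d]))]
  · have hval : ∀ i, LinearIsometryEquiv.piLpCongrLeft 2 ℝ ℝ (Equiv.swap a c * Equiv.swap b d) x i =
        x ((Equiv.swap a c * Equiv.swap b d).symm i) := fun i => rfl
    have h1 : (Equiv.swap a c * Equiv.swap b d).symm a = c := by
      rw [Equiv.symm_apply_eq]
      simp [Equiv.swap_apply_of_ne_of_ne hbc.symm hcd]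
    have h2 : (Equiv.swap a c * Equiv.swap b d).symm b = d := by
      rw [Equiv.symm_apply_eq]
      simp [Equiv.swap_apply_of_ne_of_ne hab.symm hbc]
    have h3 : (Equiv.swap a c * Equiv.swap b d).symm c = a := by
      rw [Equiv.symm_apply_eq]
      simp [Equiv.swap_apply_of_ne_of_ne hab had]
    have h4 : (Equiv.swap a c * Equiv.swap b d).symm d = b := by
      rw [Equiv.symm_apply_eq]
      simp [Equiv.swap_apply_of_ne_of_ne had.symm hcd.symm]
    simp only [hval, h1, h2, h3, h4]
    ring

end SymmetryGroups

section CubicSymmetry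

/-- A multiple of the determinant on traceless symmetric `3 × 3` matrices, in orthonormal coordinates. -/
noncomputable def detCubic (x : Euc 5) : ℝ :=
  -(2 / 3) * x 0 ^ 3 + 2 * x 0 * (x 1 ^ 2 + x 2 ^ 2) - x 0 * (x 3 ^ 2 + x 4 ^ 2) +
    √3 * (x 1 * (x 3 ^ 2 - x 4 ^ 2) + 2 * x 2 * x 3 * x 4)

theorem exists_detCubic_rotation (t : ℝ) : ∃ g : Euc 5 ≃ₗᵢ[ℝ] Euc 5, (∀ x, detCubic (g x) = detCubic x) ∧
    ∀ x, g x 1 = Real.cos (2 * t) * x 1 - Real.sin (2 * t) * x 2 ∧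
      g x 2 = Real.sin (2 * t) * x 1 + Real.cos (2 * t) * x 2 ∧
      g x 3 = Real.cos t * x 3 - Real.sin t * x 4 ∧ g x 4 = Real.sin t * x 3 + Real.cos t * x 4 := by
  obtain ⟨g, hg⟩ := exists_linearIsometryEquiv_apply (N := 5)
    (fun x => ![x 0, Real.cos (2 * t) * x 1 - Real.sin (2 * t) * x 2,
      Real.sin (2 * t) * x 1 + Real.cos (2 * t) * x 2, Real.cos t * x 3 - Real.sin t * x 4,
      Real.sin t * x 3 + Real.cos t * x 4])
    (fun x y i => by fin_cases i <;> simp <;> ring) (fun r x i => by fin_cases i <;> simp <;> ring)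
    (fun x => by
      simp [Fin.sum_univ_five]
      linear_combination (x 1 ^ 2 + x 2 ^ 2) * Real.sin_sq_add_cos_sq (2 * t) +
        (x 3 ^ 2 + x 4 ^ 2) * Real.sin_sq_add_cos_sq t)
  have h0 : ∀ x, g x 0 = x 0 := fun x => hg x 0
  have h1 : ∀ x, g x 1 = Real.cos (2 * t) * x 1 - Real.sin (2 * t) * x 2 := fun x => hg x 1
  have h2 : ∀ x, g x 2 = Real.sin (2 * t) * x 1 + Real.cos (2 * t) * x 2 := fun x => hg x 2
  have h3 : ∀ x, g x 3 = Real.cos t * x 3 - Real.sin t * x 4 := fun x => hg x 3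
  have h4 : ∀ x, g x 4 = Real.sin t * x 3 + Real.cos t * x 4 := fun x => hg x 4
  refine ⟨g, fun x => ?_, fun x => ⟨h1 x, h2 x, h3 x, h4 x⟩⟩
  rw [detCubic, detCubic, h0, h1, h2, h3, h4, Real.cos_two_mul', Real.sin_two_mul]
  have h := Real.cos_sq' t
  set S := Real.sin t
  set C := Real.cos t
  have e4 : C ^ 4 = (1 - S ^ 2) ^ 2 := by rw [← h]; ring
  ring_nf
  simp only [h, e4]
  ring

theorem exists_detCubic_permutation : ∃ g : Euc 5 ≃ₗᵢ[ℝ] Euc 5, (∀ x, detCubic (g x) = detCubic x) ∧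
    ∀ x, x 1 = 0 → g x 1 = √3 / 2 * x 0 := by
  have hs : √3 ^ 2 = 3 := Real.sq_sqrt (by norm_num)
  obtain ⟨g, hg⟩ := exists_linearIsometryEquiv_apply (N := 5)
    (fun x => ![-(x 0 + √3 * x 1) / 2, (√3 * x 0 - x 1) / 2, x 4, x 2, x 3])
    (fun x y i => by fin_cases i <;> simp <;> ring) (fun r x i => by fin_cases i <;> simp <;> ring)
    (fun x => by
      simp [Fin.sum_univ_five]
      linear_combination (x 0 ^ 2 + x 1 ^ 2) / 4 * hs)
  have h0 : ∀ x, g x 0 = -(x 0 + √3 * x 1) / 2 := fun x => hg x 0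
  have h1 : ∀ x, g x 1 = (√3 * x 0 - x 1) / 2 := fun x => hg x 1
  have h2 : ∀ x, g x 2 = x 4 := fun x => hg x 2
  have h3 : ∀ x, g x 3 = x 2 := fun x => hg x 3
  have h4 : ∀ x, g x 4 = x 3 := fun x => hg x 4
  refine ⟨g, fun x => ?_, fun x hx => ?_⟩
  · rw [detCubic, detCubic, h0, h1, h2, h3, h4]
    have hs3 : √3 ^ 3 = 3 * √3 := by rw [pow_succ, hs]
    ring_nf
    simp only [hs, hs3]
    ring
  · rw [h1, hx]
    ring

theorem infinite_orbit_detCubic_of_ne_zero {y : Euc 5} (hy : y 1 ≠ 0 ∨ y 2 ≠ 0 ∨ y 3 ≠ 0 ∨ y 4 ≠ 0) :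
    ((fun g : Euc 5 ≃ₗᵢ[ℝ] Euc 5 => g y) '' {g | ∀ x, detCubic (g x) = detCubic x}).Infinite := by
  choose g hg hgx using exists_detCubic_rotation
  have ht : 2 * (Real.pi / 2) = Real.pi := by ring
  rcases hy with hy | hy | hy | hy
  · refine infinite_orbit_of_curve (by fun_prop) (fun t => ⟨g t, hg t, (hgx t y).1⟩) (a := 0) (b := Real.pi / 2) ?_
    simp only [ht, mul_zero, Real.cos_zero, Real.sin_zero, Real.cos_pi, Real.sin_pi]
    exact fun h => hy (by linarith)
  · refine infinite_orbit_of_curve (by fun_prop) (fun t => ⟨g t, hg t, (hgx t y).2.1⟩) (a := 0)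
      (b := Real.pi / 2) ?_
    simp only [ht, mul_zero, Real.cos_zero, Real.sin_zero, Real.cos_pi, Real.sin_pi]
    exact fun h => hy (by linarith)
  · refine infinite_orbit_of_curve (by fun_prop) (fun t => ⟨g t, hg t, (hgx t y).2.2.1⟩) (a := 0)
      (b := Real.pi) ?_
    simp only [Real.cos_zero, Real.sin_zero, Real.cos_pi, Real.sin_pi]
    exact fun h => hy (by linarith)
  · refine infinite_orbit_of_curve (by fun_prop) (fun t => ⟨g t, hg t, (hgx t y).2.2.2⟩) (a := 0)
      (b := Real.pi) ?_
    simp only [Real.cos_zero, Real.sin_zero, Real.cos_pi, Real.sin_pi]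
    exact fun h => hy (by linarith)

theorem infinite_orbit_detCubic {y : Euc 5} (hy : y ≠ 0) :
    ((fun g : Euc 5 ≃ₗᵢ[ℝ] Euc 5 => g y) '' {g | ∀ x, detCubic (g x) = detCubic x}).Infinite := by
  by_cases h : y 1 ≠ 0 ∨ y 2 ≠ 0 ∨ y 3 ≠ 0 ∨ y 4 ≠ 0
  · exact infinite_orbit_detCubic_of_ne_zero h
  push Not at h
  obtain ⟨h1, h2, h3, h4⟩ := h
  have h0 : y 0 ≠ 0 := by
    intro h0
    refine hy ?_
    ext i
    fin_cases i <;> assumption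
  obtain ⟨c, hc, hcy⟩ := exists_detCubic_permutation
  refine (infinite_orbit_detCubic_of_ne_zero (y := c y) (Or.inl ?_)).mono ?_
  · rw [hcy y h1]
    exact mul_ne_zero (by positivity) h0
  · rintro _ ⟨g, hg, rfl⟩
    exact ⟨c.trans g, fun x => (hg (c x)).trans (hc x), rfl⟩

theorem exists_symmetric_function {N : ℕ} (hN : 4 ≤ N) : ∃ P : Euc N → ℝ, ContDiff ℝ ∞ P ∧
    (∃ x₀, ‖x₀‖ ≤ 1 / 2 ∧ P x₀ ≠ 0) ∧
    (∀ y : Euc N, y ≠ 0 → ((fun g : Euc N ≃ₗᵢ[ℝ] Euc N => g y) '' {g | ∀ x, P (g x) = P x}).Infinite) ∧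
    ∃ σ : Euc N ≃ₗᵢ[ℝ] Euc N, ∀ x, P (σ x) = -P x := by
  rcases ne_or_eq N 5 with h5 | rfl
  · exact exists_symmetric_quadratic hN h5
  · refine ⟨detCubic, by unfold detCubic; fun_prop, ⟨EuclideanSpace.single 0 (1 / 2), by simp, ?_⟩,
      fun y => infinite_orbit_detCubic, LinearIsometryEquiv.neg ℝ, fun x => ?_⟩
    · simp [detCubic]
    · simp [detCubic]
      ring

end CubicSymmetry

end

/-- For `N ≥ 4`, the equation `-Δ_{𝔹^N} u - λ u = |u|^{p-1} u` (written in the Poincaré ball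
model) admits at least two distinct nontrivial `C²` solutions in `H¹(𝔹^N)`, each sign-changing
and non-radial. -/
theorem two_nonradial_sign_changing_hyperbolic
    (N : ℕ) (hN : 4 ≤ N) (lam p : ℝ) (hlam : lam < ((N : ℝ) - 1) ^ 2 / 4)
    (hp1 : 1 < p) (hp2 : p < ((N : ℝ) + 2) / ((N : ℝ) - 2)) :
    ∃ u₁ u₂ : EuclideanSpace ℝ (Fin N) → ℝ,
      u₁ ≠ u₂ ∧
      (∀ u : EuclideanSpace ℝ (Fin N) → ℝ, (u = u₁ ∨ u = u₂) →
        -- u is C² on the open unit ball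
        ContDiffOn ℝ 2 u {x : EuclideanSpace ℝ (Fin N) | ‖x‖ < 1} ∧
        -- u is not identically zero on the ball
        (∃ x : EuclideanSpace ℝ (Fin N), ‖x‖ < 1 ∧ u x ≠ 0) ∧
        -- the equation in ball-model form
        (∀ x : EuclideanSpace ℝ (Fin N), ‖x‖ < 1 →
          ((1 - ‖x‖ ^ 2) ^ 2 / 4) * lap u x +
            ((N : ℝ) - 2) * ((1 - ‖x‖ ^ 2) / 2) * ⟪x, gradient u x⟫ +
            lam * u x + |u x| ^ (p - 1) * u x = 0) ∧
        -- u ∈ L² of hyperbolic space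
        MeasureTheory.IntegrableOn
          (fun x : EuclideanSpace ℝ (Fin N) => u x ^ 2 * (2 / (1 - ‖x‖ ^ 2)) ^ N)
          {x : EuclideanSpace ℝ (Fin N) | ‖x‖ < 1} ∧
        -- the hyperbolic gradient of u is in L²
        MeasureTheory.IntegrableOn
          (fun x : EuclideanSpace ℝ (Fin N) => ‖gradient u x‖ ^ 2 * (2 / (1 - ‖x‖ ^ 2)) ^ (N - 2))
          {x : EuclideanSpace ℝ (Fin N) | ‖x‖ < 1} ∧
        -- sign-changing
        (∃ x, ‖x‖ < 1 ∧ 0 < u x) ∧ (∃ x, ‖x‖ < 1 ∧ u x < 0) ∧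
        -- non-radial
        (∃ x y : EuclideanSpace ℝ (Fin N), ‖x‖ < 1 ∧ ‖y‖ < 1 ∧ ‖x‖ = ‖y‖ ∧ u x ≠ u y)) := by
  obtain ⟨P, hP, ⟨x₀, hx₀, hP₀⟩, horb, σ, hσ⟩ := exists_symmetric_function hN
  obtain ⟨u₁, u₂, hne, hu⟩ := exists_pair_of_symmetric_function hN hlam hp1 hp2 hP hx₀ hP₀ horb hσ
  refine ⟨u₁, u₂, hne, fun u h => ?_⟩
  have hm : ∀ x : EuclideanSpace ℝ (Fin N), ‖x‖ < 1 ↔ x ∈ Metric.ball (0 : Euc N) 1 :=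
    fun x => mem_ball_zero_iff.symm
  simp only [hm, Set.ofPred_mem_eq]
  obtain ⟨h1, h2, h3, h4, h5, h6, h7, x, hx, y, hy, hxy, h8⟩ := hu u h
  exact ⟨h1, h2, h3, h4, h5, h6, h7, x, y, hx, hy, hxy, h8⟩
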